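/- Let a_1, …, a_s be positive integers with max{a_1, …, a_s} = 7 and set m = Σ_{i=1}^s (a_i − 1) + 1. If m ≥ 9, then m + 10 ≤ F_v(a_1, …, a_s; m − 1) ≤ m + 12. -/

import Mathlib

/-- `G →v (a₁, …, aₛ)`: for every coloring of the vertices of `G` with `s` colors there is a
color `i` and a monochromatic clique of size `aᵢ` in color `i`. The list `a` records
`a₁, …, aₛ`. -/
def VArrow {V : Type*} (G : SimpleGraph V) (a : List ℕ) : Prop :=
  ∀ c : V → Fin a.length, ∃ i : Fin a.length, ∃ s : Finset V,
    G.IsNClique (a.get i) s ∧ ∀ v ∈ s, c v = i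

/-- The vertex Folkman number `F_v(a₁, …, aₛ; q)`: the minimum number of vertices of a
`K_q`-free graph `G` with `G →v (a₁, …, aₛ)`. -/
noncomputable def folkman (a : List ℕ) (q : ℕ) : ℕ :=
  sInf {n : ℕ | ∃ G : SimpleGraph (Fin n), G.CliqueFree q ∧ VArrow G a}

namespace Folkman

/-! ### Kernel-friendly primitives -/

/-- Evaluate `n` to a numeral before passing it to `f`. -/
noncomputable def frc {α : Type} (n : ℕ) (f : ℕ → α) : α :=
  Nat.rec (f 0) (fun m _ => f m) (Nat.add n 1)

/-- Bit `i` of `m`. -/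
noncomputable def tb (m i : ℕ) : Bool := Nat.beq (Nat.land (Nat.shiftRight m i) 1) 1

/-- Partner of a vertex in the matching of the pairs `{2 * i, 2 * i + 1}`. -/
noncomputable def mate (v : ℕ) : ℕ :=
  bif Nat.beq (Nat.land v 1) 1 then Nat.pred v else Nat.succ v

noncomputable def nthN (l : List ℕ) (k : ℕ) : ℕ :=
  List.rec (fun _ => 0) (fun h _ ih k => Nat.rec h (fun m _ => ih m) k) l k

noncomputable def nthO {α : Type} (l : List α) (k : ℕ) : Option α :=
  List.rec (fun _ => none) (fun h _ ih k => Nat.rec (some h) (fun m _ => ih m) k) l k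

noncomputable def allL (f : ℕ → Bool) (l : List ℕ) : Bool :=
  List.rec true (fun e _ ih => bif f e then ih else false) l

noncomputable def allN (f : ℕ → Bool) (n : ℕ) : Bool :=
  Nat.rec true (fun i ih => bif f i then ih else false) n

/-- The number of bits of `m` below `n`. -/
noncomputable def cnt (m n : ℕ) : ℕ :=
  Nat.rec 0 (fun i ih => bif tb m i then Nat.succ ih else ih) n

/-- The five-bit field of `s` at position `i`. -/
noncomputable def fld (s i : ℕ) : ℕ := Nat.land (Nat.shiftRight s i) 31

noncomputable def ones (n : ℕ) : ℕ := Nat.pred (Nat.shiftLeft 1 n)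

/-! ### Tables of `k`-subsets of `range n`, indexed in the combinatorial number system -/

noncomputable def chs (n : ℕ) : ℕ → ℕ :=
  Nat.rec (fun k => Nat.rec 1 (fun _ _ => 0) k)
    (fun _ ih k => Nat.rec 1 (fun k _ => frc (ih (Nat.succ k)) fun x => frc (ih k) fun y =>
      Nat.add x y) k) n

/-- The set of indices of the `k`-subsets of `range n` containing `a`. -/
noncomputable def xt (a n : ℕ) : ℕ → ℕ :=
  Nat.rec (fun _ => 0) (fun n ih k => Nat.rec 0 (fun k _ =>
    bif Nat.beq n a then
      frc (chs n (Nat.succ k)) fun x => frc (chs n k) fun y => Nat.shiftLeft (ones y) x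
    else
      frc (ih (Nat.succ k)) fun x => frc (ih k) fun y => frc (chs n (Nat.succ k)) fun z =>
        Nat.lor x (Nat.shiftLeft y z)) k) n

noncomputable def tabs (n k : ℕ) {α : Type} (fuel : ℕ) : List ℕ → (List ℕ → α) → α :=
  Nat.rec (fun l f => f l) (fun m ih l f => frc (xt m n k) fun x => ih (List.cons x l) f) fuel

/-! ### Graphs as bit masks: bit `32 * i + j` records the pair `(i, j)` -/

noncomputable def hasE (E a b : ℕ) : Bool := tb E (Nat.add (Nat.mul 32 a) b)

noncomputable def addE (E a b : ℕ) : ℕ :=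
  Nat.lor E (Nat.lor (Nat.shiftLeft 1 (Nat.add (Nat.mul 32 a) b))
    (Nat.shiftLeft 1 (Nat.add (Nat.mul 32 b) a)))

noncomputable def row (E a : ℕ) : ℕ := Nat.land (Nat.shiftRight E (Nat.mul 32 a)) 4294967295

noncomputable def hi (e : ℕ) : ℕ := Nat.shiftRight e 5

noncomputable def lo (e : ℕ) : ℕ := Nat.land e 31

/-- The parameters of a refutation: `n` vertices, independent sets of size at most `p`, after the
deletion of `K` cliques there is still an independent set of size `F`, degrees at least `d`,
`tf` records triangle-freeness, the vertices in the mask `N` are paired by `mate`, with `NP`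
pairs, and `mx` lists the edges known from the start. -/
structure Ins where
  n : ℕ
  p : ℕ
  K : ℕ
  F : ℕ
  d : ℕ
  tf : Bool
  NP : ℕ
  N : ℕ
  mx : List ℕ

/-- Remaining input of a certificate reader. -/
abbrev Res := Option (ℕ × List ℕ)

noncomputable def bnd (o : Res) (f : ℕ → List ℕ → Res) : Res :=
  Option.rec none (fun q => Prod.rec f q) o

noncomputable def ret (s w : ℕ) (rest : List ℕ) : Res :=
  frc (Nat.shiftRight s w) fun s' => some (s', rest)

/-- Move on to the next block of the certificate if the current one is used up. -/
noncomputable def nxt (f : ℕ → List ℕ → Res) (s : ℕ) (rest : List ℕ) : Res :=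
  bif Nat.beq s 1 then List.rec none (fun s' rest' _ => f s' rest') rest else f s rest

/-! ### Case splitting on edges -/

noncomputable def addI (xs : List ℕ) (full I a b : ℕ) : ℕ :=
  Nat.land I (Nat.xor full (Nat.land (nthN xs a) (nthN xs b)))

noncomputable def hSplit (xs : List ℕ) (full : ℕ)
    (ih : ℕ → List ℕ → ℕ → ℕ → ℕ → List ℕ → Res)
    (E : ℕ) (L : List ℕ) (I E0 s : ℕ) (rest : List ℕ) : Res :=
  frc (fld s 3) fun a => frc (fld s 8) fun b =>
    bif Nat.beq a b then none else
    bnd (frc (addE E a b) fun E' => frc (addI xs full I a b) fun I' =>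
          frc (Nat.shiftRight s 13) fun s' => frc (Nat.add (Nat.mul 32 a) b) fun c =>
            ih E' (List.cons c L) I' E0 s' rest)
      fun s' rest' => frc (addE E0 a b) fun E0' => ih E L I E0' s' rest'

/-- Read `k` cliques from the certificate and pass on the set of indices of the sets meeting one
of them. -/
noncomputable def hCov (tf : Bool) (xs : List ℕ) (E : ℕ) (L : List ℕ) (f : ℕ → ℕ → Res) (k : ℕ) :
    ℕ → ℕ → Res :=
  Nat.rec f
    (fun _ ih M s => frc (Nat.land s 63) fun ix => frc (nthN L ix) fun e =>
      frc (hi e) fun a => frc (lo e) fun b =>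
        bif hasE E a b then
          frc (Nat.lor M (Nat.lor (nthN xs a) (nthN xs b))) fun M' =>
            bif tf then frc (Nat.shiftRight s 6) fun s' => ih M' s' else
              frc (fld s 6) fun c => frc (Nat.shiftRight s 11) fun s' =>
              bif Nat.beq c a then ih M' s' else
              bif hasE E a c then bif hasE E b c then
                frc (Nat.lor M' (nthN xs c)) fun M'' => ih M'' s'
              else none else none
        else none) k

noncomputable def hLeaf (I : ℕ) (rest : List ℕ) (M s : ℕ) : Res :=
  bif Nat.beq (Nat.land I M) I then some (s, rest) else none

/-- A set of positions of entries of `xs` that contain `R`. The kernel hashes numerals by their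
low 64 bits, which the tag `u` keeps distinct. -/
noncomputable def common (R u : ℕ) (xs : List ℕ) : ℕ :=
  frc (Nat.shiftLeft R 64) fun Q => frc (Nat.lor Q (Nat.land u 18446744073709551615)) fun R' =>
    List.rec 0 (fun x _ ih => frc ih fun T =>
      bif Nat.beq (Nat.land R' (Nat.shiftLeft x 64)) Q then Nat.succ (Nat.shiftLeft T 1)
      else Nat.shiftLeft T 1) xs

/-- Add all pairs of elements of `T` below `n`. -/
noncomputable def addT (E T n : ℕ) : ℕ :=
  Nat.rec E (fun a ih =>
    bif tb T a then Nat.lor ih (Nat.shiftLeft T (Nat.mul 32 a)) else ih) n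

/-- Any two elements common to all sets in `I` outside `M` are non-adjacent. -/
noncomputable def hComm (n : ℕ) (xs : List ℕ)
    (ih : ℕ → List ℕ → ℕ → ℕ → ℕ → List ℕ → Res)
    (E : ℕ) (L : List ℕ) (I E0 : ℕ) (rest : List ℕ) (M s : ℕ) : Res :=
  frc (Nat.xor I (Nat.land I M)) fun R => frc (Nat.land (common R s xs) 4294967295) fun T =>
    frc (addT E0 T n) fun E0' => ih E L I E0' s rest

noncomputable def hTri (n : ℕ) (tf : Bool) (E s : ℕ) (rest : List ℕ) : Res :=
  frc (fld s 3) fun a => frc (fld s 8) fun b => frc (fld s 13) fun c =>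
    bif tf then bif hasE E a b then bif hasE E b c then bif hasE E a c then
    bif Nat.blt a n then bif Nat.blt b n then bif Nat.blt c n then ret s 18 rest
    else none else none else none else none else none else none else none

noncomputable def hDeg (n d E0 s : ℕ) (rest : List ℕ) : Res :=
  frc (fld s 3) fun a => frc (Nat.lor (row E0 a) (Nat.shiftLeft 1 a)) fun m =>
    bif Nat.blt a n then bif Nat.blt n (Nat.add (cnt m n) d) then ret s 8 rest else none else none

noncomputable def hSet (n p E0 s : ℕ) (rest : List ℕ) : Res :=
  frc (Nat.land (Nat.shiftRight s 3) 1048575) fun m =>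
    bif Nat.blt p (cnt m n) then
      bif allN (fun i => bif tb m i then frc (Nat.xor m (Nat.shiftLeft 1 i)) fun m' =>
        Nat.beq (Nat.land (row E0 i) m') m' else true) n
      then ret s 23 rest else none
    else none

noncomputable def initE (l : List ℕ) : ℕ :=
  List.rec 0 (fun e _ E => addE E (hi e) (lo e)) l

/-- The elements of `m` adjacent to the images under `π` of the elements of `q`. -/
noncomputable def cands (E π fuel : ℕ) : ℕ → ℕ → ℕ :=
  Nat.rec (fun _ m => m) (fun _ ih q m => bif Nat.beq q 0 then m else
    frc (Nat.log2 q) fun u => frc (Nat.xor q (Nat.shiftLeft 1 u)) fun q' =>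
    frc (Nat.land m (row E (fld π (Nat.mul 5 u)))) fun m' => ih q' m') fuel

noncomputable def popCount (fuel : ℕ) : ℕ → ℕ :=
  Nat.rec (fun _ => 0) (fun _ ih m => bif Nat.beq m 0 then 0 else
    frc (Nat.xor m (Nat.shiftLeft 1 (Nat.log2 m))) fun m' => Nat.succ (ih m')) fuel

/-- The `(j + 1)`-st largest element of `m`. -/
noncomputable def pick (j : ℕ) : ℕ → ℕ :=
  Nat.rec (fun m => Nat.log2 m) (fun _ ih m =>
    frc (Nat.xor m (Nat.shiftLeft 1 (Nat.log2 m))) fun m' => ih m') j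

/-- Read a map from the graph `C` to the graph `E`, packed in five-bit fields. The image of a vertex
is given by its position among the unused vertices adjacent to the images of its earlier
neighbors. -/
noncomputable def hMap (n C E : ℕ) (f : ℕ → ℕ → Res) (fuel : ℕ) : ℕ → ℕ → ℕ → ℕ → Res :=
  Nat.rec (fun _ _ π s => f π s) (fun _ ih v U π s =>
    frc (cands E π n (Nat.land (row C v) (ones v)) U) fun m => frc (popCount n m) fun c =>
    frc (pick (Nat.mod s c) m) fun w => frc (Nat.div s c) fun s' =>
    frc (Nat.xor U (Nat.shiftLeft 1 w)) fun U' =>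
    frc (Nat.lor π (Nat.shiftLeft w (Nat.mul 5 v))) fun π' =>
    frc (Nat.succ v) fun v' => ih v' U' π' s') fuel

noncomputable def permOk (n π : ℕ) : Bool :=
  Nat.beq (Nat.rec 0 (fun i r => Nat.lor r (Nat.shiftLeft 1 (fld π (Nat.mul 5 i)))) n) (ones n)

noncomputable def hReuse (P : Ins) (bs : List (List ℕ)) (E s : ℕ) (rest : List ℕ) : Res :=
  bif Nat.beq P.F P.p then
  frc (Nat.land (Nat.shiftRight s 3) 63) fun i => frc (Nat.shiftRight s 9) fun s' =>
    Option.rec none (fun l => frc (initE l) fun C => frc (ones P.n) fun U =>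
      hMap P.n C E (fun π s'' =>
        bif permOk P.n π then
          bif allL (fun e => hasE E (fld π (Nat.mul 5 (hi e))) (fld π (Nat.mul 5 (lo e)))) l then
            some (s'', rest)
          else none
        else none) P.n 0 U 0 s') (nthO bs i)
  else none

noncomputable def disp (P : Ins) (bs : List (List ℕ)) (xs : List ℕ) (full : ℕ)
    (ih : ℕ → List ℕ → ℕ → ℕ → ℕ → List ℕ → Res)
    (E : ℕ) (L : List ℕ) (I E0 s : ℕ) (rest : List ℕ) : Res :=
  frc (Nat.land s 7) fun t =>
  bif Nat.beq t 0 then hSplit xs full ih E L I E0 s rest else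
  bif Nat.beq t 1 then frc (Nat.shiftRight s 3) fun s' => hCov P.tf xs E L (hLeaf I rest) P.K 0 s' else
  bif Nat.beq t 2 then hTri P.n P.tf E s rest else
  bif Nat.beq t 3 then hDeg P.n P.d E0 s rest else
  bif Nat.beq t 4 then hSet P.n P.p E0 s rest else
  bif Nat.beq t 5 then hReuse P bs E s rest else
  frc (Nat.shiftRight s 3) fun s' => hCov P.tf xs E L (hComm P.n xs ih E L I E0 rest) P.K 0 s'

noncomputable def run (P : Ins) (bs : List (List ℕ)) (xs : List ℕ) (full : ℕ) (fuel : ℕ) :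
    ℕ → List ℕ → ℕ → ℕ → ℕ → List ℕ → Res :=
  Nat.rec (fun _ _ _ _ _ _ => none) (fun _ ih E L I E0 s rest =>
    nxt (disp P bs xs full ih E L I E0) s rest) fuel

/-! ### Following alternating paths -/

noncomputable def forN (n : ℕ) (f : ℕ → ℕ → List ℕ → Res) : ℕ → List ℕ → Res :=
  Nat.rec (fun s rest => some (s, rest)) (fun k ih s rest => bnd (f k s rest) ih) n

noncomputable def mateMask (m : ℕ) : ℕ :=
  Nat.lor (Nat.shiftLeft (Nat.land m 1431655765) 1) (Nat.land (Nat.shiftRight m 1) 1431655765)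

/-- The vertices reachable inside the part of the graph discovered so far. -/
noncomputable def clos (N E B : ℕ) (fuel : ℕ) : ℕ → ℕ → ℕ :=
  Nat.rec (fun C _ => C) (fun _ ih C todo =>
    bif Nat.beq todo 0 then C else
      frc (Nat.log2 todo) fun u => frc (Nat.xor todo (Nat.shiftLeft 1 u)) fun todo' =>
      bif tb N u then
        frc (Nat.land (mateMask (Nat.land (row E u) N)) B) fun m =>
        frc (Nat.xor m (Nat.land m C)) fun new =>
        frc (Nat.lor C new) fun C' => frc (Nat.lor todo' new) fun t' => ih C' t'
      else ih C todo') fuel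

/-- The pairs from `t` on are fresh: they carry no edges except for the matching. -/
noncomputable def fresh (P : Ins) (E t : ℕ) : Bool :=
  bif Nat.beq (Nat.shiftRight E 1024) 0 then
    allN (fun i => bif Nat.ble (Nat.mul 2 t) i then
      bif Nat.blt i (Nat.mul 2 P.NP) then
        bif tb P.N i then Nat.beq (row E i) (Nat.shiftLeft 1 (mate i)) else false
      else Nat.beq (Nat.shiftRight (Nat.land (row E i) (ones (Nat.mul 2 P.NP))) (Nat.mul 2 t)) 0
    else Nat.beq (Nat.shiftRight (Nat.land (row E i) (ones (Nat.mul 2 P.NP))) (Nat.mul 2 t)) 0) 32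
  else false

noncomputable def hStep (P : Ins) (xs : List ℕ) (full : ℕ)
    (ih : ℕ → List ℕ → ℕ → ℕ → ℕ → ℕ → ℕ → ℕ → List ℕ → Res)
    (E : ℕ) (L : List ℕ) (I t A tgt r : ℕ) (v s : ℕ) (rest : List ℕ) : Res :=
  bif Nat.beq v (Nat.mul 2 t) then
    bif Nat.blt t P.NP then
      frc (addE E r v) fun E' => frc (Nat.add (Nat.mul 32 r) v) fun c =>
      frc (addI xs full I r v) fun I' => frc (Nat.succ t) fun t' => frc (Nat.succ v) fun v' =>
        ih E' (List.cons c L) I' t' A v' tgt s rest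
    else some (s, rest)
  else frc (mate v) fun w =>
    bif tb A v then some (s, rest) else
    bif tb P.N w then
      bif Nat.beq r w then some (s, rest) else
      frc (addE E r w) fun E' => frc (Nat.add (Nat.mul 32 r) w) fun c =>
      frc (addI xs full I r w) fun I' => ih E' (List.cons c L) I' t A v tgt s rest
    else some (s, rest)

noncomputable def hExpand (P : Ins) (xs : List ℕ) (full : ℕ)
    (ih : ℕ → List ℕ → ℕ → ℕ → ℕ → ℕ → ℕ → ℕ → List ℕ → Res)
    (E : ℕ) (L : List ℕ) (I t A cur tgt s : ℕ) (rest : List ℕ) : Res :=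
  frc (ones (Nat.mul 2 t)) fun B => frc (Nat.xor B (Nat.land B A)) fun B' =>
  frc (Nat.shiftLeft 1 cur) fun c0 => frc (clos P.N E B' 40 c0 c0) fun C =>
  frc (Nat.lor A C) fun A' => frc (Nat.shiftRight s 2) fun s' =>
    bif tb C cur then bif tb C tgt then none else
    bif Nat.blt tgt (Nat.mul 2 t) then
    bif Nat.beq (Nat.shiftRight A' (Nat.mul 2 t)) 0 then
    bif fresh P E t then
      forN (Nat.mul 2 t) (fun r s rest =>
        bif tb C r then bif tb P.N r then
          forN (Nat.succ (Nat.mul 2 t)) (hStep P xs full ih E L I t A' tgt r) s rest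
        else some (s, rest) else some (s, rest)) s' rest
    else none else none else none else none

noncomputable def hAuto (n : ℕ) (tf : Bool) (E : ℕ) (L : List ℕ) (s : ℕ) (rest : List ℕ) : Res :=
  frc (nthN L 0) fun e => frc (hi e) fun a => frc (lo e) fun b =>
  frc (Nat.log2 (Nat.land (row E a) (row E b))) fun c =>
    bif tf then bif hasE E a b then bif hasE E b c then bif hasE E a c then
    bif Nat.blt a n then bif Nat.blt b n then bif Nat.blt c n then ret s 2 rest
    else none else none else none else none else none else none else none

noncomputable def pdisp (P : Ins) (okl : ℕ → Bool) (bs : List (List ℕ)) (xs : List ℕ) (full : ℕ)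
    (ih : ℕ → List ℕ → ℕ → ℕ → ℕ → ℕ → ℕ → ℕ → List ℕ → Res)
    (E : ℕ) (L : List ℕ) (I t A cur tgt s : ℕ) (rest : List ℕ) : Res :=
  frc (Nat.land s 3) fun g =>
  bif Nat.beq g 0 then hExpand P xs full ih E L I t A cur tgt s rest else
  bif Nat.beq g 1 then
    bif allL (fun e => hasE E (hi e) (lo e)) P.mx then
      frc (fld s 2) fun l => frc (mate l) fun l' => frc (Nat.shiftRight s 7) fun s' =>
        bif okl l then ih E L I t 0 l l' s' rest else none
    else none else
  bif Nat.beq g 2 then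
    frc (Nat.shiftRight s 2) fun s' => run P bs xs full 200 E L I 0 s' rest else
  hAuto P.n P.tf E L s rest

noncomputable def prun (P : Ins) (okl : ℕ → Bool) (bs : List (List ℕ)) (xs : List ℕ) (full : ℕ)
    (fuel : ℕ) : ℕ → List ℕ → ℕ → ℕ → ℕ → ℕ → ℕ → ℕ → List ℕ → Res :=
  Nat.rec (fun _ _ _ _ _ _ _ _ _ => none) (fun _ ih E L I t A cur tgt s rest =>
    nxt (pdisp P okl bs xs full ih E L I t A cur tgt) s rest) fuel

/-! ### Certificates -/

/-- A configuration (a list of edges, the number of discovered pairs) and its refutation. -/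
structure Cert where
  edges : List ℕ
  t : ℕ
  code : List ℕ

noncomputable def initI (xs : List ℕ) (full : ℕ) (l : List ℕ) : ℕ :=
  List.rec full (fun e _ I => addI xs full I (hi e) (lo e)) l

noncomputable def runAll (P : Ins) (okl : ℕ → Bool) (xs : List ℕ) (full : ℕ) (cs : List Cert) :
    List (List ℕ) → Bool :=
  List.rec (fun _ => true) (fun x _ ih bs =>
    Cert.rec (fun b t c =>
      frc (initE b) fun E => frc (initI xs full b) fun I =>
        Option.rec false (fun _ => ih (bs ++ [b])) (prun P okl bs xs full 60 E b I t 0 0 0 1 c)) x)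
    cs

noncomputable def checkAll (P : Ins) (okl : ℕ → Bool) (cs : List Cert) : Bool :=
  tabs P.n P.F P.n [] fun xs => frc (ones (chs P.n P.F)) fun full => runAll P okl xs full cs []

end Folkman

namespace Folkman

/-! ### Semantics of the primitives -/

theorem frc_eq {α : Type} (n : ℕ) (f : ℕ → α) : frc n f = f n := rfl

theorem tb_eq (m i : ℕ) : tb m i = m.testBit i := by
  have h : tb m i = Nat.beq ((m >>> i) &&& 1) 1 := rfl
  rw [h, Nat.and_comm]
  unfold Nat.testBit
  rcases (Nat.and_one_is_mod (m >>> i) ▸ Nat.mod_two_eq_zero_or_one (m >>> i) :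
    (m >>> i) &&& 1 = 0 ∨ (m >>> i) &&& 1 = 1) with h | h <;> rw [Nat.and_comm] at h <;> rw [h] <;> rfl

theorem mate_eq (v : ℕ) : mate v = if v % 2 = 1 then v - 1 else v + 1 := by
  have h : mate v = bif Nat.beq (v &&& 1) 1 then v.pred else v.succ := rfl
  rw [h, Nat.and_one_is_mod]
  rcases Nat.mod_two_eq_zero_or_one v with h | h
  · rw [h]; rfl
  · rw [h]; rfl

theorem mate_mate (v : ℕ) : mate (mate v) = v := by
  simp only [mate_eq]; split_ifs <;> omega

theorem mate_div (v : ℕ) : mate v / 2 = v / 2 := by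
  simp only [mate_eq]; split_ifs <;> omega

theorem mate_ne (v : ℕ) : mate v ≠ v := by
  simp only [mate_eq]; split_ifs <;> omega

theorem eq_or_eq_mate {u v : ℕ} (h : u / 2 = v / 2) : u = v ∨ u = mate v := by
  simp only [mate_eq]; split_ifs <;> omega

theorem allL_eq_true {f : ℕ → Bool} {l : List ℕ} (h : allL f l = true) : ∀ e ∈ l, f e = true := by
  induction l with
  | nil => simp
  | cons a l ih =>
    have h' : (bif f a then allL f l else false) = true := h
    cases hf : f a <;> simp_all

theorem allN_eq_true {f : ℕ → Bool} {n : ℕ} (h : allN f n = true) : ∀ i < n, f i = true := by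
  induction n with
  | zero => simp
  | succ n ih =>
    have h' : (bif f n then allN f n else false) = true := h
    cases hf : f n
    · simp [hf] at h'
    · rw [hf] at h'
      intro i hi
      rcases Nat.lt_succ_iff_lt_or_eq.1 hi with hi | rfl
      exacts [ih h' i hi, hf]

theorem cnt_eq (m n : ℕ) : cnt m n = ((Finset.range n).filter fun i => m.testBit i = true).card := by
  induction n with
  | zero => rfl
  | succ n ih =>
    have h : cnt m (n + 1) = bif tb m n then (cnt m n).succ else cnt m n := rfl
    rw [h, tb_eq, Finset.range_add_one, Finset.filter_insert]
    cases hb : m.testBit n <;> simp [ih]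

theorem ones_eq (n : ℕ) : ones n = 2 ^ n - 1 := by
  have h : ones n = (1 <<< n).pred := rfl
  rw [h, Nat.one_shiftLeft, Nat.pred_eq_sub_one]

theorem chs_eq (n : ℕ) : ∀ k, chs n k = n.choose k := by
  induction n with
  | zero => intro k; cases k <;> rfl
  | succ n ih =>
    intro k
    cases k with
    | zero => simp [show chs (n + 1) 0 = 1 from rfl]
    | succ k =>
      have h : chs (n + 1) (k + 1) = chs n (k + 1) + chs n k := rfl
      rw [h, ih, ih, Nat.choose_succ_succ, add_comm, Nat.succ_eq_add_one]

/-- The index of the set `{i < n | b i}`, if it has `k` elements, among all `k`-subsets. -/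
def idx : ℕ → ℕ → (ℕ → Bool) → ℕ
  | 0, _, _ => 0
  | _ + 1, 0, _ => 0
  | n + 1, k + 1, b => if b n then n.choose (k + 1) + idx n k b else idx n (k + 1) b

/-- The set `{i < n | b i}`. -/
def fs (n : ℕ) (b : ℕ → Bool) : Finset ℕ := (Finset.range n).filter fun i => b i = true

theorem card_fs_succ (n : ℕ) (b : ℕ → Bool) :
    (fs (n + 1) b).card = (fs n b).card + if b n then 1 else 0 := by
  unfold fs
  rw [Finset.range_add_one, Finset.filter_insert]
  cases b n <;> simp

theorem idx_lt (n : ℕ) : ∀ (k : ℕ) (b : ℕ → Bool), (fs n b).card = k → idx n k b < n.choose k := by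
  induction n with
  | zero =>
    intro k b h
    have : k = 0 := by simpa [fs] using h.symm
    subst this; simp [idx]
  | succ n ih =>
    intro k b h
    rw [card_fs_succ] at h
    cases k with
    | zero => simp [idx]
    | succ k =>
      rw [Nat.choose_succ_succ]
      cases hb : b n
      · have := ih (k + 1) b (by simpa [hb] using h)
        simp only [idx, hb]; simp; omega
      · have := ih k b (by simpa [hb] using h)
        simp only [idx, hb]; simp; omega

theorem xt_lt (a n : ℕ) : ∀ k, xt a n k < 2 ^ n.choose k := by
  induction n with
  | zero => intro k; exact Nat.two_pow_pos _
  | succ n ih =>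
    intro k
    cases k with
    | zero => exact Nat.two_pow_pos _
    | succ k =>
      have h : xt a (n + 1) (k + 1) = bif Nat.beq n a then ones (chs n k) <<< chs n (k + 1) else
        xt a n (k + 1) ||| (xt a n k <<< chs n (k + 1)) := rfl
      have key : ∀ x, x < 2 ^ n.choose k → x <<< n.choose (k + 1) < 2 ^ (n + 1).choose (k + 1) := by
        intro x hx
        rw [Nat.shiftLeft_eq, Nat.choose_succ_succ, pow_add]
        exact Nat.mul_lt_mul_of_pos_right hx (Nat.two_pow_pos _)
      rw [h, chs_eq, chs_eq]
      cases Nat.beq n a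
      · refine Nat.or_lt_two_pow ((ih (k + 1)).trans_le ?_) (key _ (ih k))
        exact Nat.pow_le_pow_right (by norm_num) (Nat.choose_succ_succ n k ▸ Nat.le_add_left _ _)
      · refine key _ ?_
        rw [ones_eq]
        exact Nat.sub_lt (Nat.two_pow_pos _) one_pos

theorem xt_mem (a n : ℕ) : ∀ (k : ℕ) (b : ℕ → Bool), (fs n b).card = k →
    (xt a n k).testBit (idx n k b) = true → b a = true ∧ a < n := by
  induction n with
  | zero => intro k b _ h; simp [show xt a 0 k = 0 from rfl] at h
  | succ n ih =>
    intro k b hk h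
    rw [card_fs_succ] at hk
    cases k with
    | zero => simp [show xt a (n + 1) 0 = 0 from rfl] at h
    | succ k =>
      have hx : xt a (n + 1) (k + 1) = bif Nat.beq n a then ones (chs n k) <<< chs n (k + 1) else
        xt a n (k + 1) ||| (xt a n k <<< chs n (k + 1)) := rfl
      rw [hx, chs_eq, chs_eq] at h
      cases hb : b n
      · have hk' : (fs n b).card = k + 1 := by simpa [hb] using hk
        have hi : idx (n + 1) (k + 1) b = idx n (k + 1) b := by simp [idx, hb]
        have hlt := idx_lt n (k + 1) b hk'
        rw [hi] at h
        cases he : Nat.beq n a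
        · simp only [he, cond_false, Nat.testBit_or, Nat.testBit_shiftLeft] at h
          have := ih (k + 1) b hk' (by simpa [Nat.not_le.2 hlt] using h)
          exact ⟨this.1, by omega⟩
        · simp [he, Nat.testBit_shiftLeft, Nat.not_le.2 hlt] at h
      · have hk' : (fs n b).card = k := by simpa [hb] using hk
        have hi : idx (n + 1) (k + 1) b = n.choose (k + 1) + idx n k b := by simp [idx, hb]
        rw [hi] at h
        cases he : Nat.beq n a
        · have h0 : (xt a n (k + 1)).testBit (n.choose (k + 1) + idx n k b) = false :=
            Nat.testBit_lt_two_pow ((xt_lt a n (k + 1)).trans_le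
              (Nat.pow_le_pow_right (by norm_num) (Nat.le_add_right _ _)))
          simp only [he, cond_false, Nat.testBit_or, Nat.testBit_shiftLeft, h0] at h
          have := ih k b hk' (by simpa using h)
          exact ⟨this.1, by omega⟩
        · have : n = a := Nat.eq_of_beq_eq_true he
          subst this
          exact ⟨hb, by omega⟩

/-- `xs` lists tables of the `F`-subsets of `range n` containing a given element. -/
def IsTab (n F : ℕ) (xs : List ℕ) : Prop :=
  ∀ (a : ℕ) (b : ℕ → Bool), (fs n b).card = F →
    (nthN xs a).testBit (idx n F b) = true → b a = true ∧ a < n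

theorem nthN_eq (l : List ℕ) : ∀ k, nthN l k = l.getD k 0 := by
  induction l with
  | nil => intro k; simp [show nthN [] k = 0 from rfl]
  | cons a l ih =>
    intro k
    cases k with
    | zero => rfl
    | succ k =>
      rw [show nthN (a :: l) (k + 1) = nthN l k from rfl, ih]; simp

theorem nthO_mem {α : Type} {l : List α} : ∀ {k : ℕ} {x : α}, nthO l k = some x → x ∈ l := by
  induction l with
  | nil => intro k x h; cases h
  | cons a l ih =>
    intro k x h
    cases k with
    | zero => cases h; simp
    | succ k => exact List.mem_cons_of_mem _ (ih (k := k) h)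

theorem tabs_eq (n k : ℕ) {α : Type} (fuel : ℕ) : ∀ (l : List ℕ) (f : List ℕ → α),
    tabs n k fuel l f = f ((List.range fuel).map (fun a => xt a n k) ++ l) := by
  induction fuel with
  | zero => intro l f; rfl
  | succ m ih =>
    intro l f
    have h : tabs n k (m + 1) l f = tabs n k m (xt m n k :: l) f := rfl
    rw [h, ih, List.range_succ]; simp

theorem isTab_range (n F : ℕ) : IsTab n F ((List.range n).map fun a => xt a n F) := by
  intro a b hb h
  rw [nthN_eq, List.getD_eq_getElem?_getD] at h
  rcases lt_or_ge a n with ha | ha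
  · simp only [List.getElem?_map, List.getElem?_range ha] at h
    exact xt_mem a n F b hb (by simpa using h)
  · simp [ha] at h

end Folkman

namespace Folkman

/-! ### Soundness of the case splitting -/

/-- The hypotheses refuted by a certificate; the neighbourhood of a vertex is given by a set
containing it. -/
structure Hyp (P : Ins) (G : SimpleGraph ℕ) : Prop where
  ind : ∀ S ⊆ Finset.range P.n, G.IsIndepSet (S : Set ℕ) → S.card ≤ P.p
  rob : ∀ L : List (Finset ℕ), L.length = P.K → (∀ C ∈ L, G.IsClique (C : Set ℕ)) →
    ∃ S ⊆ Finset.range P.n, G.IsIndepSet (S : Set ℕ) ∧ S.card = P.F ∧ ∀ C ∈ L, Disjoint S C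
  deg : ∀ v < P.n, ∀ D : Finset ℕ, (∀ u < P.n, G.Adj v u → u ∈ D) → P.d ≤ D.card
  tri : P.tf = true → ∀ a b c, a < P.n → b < P.n → c < P.n →
    G.Adj a b → G.Adj b c → G.Adj a c → False
  pairs : ∀ S : Finset ℕ, (∀ v ∈ S, P.N.testBit v = true) → G.IsIndepSet (S : Set ℕ) →
    S.card ≤ P.F

/-- Conditions on the parameters. -/
structure Ins.Valid (P : Ins) : Prop where
  n_le : P.n ≤ 32
  N_lt : ∀ v, P.N.testBit v = true → v < P.n
  N_lt' : ∀ v, P.N.testBit v = true → v < 2 * P.NP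
  NP_le : P.NP ≤ 16

def Known (E : ℕ) (G : SimpleGraph ℕ) : Prop :=
  ∀ i j, j < 32 → E.testBit (32 * i + j) = true → G.Adj i j

def NonE (E : ℕ) (G : SimpleGraph ℕ) : Prop :=
  ∀ i j, j < 32 → E.testBit (32 * i + j) = true → ¬ G.Adj i j

/-- `I` contains the indices of all `F`-sets that are independent as far as is known. -/
def Tab (P : Ins) (E I : ℕ) : Prop :=
  ∀ G, Known E G → ∀ b : ℕ → Bool, (fs P.n b).card = P.F →
    (∀ i j, b i = true → b j = true → ¬ G.Adj i j) → I.testBit (idx P.n P.F b) = true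

theorem lt_of_blt {a b : ℕ} (h : Nat.blt a b = true) : a < b := by
  rwa [Nat.blt_eq] at h

theorem bif_none {α : Type} {c : Bool} {x : Option α} {r : α} :
    (bif c then x else none) = some r ↔ c = true ∧ x = some r := by
  cases c <;> simp

theorem bnd_some {o : Res} {f : ℕ → List ℕ → Res} {r : ℕ × List ℕ} (h : bnd o f = some r) :
    ∃ s rest, o = some (s, rest) ∧ f s rest = some r := by
  match o, h with
  | some (s, rest), h => exact ⟨s, rest, rfl, h⟩

theorem nxt_some {f : ℕ → List ℕ → Res} {s : ℕ} {rest : List ℕ} {r : ℕ × List ℕ}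
    (h : nxt f s rest = some r) : ∃ s' rest', f s' rest' = some r := by
  unfold nxt at h
  cases hb : Nat.beq s 1
  · rw [hb] at h; exact ⟨s, rest, h⟩
  · rw [hb] at h
    match rest, h with
    | s' :: rest', h => exact ⟨s', rest', h⟩

theorem fld_lt (s i : ℕ) : fld s i < 32 := by
  have h : fld s i = (s >>> i) &&& 31 := rfl
  rw [h, show (31 : ℕ) = 2 ^ 5 - 1 by norm_num, Nat.and_two_pow_sub_one_eq_mod]
  exact Nat.mod_lt _ (by norm_num)

theorem lo_lt (e : ℕ) : lo e < 32 := by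
  have h : lo e = fld e 0 := rfl
  rw [h]; exact fld_lt _ _

theorem hi_lo (a b : ℕ) (hb : b < 32) : hi (32 * a + b) = a ∧ lo (32 * a + b) = b := by
  have h : hi (32 * a + b) = (32 * a + b) >>> 5 := rfl
  have h' : lo (32 * a + b) = (32 * a + b) &&& (2 ^ 5 - 1) := rfl
  rw [h, h', Nat.and_two_pow_sub_one_eq_mod, Nat.shiftRight_eq_div_pow]
  omega

theorem hasE_eq (E a b : ℕ) : hasE E a b = E.testBit (32 * a + b) := by
  have h : hasE E a b = tb E (32 * a + b) := rfl
  rw [h, tb_eq]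

theorem Known.adj {E : ℕ} {G : SimpleGraph ℕ} (h : Known E G) {a b : ℕ} (hb : b < 32)
    (he : hasE E a b = true) : G.Adj a b :=
  h a b hb (by rwa [hasE_eq] at he)

theorem addE_bit (E a b i j : ℕ) (ha : a < 32) (hb : b < 32) (hj : j < 32) :
    (addE E a b).testBit (32 * i + j) = true ↔
      E.testBit (32 * i + j) = true ∨ i = a ∧ j = b ∨ i = b ∧ j = a := by
  have h : addE E a b = E ||| ((1 <<< (32 * a + b)) ||| (1 <<< (32 * b + a))) := rfl
  rw [h, Nat.testBit_or, Nat.testBit_or, Nat.one_shiftLeft, Nat.one_shiftLeft,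
    Nat.testBit_two_pow, Nat.testBit_two_pow]
  simp only [Bool.or_eq_true, decide_eq_true_eq]
  have h1 : 32 * a + b = 32 * i + j ↔ i = a ∧ j = b := by omega
  have h2 : 32 * b + a = 32 * i + j ↔ i = b ∧ j = a := by omega
  rw [h1, h2]

theorem known_addE {E a b : ℕ} {G : SimpleGraph ℕ} (ha : a < 32) (hb : b < 32) :
    Known (addE E a b) G ↔ Known E G ∧ G.Adj a b := by
  constructor
  · intro h
    exact ⟨fun i j hj he => h i j hj ((addE_bit E a b i j ha hb hj).2 (Or.inl he)),
      h a b hb ((addE_bit E a b a b ha hb hb).2 (Or.inr (Or.inl ⟨rfl, rfl⟩)))⟩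
  · rintro ⟨h, hab⟩ i j hj he
    rcases (addE_bit E a b i j ha hb hj).1 he with he | ⟨rfl, rfl⟩ | ⟨rfl, rfl⟩
    exacts [h i j hj he, hab, hab.symm]

theorem nonE_addE {E a b : ℕ} {G : SimpleGraph ℕ} (ha : a < 32) (hb : b < 32)
    (h : NonE E G) (hab : ¬ G.Adj a b) : NonE (addE E a b) G := by
  intro i j hj he
  rcases (addE_bit E a b i j ha hb hj).1 he with he | ⟨rfl, rfl⟩ | ⟨rfl, rfl⟩
  exacts [h i j hj he, hab, fun h' => hab h'.symm]

theorem row_bit (E a j : ℕ) : (row E a).testBit j = true ↔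
    j < 32 ∧ E.testBit (32 * a + j) = true := by
  have h : row E a = (E >>> (32 * a)) &&& (2 ^ 32 - 1) := rfl
  rw [h, Nat.testBit_and, Nat.testBit_shiftRight, Nat.testBit_two_pow_sub_one]
  simp [and_comm]

theorem tab_addI {P : Ins} {xs : List ℕ} {E I a b : ℕ} (hxs : IsTab P.n P.F xs)
    (ha : a < 32) (hb : b < 32) (h : Tab P E I) :
    Tab P (addE E a b) (addI xs (ones (chs P.n P.F)) I a b) := by
  intro G hG c hc hi
  obtain ⟨hG, hab⟩ := (known_addE ha hb).1 hG
  have hI := h G hG c hc hi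
  have e : addI xs (ones (chs P.n P.F)) I a b =
    I &&& (ones (chs P.n P.F) ^^^ (nthN xs a &&& nthN xs b)) := rfl
  rw [e, ones_eq, chs_eq, Nat.testBit_and, Nat.testBit_xor, Nat.testBit_two_pow_sub_one, hI,
    Nat.testBit_and]
  have hlt := idx_lt P.n P.F c hc
  cases h1 : (nthN xs a).testBit (idx P.n P.F c)
  · simp [hlt]
  · cases h2 : (nthN xs b).testBit (idx P.n P.F c)
    · simp [hlt]
    · exact absurd hab (hi a b (hxs a c hc h1).1 (hxs b c hc h2).1)

theorem fs_decide {n : ℕ} {S : Finset ℕ} (hS : S ⊆ Finset.range n) :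
    fs n (fun i => decide (i ∈ S)) = S := by
  ext i
  simp only [fs, Finset.mem_filter, Finset.mem_range, decide_eq_true_eq]
  exact ⟨fun h => h.2, fun h => ⟨Finset.mem_range.1 (hS h), h⟩⟩

theorem hCov_sound {P : Ins} {tf : Bool} {xs : List ℕ} {E : ℕ} {L : List ℕ} {r : ℕ × List ℕ}
    {f : ℕ → ℕ → Res} (hxs : IsTab P.n P.F xs) (k : ℕ) :
    ∀ M s, hCov tf xs E L f k M s = some r →
    ∃ (cs : List (Finset ℕ)) (M₁ s₁ : ℕ), cs.length = k ∧
      (∀ G, Known E G → ∀ C ∈ cs, G.IsClique (C : Set ℕ)) ∧ f M₁ s₁ = some r ∧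
      ∀ b : ℕ → Bool, (fs P.n b).card = P.F → (∀ C ∈ cs, ∀ v ∈ C, b v = false) →
        M.testBit (idx P.n P.F b) = false → M₁.testBit (idx P.n P.F b) = false := by
  induction k with
  | zero =>
    intro M s h
    exact ⟨[], M, s, rfl, by simp, h, fun _ _ _ hM => hM⟩
  | succ k ih =>
    intro M s h
    obtain ⟨e, he⟩ : ∃ e, e = nthN L (Nat.land s 63) := ⟨_, rfl⟩
    obtain ⟨M', hM'⟩ : ∃ M', M' = M ||| (nthN xs (hi e) ||| nthN xs (lo e)) := ⟨_, rfl⟩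
    have hmem : ∀ a (b : ℕ → Bool), (fs P.n b).card = P.F → b a = false →
        (nthN xs a).testBit (idx P.n P.F b) = false := by
      intro a b hb ha
      by_contra hh
      rw [Bool.not_eq_false] at hh
      rw [(hxs a b hb hh).1] at ha
      cases ha
    have two : ∀ s', hasE E (hi e) (lo e) = true → hCov tf xs E L f k M' s' = some r →
        ∃ (cs : List (Finset ℕ)) (M₁ s₁ : ℕ), cs.length = k + 1 ∧
      (∀ G, Known E G → ∀ C ∈ cs, G.IsClique (C : Set ℕ)) ∧ f M₁ s₁ = some r ∧
      ∀ b : ℕ → Bool, (fs P.n b).card = P.F → (∀ C ∈ cs, ∀ v ∈ C, b v = false) →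
        M.testBit (idx P.n P.F b) = false → M₁.testBit (idx P.n P.F b) = false := by
      intro s' hE h
      obtain ⟨cs, M₁, s₁, hl, hc, hf, hb⟩ := ih _ _ h
      refine ⟨{hi e, lo e} :: cs, M₁, s₁, by simp [hl], ?_, hf, ?_⟩
      · intro G hG C hC
        rcases List.mem_cons.1 hC with rfl | hC
        · have := hG.adj (lo_lt e) hE
          simpa [SimpleGraph.isClique_pair] using fun _ => this
        · exact hc G hG C hC
      · intro b hbc hav hM
        refine hb b hbc (fun C hC => hav C (List.mem_cons_of_mem _ hC)) ?_
        rw [hM', Nat.testBit_or, Nat.testBit_or, hM,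
          hmem _ b hbc (hav _ List.mem_cons_self _ (by simp)),
          hmem _ b hbc (hav _ List.mem_cons_self _ (by simp))]
        rfl
    have h' : (bif hasE E (hi e) (lo e) then
            bif tf then hCov tf xs E L f k M' (Nat.shiftRight s 6) else
              bif Nat.beq (fld s 6) (hi e) then
                hCov tf xs E L f k M' (Nat.shiftRight s 11) else
              bif hasE E (hi e) (fld s 6) then bif hasE E (lo e) (fld s 6) then
                hCov tf xs E L f k (M' ||| nthN xs (fld s 6)) (Nat.shiftRight s 11)
              else none else none
        else none) = some r := by
      rw [hM', he]; exact h
    obtain ⟨hE, h'⟩ := bif_none.1 h'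
    cases tf
    · rw [cond_false] at h'
      cases hca : Nat.beq (fld s 6) (hi e)
      · rw [hca, cond_false] at h'
        obtain ⟨h1, h'⟩ := bif_none.1 h'
        obtain ⟨h2, h'⟩ := bif_none.1 h'
        obtain ⟨cs, M₁, s₁, hl, hc, hf, hb⟩ := ih _ _ h'
        refine ⟨{hi e, lo e, fld s 6} :: cs, M₁, s₁, by simp [hl], ?_, hf, ?_⟩
        · intro G hG C hC
          rcases List.mem_cons.1 hC with rfl | hC
          · have a1 := hG.adj (lo_lt e) hE
            have a2 := hG.adj (fld_lt s 6) h1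
            have a3 := hG.adj (fld_lt s 6) h2
            rw [Finset.coe_insert, Finset.coe_pair, SimpleGraph.isClique_insert,
              SimpleGraph.isClique_pair]
            refine ⟨fun _ => a3, fun x hx _ => ?_⟩
            rcases hx with rfl | rfl
            exacts [a1, a2]
          · exact hc G hG C hC
        · intro b hbc hav hM
          refine hb b hbc (fun C hC => hav C (List.mem_cons_of_mem _ hC)) ?_
          rw [hM', Nat.testBit_or, Nat.testBit_or, Nat.testBit_or, hM,
            hmem _ b hbc (hav _ List.mem_cons_self _ (by simp)),
            hmem _ b hbc (hav _ List.mem_cons_self _ (by simp)),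
            hmem _ b hbc (hav _ List.mem_cons_self _ (by simp))]
          rfl
      · rw [hca, cond_true] at h'
        exact two _ hE h'
    · rw [cond_true] at h'
      exact two _ hE h'

theorem exists_uncovered {P : Ins} {xs : List ℕ} {E I s : ℕ} {L : List ℕ} {r : ℕ × List ℕ}
    {f : ℕ → ℕ → Res} {G : SimpleGraph ℕ} (hxs : IsTab P.n P.F xs) (hI : Tab P E I) (hG : Hyp P G)
    (hE : Known E G) (h : hCov P.tf xs E L f P.K 0 s = some r) :
    ∃ M₁ s₁, f M₁ s₁ = some r ∧ ∃ S : Finset ℕ, G.IsIndepSet (S : Set ℕ) ∧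
      (fs P.n fun i => decide (i ∈ S)).card = P.F ∧
      I.testBit (idx P.n P.F fun i => decide (i ∈ S)) = true ∧
      M₁.testBit (idx P.n P.F fun i => decide (i ∈ S)) = false := by
  obtain ⟨cs, M₁, s₁, hl, hc, hf, hb⟩ := hCov_sound hxs _ _ _ h
  obtain ⟨S, hSn, hSi, hSc, hSd⟩ := hG.rob cs hl (hc G hE)
  have hcard : (fs P.n fun i => decide (i ∈ S)).card = P.F := by rw [fs_decide hSn, hSc]
  refine ⟨M₁, s₁, hf, S, hSi, hcard, hI G hE _ hcard ?_, hb _ hcard ?_ (Nat.zero_testBit _)⟩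
  · intro i j hi hj hij
    exact hSi (by simpa using hi) (by simpa using hj) hij.ne hij
  · exact fun C hC v hv => by simpa using Finset.disjoint_right.1 (hSd C hC) hv

theorem leaf_false {P : Ins} {xs : List ℕ} {E I s : ℕ} {L rest : List ℕ} {r : ℕ × List ℕ}
    {G : SimpleGraph ℕ} (hxs : IsTab P.n P.F xs) (hI : Tab P E I) (hG : Hyp P G)
    (hE : Known E G) (h : hCov P.tf xs E L (hLeaf I rest) P.K 0 s = some r) : False := by
  obtain ⟨M, s₁, h', S, -, -, h1, h2⟩ := exists_uncovered hxs hI hG hE h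
  have e : I &&& M = I := Nat.eq_of_beq_eq_true (bif_none.1 h').1
  rw [← e, Nat.testBit_and, h2, Bool.and_false] at h1
  cases h1

theorem common_bit {R u : ℕ} {xs : List ℕ} {a : ℕ} (h : (common R u xs).testBit a = true) {j : ℕ}
    (hj : R.testBit j = true) : (nthN xs a).testBit j = true := by
  unfold common at h
  simp only [frc_eq] at h
  obtain ⟨R', hR'⟩ : ∃ R', R' = Nat.lor (Nat.shiftLeft R 64) (Nat.land u 18446744073709551615) :=
    ⟨_, rfl⟩
  rw [← hR'] at h
  clear hR'
  induction xs generalizing a with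
  | nil => exact absurd h (by simp)
  | cons x l ih =>
    obtain ⟨T, hT⟩ : ∃ T : ℕ, T = List.rec 0 (fun x _ ih =>
      bif Nat.beq (Nat.land R' (Nat.shiftLeft x 64)) (Nat.shiftLeft R 64)
      then Nat.succ (Nat.shiftLeft ih 1) else Nat.shiftLeft ih 1) l := ⟨_, rfl⟩
    have h' : (bif Nat.beq (R' &&& (x <<< 64)) (R <<< 64) then T <<< 1 + 1 else T <<< 1).testBit a
      = true := by rw [hT]; exact h
    have hT2 : T <<< 1 = 2 * T := by rw [Nat.shiftLeft_eq]; omega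
    rw [hT2] at h'
    cases a with
    | zero =>
      cases hc : Nat.beq (R' &&& (x <<< 64)) (R <<< 64)
      · rw [hc] at h'
        simp at h'
      · have e := Nat.eq_of_beq_eq_true hc
        have hb : (R <<< 64).testBit (j + 64) = true := by
          rw [Nat.testBit_shiftLeft]; simpa using hj
        rw [← e, Nat.testBit_and, Bool.and_eq_true, Nat.testBit_shiftLeft, Nat.add_sub_cancel,
          Bool.and_eq_true] at hb
        exact hb.2.2
    | succ a =>
      refine ih (a := a) ?_
      rw [← hT]
      cases hc : Nat.beq (R' &&& (x <<< 64)) (R <<< 64) <;> rw [hc] at h' <;>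
        rw [Nat.testBit_succ] at h' <;> convert h' using 2 <;> simp <;> omega

theorem nonE_addT {E T : ℕ} {G : SimpleGraph ℕ} (hE : NonE E G) (hT : T < 2 ^ 32)
    (h : ∀ i j, T.testBit i = true → T.testBit j = true → ¬ G.Adj i j) (n : ℕ) :
    NonE (addT E T n) G := by
  induction n with
  | zero => exact hE
  | succ a ih =>
    have e : addT E T (a + 1) =
      bif tb T a then addT E T a ||| T <<< (32 * a) else addT E T a := rfl
    rw [e, tb_eq]
    cases hb : T.testBit a
    · exact ih
    · intro i j hj hij
      rw [cond_true, Nat.testBit_or, Bool.or_eq_true, Nat.testBit_shiftLeft, Bool.and_eq_true,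
        decide_eq_true_eq] at hij
      rcases hij with hij | ⟨h1, h2⟩
      · exact ih i j hj hij
      · have h3 : 32 * i + j - 32 * a < 32 := by
          by_contra h3
          rw [Nat.testBit_lt_two_pow (hT.trans_le (Nat.pow_le_pow_right (by omega) (not_lt.1 h3)))]
            at h2
          cases h2
        obtain rfl : i = a := by omega
        rw [Nat.add_sub_cancel_left] at h2
        exact h _ _ hb h2

theorem nonE_common {P : Ins} {xs : List ℕ} {E I E0 s : ℕ} {L rest : List ℕ} {r : ℕ × List ℕ}
    {G : SimpleGraph ℕ} {ih : ℕ → List ℕ → ℕ → ℕ → ℕ → List ℕ → Res}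
    (hxs : IsTab P.n P.F xs) (hI : Tab P E I) (hG : Hyp P G) (hE : Known E G) (hE0 : NonE E0 G)
    (h : hCov P.tf xs E L (hComm P.n xs ih E L I E0 rest) P.K 0 s = some r) :
    ∃ E0' s', NonE E0' G ∧ ih E L I E0' s' rest = some r := by
  obtain ⟨M, s₁, h', S, hSi, hc, h1, h2⟩ := exists_uncovered hxs hI hG hE h
  unfold hComm at h'
  simp only [frc_eq] at h'
  refine ⟨_, s₁, nonE_addT hE0 ?_ ?_ _, h'⟩
  · exact Nat.and_lt_two_pow _ (by norm_num)
  · have key : ∀ i, (common (Nat.xor I (Nat.land I M)) s₁ xs &&& 4294967295).testBit i = true →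
        i ∈ S := by
      intro i hi
      rw [Nat.testBit_and, Bool.and_eq_true] at hi
      have hR : (I ^^^ (I &&& M)).testBit (idx P.n P.F fun i => decide (i ∈ S)) = true := by
        rw [Nat.testBit_xor, Nat.testBit_and, h1, h2]; rfl
      simpa using (hxs i _ hc (common_bit hi.1 hR)).1
    exact fun i j hi hj hij => hSi (key i hi) (key j hj) hij.ne hij

theorem deg_false {P : Ins} {E0 s : ℕ} {rest : List ℕ} {r : ℕ × List ℕ} {G : SimpleGraph ℕ}
    (hG : Hyp P G) (hE : NonE E0 G) (h : hDeg P.n P.d E0 s rest = some r) : False := by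
  unfold hDeg at h
  simp only [frc_eq] at h
  obtain ⟨h1, h⟩ := bif_none.1 h
  obtain ⟨h2, -⟩ := bif_none.1 h
  set a := fld s 3 with ha
  obtain ⟨m, hm⟩ : ∃ m, m = row E0 a ||| 1 <<< a := ⟨_, rfl⟩
  have h2' : P.n < cnt m P.n + P.d := by
    rw [hm]; exact lt_of_blt h2
  have h1' : a < P.n := lt_of_blt h1
  have := hG.deg a h1' ((Finset.range P.n).filter fun i => ¬ m.testBit i = true) (by
    intro u hu hau
    refine Finset.mem_filter.2 ⟨Finset.mem_range.2 hu, fun hm' => ?_⟩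
    rw [hm, Nat.testBit_or, Bool.or_eq_true, row_bit, Nat.one_shiftLeft,
      Nat.testBit_two_pow] at hm'
    rcases hm' with ⟨hu, hm'⟩ | hm'
    · exact hE a u hu hm' hau
    · exact hau.ne (by simpa using hm'))
  have hs := Finset.card_filter_add_card_filter_not (s := Finset.range P.n)
    (fun i => m.testBit i = true)
  rw [← cnt_eq, Finset.card_range] at hs
  omega

theorem set_false {P : Ins} {E0 s : ℕ} {rest : List ℕ} {r : ℕ × List ℕ} {G : SimpleGraph ℕ}
    (hG : Hyp P G) (hE : NonE E0 G) (h : hSet P.n P.p E0 s rest = some r) :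
    False := by
  unfold hSet at h
  simp only [frc_eq] at h
  obtain ⟨h1, h⟩ := bif_none.1 h
  obtain ⟨h2, -⟩ := bif_none.1 h
  generalize Nat.land (Nat.shiftRight s 3) 1048575 = m at h1 h2
  have h1' : P.p < cnt m P.n := lt_of_blt h1
  have := hG.ind ((Finset.range P.n).filter fun i => m.testBit i = true)
    (Finset.filter_subset _ _) (by
    intro i hi j hj hij
    rw [Finset.mem_coe, Finset.mem_filter, Finset.mem_range] at hi hj
    have := allN_eq_true h2 i hi.1
    simp only [tb_eq, hi.2, cond_true] at this
    have e : row E0 i &&& (m ^^^ 1 <<< i) = m ^^^ 1 <<< i := Nat.eq_of_beq_eq_true this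
    have hb : (m ^^^ 1 <<< i).testBit j = true := by
      rw [Nat.testBit_xor, hj.2, Nat.one_shiftLeft, Nat.testBit_two_pow]
      simp [hij]
    rw [← e, Nat.testBit_and, Bool.and_eq_true, row_bit] at hb
    exact hE i j hb.1.1 hb.1.2)
  rw [← cnt_eq] at this
  omega

theorem triangle_false {P : Ins} {E s : ℕ} {rest : List ℕ} {r : ℕ × List ℕ} {G : SimpleGraph ℕ}
    (hG : Hyp P G) (hE : Known E G) (h : hTri P.n P.tf E s rest = some r) : False := by
  unfold hTri at h
  simp only [frc_eq] at h
  obtain ⟨h1, h⟩ := bif_none.1 h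
  obtain ⟨h2, h⟩ := bif_none.1 h
  obtain ⟨h3, h⟩ := bif_none.1 h
  obtain ⟨h4, h⟩ := bif_none.1 h
  obtain ⟨h5, h⟩ := bif_none.1 h
  obtain ⟨h6, h⟩ := bif_none.1 h
  obtain ⟨h7, -⟩ := bif_none.1 h
  exact hG.tri h1 _ _ _ (lt_of_blt h5) (lt_of_blt h6) (lt_of_blt h7)
    (hE.adj (fld_lt _ _) h2) (hE.adj (fld_lt _ _) h3) (hE.adj (fld_lt _ _) h4)

/-- The hypotheses are preserved by a relabelling of the vertices, except possibly for the one
on the paired vertices. -/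
theorem Hyp.comap {P : Ins} {G : SimpleGraph ℕ} (hG : Hyp P G) {f : ℕ → ℕ}
    (hf : Set.BijOn f (Finset.range P.n) (Finset.range P.n))
    (hp : ∀ S : Finset ℕ, (∀ v ∈ S, P.N.testBit v = true) →
      (G.comap f).IsIndepSet (S : Set ℕ) → S.card ≤ P.F) : Hyp P (G.comap f) where
  ind S hS hi := by
    have hinj : Set.InjOn f S := hf.injOn.mono (by exact_mod_cast hS)
    rw [← Finset.card_image_of_injOn hinj]
    refine hG.ind _ ?_ ?_
    · intro x hx
      obtain ⟨y, hy, rfl⟩ := Finset.mem_image.1 hx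
      exact hf.mapsTo (hS hy)
    · rw [Finset.coe_image]
      rintro _ ⟨x, hx, rfl⟩ _ ⟨y, hy, rfl⟩ hxy
      exact hi hx hy (fun h => hxy (h ▸ rfl))
  rob L hl hc := by
    obtain ⟨S, hS, hi, hcard, hd⟩ := hG.rob (L.map (Finset.image f)) (by simpa using hl) (by
      intro C hC
      obtain ⟨D, hD, rfl⟩ := List.mem_map.1 hC
      rw [Finset.coe_image]
      rintro _ ⟨x, hx, rfl⟩ _ ⟨y, hy, rfl⟩ hxy
      exact hc D hD hx hy (fun h => hxy (h ▸ rfl)))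
    have hmem : ∀ x, x ∈ (Finset.range P.n).filter (fun i => f i ∈ S) ↔
      x ∈ Finset.range P.n ∧ f x ∈ S := fun x => Finset.mem_filter
    refine ⟨(Finset.range P.n).filter (fun i => f i ∈ S), Finset.filter_subset _ _, ?_, ?_, ?_⟩
    · intro x hx y hy hxy
      have hx := (hmem x).1 hx
      have hy := (hmem y).1 hy
      exact hi hx.2 hy.2 (fun h => hxy (hf.injOn hx.1 hy.1 h))
    · rw [← hcard, ← Finset.card_image_of_injOn (hf.injOn.mono (by
        intro x hx; exact ((hmem x).1 hx).1))]
      congr 1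
      ext y
      rw [Finset.mem_image]
      constructor
      · rintro ⟨x, hx, rfl⟩
        exact ((hmem x).1 hx).2
      · intro hy
        obtain ⟨x, hx, rfl⟩ := hf.surjOn (hS hy)
        exact ⟨x, (hmem x).2 ⟨hx, hy⟩, rfl⟩
    · intro C hC
      rw [Finset.disjoint_left]
      intro x hx hxC
      exact Finset.disjoint_left.1 (hd _ (List.mem_map_of_mem hC)) ((hmem x).1 hx).2
        (Finset.mem_image_of_mem f hxC)
  deg v hv D hD := by
    refine (hG.deg (f v) (Finset.mem_range.1 (hf.mapsTo (Finset.mem_coe.2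
      (Finset.mem_range.2 hv)))) (D.image f) ?_).trans Finset.card_image_le
    intro u hu huv
    obtain ⟨w, hw, rfl⟩ := hf.surjOn (Finset.mem_coe.2 (Finset.mem_range.2 hu))
    exact Finset.mem_image_of_mem f (hD w (Finset.mem_range.1 hw) huv)
  tri ht a b c ha hb hc := by
    have hm : ∀ x < P.n, f x < P.n := fun x hx => Finset.mem_range.1 (hf.mapsTo
      (Finset.mem_coe.2 (Finset.mem_range.2 hx)))
    exact hG.tri ht _ _ _ (hm a ha) (hm b hb) (hm c hc)
  pairs := hp

theorem permOk_bijOn {n π : ℕ} (h : permOk n π = true) :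
    Set.BijOn (fun i => fld π (Nat.mul 5 i)) (Finset.range n) (Finset.range n) := by
  obtain ⟨R, hR0, hRs, hRn⟩ : ∃ R : ℕ → ℕ, R 0 = 0 ∧
      (∀ k, R (k + 1) = R k ||| 1 <<< (fld π (Nat.mul 5 k))) ∧ R n = ones n :=
    ⟨@Nat.rec (fun _ => ℕ) 0 (fun i r => Nat.lor r (Nat.shiftLeft 1 (fld π (Nat.mul 5 i)))),
      rfl, fun _ => rfl, Nat.eq_of_beq_eq_true h⟩
  have key : ∀ k, ∀ j, (R k).testBit j = true ↔ ∃ i < k, fld π (Nat.mul 5 i) = j := by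
    intro k j
    induction k with
    | zero => simp [hR0]
    | succ k ih =>
      simp only [hRs, Nat.testBit_or, Bool.or_eq_true, ih, Nat.one_shiftLeft, Nat.testBit_two_pow,
        decide_eq_true_eq]
      constructor
      · rintro (⟨i, hi, h⟩ | h)
        exacts [⟨i, by omega, h⟩, ⟨k, by omega, h⟩]
      · rintro ⟨i, hi, h⟩
        rcases Nat.lt_succ_iff_lt_or_eq.1 hi with hi | rfl
        exacts [Or.inl ⟨i, hi, h⟩, Or.inr h]
  have key' : ∀ j, j < n ↔ ∃ i < n, fld π (Nat.mul 5 i) = j := by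
    intro j
    rw [← key n j, hRn, ones_eq, Nat.testBit_two_pow_sub_one, decide_eq_true_eq]
  have hm : Set.MapsTo (fun i => fld π (Nat.mul 5 i)) (Finset.range n) (Finset.range n) := by
    intro i hi
    simp only [Finset.coe_range, Set.mem_Iio] at hi ⊢
    exact (key' _).2 ⟨i, hi, rfl⟩
  have hs : Set.SurjOn (fun i => fld π (Nat.mul 5 i)) (Finset.range n) (Finset.range n) := by
    intro j hj
    simp only [Finset.coe_range, Set.mem_Iio] at hj
    obtain ⟨i, hi, h⟩ := (key' j).1 hj
    exact ⟨i, by simpa using hi, h⟩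
  exact ⟨hm, Finset.injOn_of_surjOn_of_card_le _ hm hs le_rfl, hs⟩

/-- Configurations that cannot occur. -/
def Refuted (P : Ins) (l : List ℕ) : Prop :=
  ∀ G, Hyp P G → ¬ ∀ e ∈ l, G.Adj (hi e) (lo e)

theorem hMap_some {n C E : ℕ} {f : ℕ → ℕ → Res} {r : ℕ × List ℕ} (fuel : ℕ) :
    ∀ v U π s, hMap n C E f fuel v U π s = some r → ∃ π' s', f π' s' = some r := by
  induction fuel with
  | zero => exact fun _ _ π s h => ⟨π, s, h⟩
  | succ k ih =>
    intro v U π s h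
    unfold hMap at h
    simp only [frc_eq] at h
    exact ih _ _ _ _ h

theorem reuse_false {P : Ins} {bs : List (List ℕ)} {E s : ℕ} {rest : List ℕ} {r : ℕ × List ℕ}
    {G : SimpleGraph ℕ} (hP : P.Valid) (hbs : ∀ l ∈ bs, Refuted P l) (hG : Hyp P G)
    (hE : Known E G) (h : hReuse P bs E s rest = some r) : False := by
  unfold hReuse at h
  simp only [frc_eq] at h
  obtain ⟨h1, h⟩ := bif_none.1 h
  cases hb : nthO bs (Nat.land (Nat.shiftRight s 3) 63) with
  | none => rw [hb] at h; cases h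
  | some l =>
    rw [hb] at h
    obtain ⟨π, s', h⟩ := hMap_some _ _ _ _ _ h
    obtain ⟨h2, h⟩ := bif_none.1 h
    obtain ⟨h3, -⟩ := bif_none.1 h
    have hf := permOk_bijOn h2
    have hFp : P.F = P.p := Nat.eq_of_beq_eq_true h1
    have hind := hG.comap hf (fun S hS hi => by
      have hinj : Set.InjOn (fun i => fld π (Nat.mul 5 i)) S :=
        hf.injOn.mono (fun v hv => Finset.mem_coe.2 (Finset.mem_range.2 (hP.N_lt v (hS v hv))))
      rw [hFp, ← Finset.card_image_of_injOn hinj]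
      refine hG.ind _ ?_ ?_
      · intro x hx
        obtain ⟨y, hy, rfl⟩ := Finset.mem_image.1 hx
        exact hf.mapsTo (Finset.mem_coe.2 (Finset.mem_range.2 (hP.N_lt y (hS y hy))))
      · rw [Finset.coe_image]
        rintro _ ⟨x, hx, rfl⟩ _ ⟨y, hy, rfl⟩ hxy
        exact hi hx hy (fun h => hxy (h ▸ rfl)))
    exact hbs l (nthO_mem hb) _ hind fun e he => hE.adj (fld_lt _ _) (allL_eq_true h3 e he)

theorem run_false {P : Ins} {bs : List (List ℕ)} {xs : List ℕ} (hP : P.Valid)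
    (hbs : ∀ l ∈ bs, Refuted P l) (hxs : IsTab P.n P.F xs) (fuel : ℕ) :
    ∀ (E : ℕ) (L : List ℕ) (I E0 s : ℕ) (rest : List ℕ) (r : ℕ × List ℕ),
      run P bs xs (ones (chs P.n P.F)) fuel E L I E0 s rest = some r → Tab P E I →
      ∀ G, Hyp P G → Known E G → NonE E0 G → False := by
  induction fuel with
  | zero => intro E L I E0 s rest r h; cases h
  | succ fuel ih =>
    intro E L I E0 s rest r h hI G hG hE hE0
    have h' : nxt (disp P bs xs (ones (chs P.n P.F)) (run P bs xs (ones (chs P.n P.F)) fuel)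
      E L I E0) s rest = some r := h
    obtain ⟨s, rest, h⟩ := nxt_some h'
    unfold disp at h
    simp only [frc_eq] at h
    cases ht : Nat.beq (Nat.land s 7) 0
    · cases ht1 : Nat.beq (Nat.land s 7) 1
      · cases ht2 : Nat.beq (Nat.land s 7) 2
        · cases ht3 : Nat.beq (Nat.land s 7) 3
          · cases ht4 : Nat.beq (Nat.land s 7) 4
            · cases ht5 : Nat.beq (Nat.land s 7) 5
              · rw [ht, ht1, ht2, ht3, ht4, ht5] at h
                obtain ⟨E0', s', h3, h4⟩ := nonE_common hxs hI hG hE hE0 h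
                exact ih _ _ _ _ _ _ _ h4 hI G hG hE h3
              · rw [ht, ht1, ht2, ht3, ht4, ht5] at h
                exact reuse_false hP hbs hG hE h
            · rw [ht, ht1, ht2, ht3, ht4] at h
              exact set_false hG hE0 h
          · rw [ht, ht1, ht2, ht3] at h
            exact deg_false hG hE0 h
        · rw [ht, ht1, ht2] at h
          exact triangle_false hG hE h
      · rw [ht, ht1] at h
        exact leaf_false hxs hI hG hE h
    · rw [ht, cond_true] at h
      unfold hSplit at h
      simp only [frc_eq] at h
      cases hab : Nat.beq (fld s 3) (fld s 8)
      · rw [hab, cond_false] at h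
        obtain ⟨s', rest', h1, h2⟩ := bnd_some h
        by_cases hadj : G.Adj (fld s 3) (fld s 8)
        · exact ih _ _ _ _ _ _ _ h1 (tab_addI hxs (fld_lt _ _) (fld_lt _ _) hI) G hG
            ((known_addE (fld_lt _ _) (fld_lt _ _)).2 ⟨hE, hadj⟩) hE0
        · exact ih _ _ _ _ _ _ _ h2 hI G hG hE (nonE_addE (fld_lt _ _) (fld_lt _ _) hE0 hadj)
      · rw [hab] at h; cases h

end Folkman

namespace Folkman

/-! ### Soundness of the path search -/

/-- A step of an alternating path: an edge from `u` followed by a matching edge to `v ∉ A`. -/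
def Step (P : Ins) (G : SimpleGraph ℕ) (A u v : ℕ) : Prop :=
  P.N.testBit u = true ∧ P.N.testBit (mate v) = true ∧ G.Adj u (mate v) ∧ A.testBit v = false

def Path (P : Ins) (G : SimpleGraph ℕ) (A : ℕ) : ℕ → ℕ → Prop :=
  Relation.ReflTransGen (Step P G A)

theorem last_exit {α : Type} {R : α → α → Prop} {C : α → Prop} {x y : α}
    (h : Relation.ReflTransGen R x y) (hx : C x) (hy : ¬ C y) :
    ∃ r v, C r ∧ ¬ C v ∧ R r v ∧ Relation.ReflTransGen (fun u w => R u w ∧ ¬ C w) v y := by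
  have key : (∃ r v, C r ∧ ¬ C v ∧ R r v ∧
      Relation.ReflTransGen (fun u w => R u w ∧ ¬ C w) v y) ∨
      ¬ C x ∧ Relation.ReflTransGen (fun u w => R u w ∧ ¬ C w) x y := by
    clear hx
    induction h using Relation.ReflTransGen.head_induction_on with
    | refl => exact Or.inr ⟨hy, .refl⟩
    | head hab _ ih =>
      rename_i a c _
      rcases ih with ih | ⟨h1, h2⟩
      · exact Or.inl ih
      · by_cases ha : C a
        · exact Or.inl ⟨a, c, ha, h1, hab, h2⟩
        · exact Or.inr ⟨ha, .head ⟨hab, h1⟩ h2⟩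
  rcases key with key | key
  exacts [key, absurd hx key.1]

theorem forN_some {f : ℕ → ℕ → List ℕ → Res} (n : ℕ) : ∀ {s : ℕ} {rest : List ℕ}
    {r : ℕ × List ℕ}, forN n f s rest = some r →
    ∀ k < n, ∃ s rest r, f k s rest = some r := by
  induction n with
  | zero => intro s rest r _ k hk; omega
  | succ n ih =>
    intro s rest r h k hk
    obtain ⟨s', rest', h1, h2⟩ := bnd_some (show bnd (f n s rest) (forN n f) = some r from h)
    rcases Nat.lt_succ_iff_lt_or_eq.1 hk with hk | rfl
    exacts [ih h2 k hk, ⟨_, _, _, h1⟩]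

/-- The involution exchanging the pairs `{2 * t, 2 * t + 1}` and `{mate v, v}`. -/
noncomputable def swapPair (t v x : ℕ) : ℕ :=
  if x = 2 * t then mate v else if x = 2 * t + 1 then v else
  if x = mate v then 2 * t else if x = v then 2 * t + 1 else x

theorem swapPair_swapPair (t v x : ℕ) : swapPair t v (swapPair t v x) = x := by
  have := mate_eq v
  unfold swapPair
  split_ifs at * <;> omega

theorem swapPair_mate (t v x : ℕ) : swapPair t v (mate x) = mate (swapPair t v x) := by
  have := mate_eq v
  have := mate_eq x
  rw [mate_eq (swapPair t v x)]
  unfold swapPair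
  split_ifs at * <;> omega

theorem swapPair_of_lt {t v x : ℕ} (hv : 2 * t ≤ v) (hx : x < 2 * t) : swapPair t v x = x := by
  have := mate_eq v
  unfold swapPair
  split_ifs at * <;> omega

theorem swapPair_of_ge {t v n x : ℕ} (ht : t < n) (hv : mate v < 2 * n) (hx : 2 * n ≤ x) :
    swapPair t v x = x := by
  have := mate_eq v
  unfold swapPair
  split_ifs at * <;> omega

theorem swapPair_mem {t v n x : ℕ} (ht : t < n) (hv : mate v < 2 * n) (hv' : 2 * t ≤ v)
    (hx : 2 * t ≤ x) (hx' : x < 2 * n) : 2 * t ≤ swapPair t v x ∧ swapPair t v x < 2 * n := by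
  have := mate_eq v
  unfold swapPair
  split_ifs at * <;> omega

theorem bif_false_iff {c x : Bool} : (bif c then x else false) = true ↔ c = true ∧ x = true := by
  cases c <;> simp

theorem shiftRight_eq_zero {m i j : ℕ} (h : Nat.beq (Nat.shiftRight m i) 0 = true) (hj : i ≤ j) :
    m.testBit j = false := by
  have e : m >>> i = 0 := Nat.eq_of_beq_eq_true h
  have := Nat.testBit_shiftRight (i := i) (j := j - i) m
  rw [e, Nat.zero_testBit, Nat.add_sub_cancel' hj] at this
  exact this.symm

structure Fresh (P : Ins) (E t : ℕ) : Prop where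
  lt : ∀ i j, j < 32 → E.testBit (32 * i + j) = true → i < 32
  mem : ∀ i, 2 * t ≤ i → i < 2 * P.NP → P.N.testBit i = true
  row : ∀ i j, 2 * t ≤ i → i < 2 * P.NP → j < 32 →
    (E.testBit (32 * i + j) = true ↔ j = mate i)
  old : ∀ i j, (i < 2 * t ∨ 2 * P.NP ≤ i) → j < 32 → E.testBit (32 * i + j) = true →
    j < 2 * t ∨ 2 * P.NP ≤ j

theorem fresh_sound {P : Ins} (hP : P.Valid) {E t : ℕ} (h : fresh P E t = true) : Fresh P E t := by
  unfold fresh at h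
  obtain ⟨h1, h⟩ := bif_false_iff.1 h
  have h := allN_eq_true h
  have hNP := hP.NP_le
  have hlt : ∀ i j, j < 32 → E.testBit (32 * i + j) = true → i < 32 := by
    intro i j hj he
    by_contra hi
    rw [shiftRight_eq_zero h1 (by omega)] at he
    cases he
  have hnew : ∀ i, 2 * t ≤ i → i < 2 * P.NP → P.N.testBit i = true ∧ row E i = 1 <<< mate i := by
    intro i h2 h3
    have h' := h i (by omega)
    rw [show Nat.ble (Nat.mul 2 t) i = true from Nat.ble_eq.symm ▸ h2, cond_true,
      show Nat.blt i (Nat.mul 2 P.NP) = true by rw [Nat.blt_eq]; exact h3, cond_true] at h'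
    obtain ⟨h4, h5⟩ := bif_false_iff.1 h'
    rw [tb_eq] at h4
    exact ⟨h4, Nat.eq_of_beq_eq_true h5⟩
  refine ⟨hlt, fun i h2 h3 => (hnew i h2 h3).1, ?_, ?_⟩
  · intro i j h2 h3 hj
    have hr := row_bit E i j
    rw [(hnew i h2 h3).2, Nat.one_shiftLeft, Nat.testBit_two_pow, decide_eq_true_eq] at hr
    constructor
    · exact fun he => (hr.2 ⟨hj, he⟩).symm
    · exact fun he => (hr.1 he.symm).2
  · intro i j hi hj he
    by_contra hcon
    have h' := h i (hlt i j hj he)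
    have hz : Nat.beq (Nat.shiftRight (Nat.land (row E i) (ones (Nat.mul 2 P.NP)))
        (Nat.mul 2 t)) 0 = true := by
      cases hc : Nat.ble (Nat.mul 2 t) i
      · rwa [hc] at h'
      · cases hd : Nat.blt i (Nat.mul 2 P.NP)
        · rwa [hc, hd] at h'
        · have h2 : 2 * t ≤ i := Nat.le_of_ble_eq_true hc
          have h3 : i < 2 * P.NP := lt_of_blt hd
          omega
    have hb := shiftRight_eq_zero hz (j := j) (show 2 * t ≤ j by omega)
    have e : (Nat.land (row E i) (ones (Nat.mul 2 P.NP))) = row E i &&& ones (2 * P.NP) := rfl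
    rw [e, Nat.testBit_and, (row_bit E i j).2 ⟨hj, he⟩, ones_eq, Nat.testBit_two_pow_sub_one] at hb
    simp at hb
    omega

theorem Fresh.hyp_comap {P : Ins} {G : SimpleGraph ℕ} {E t v : ℕ} (hP : P.Valid) (hG : Hyp P G)
    (h : Fresh P E t) (hv : 2 * t ≤ v) (hN : P.N.testBit (mate v) = true) :
    (∀ x, P.N.testBit x = true → P.N.testBit (swapPair t v x) = true) ∧
      Hyp P (G.comap (swapPair t v)) := by
  have hv' := hP.N_lt' _ hN
  have ht : t < P.NP := by have := mate_div v; omega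
  have hNN : ∀ x, P.N.testBit x = true → P.N.testBit (swapPair t v x) = true := by
    intro x hx
    rcases lt_or_ge x (2 * t) with h1 | h1
    · rwa [swapPair_of_lt hv h1]
    · obtain ⟨h2, h3⟩ := swapPair_mem ht hv' hv h1 (hP.N_lt' x hx)
      exact h.mem _ h2 h3
  have hinj : Function.Injective (swapPair t v) :=
    (show Function.Involutive (swapPair t v) from swapPair_swapPair t v).injective
  refine ⟨hNN, hG.comap (f := swapPair t v) ?_ ?_⟩
  · have hm : Set.MapsTo (swapPair t v) (Finset.range P.n) (Finset.range P.n) := by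
      intro x hx
      rcases lt_or_ge x (2 * t) with h1 | h1
      · rwa [swapPair_of_lt hv h1]
      · rcases lt_or_ge x (2 * P.NP) with h2 | h2
        · obtain ⟨h3, h4⟩ := swapPair_mem ht hv' hv h1 h2
          exact Finset.mem_coe.2 (Finset.mem_range.2 (hP.N_lt _ (h.mem _ h3 h4)))
        · rwa [swapPair_of_ge ht hv' h2]
    exact ⟨hm, hinj.injOn, fun x hx => ⟨_, hm hx, swapPair_swapPair t v x⟩⟩
  · intro S hS hi
    rw [← Finset.card_image_of_injective S hinj]
    refine hG.pairs _ ?_ ?_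
    · intro x hx
      obtain ⟨y, hy, rfl⟩ := Finset.mem_image.1 hx
      exact hNN y (hS y hy)
    · rw [Finset.coe_image]
      rintro _ ⟨x, hx, rfl⟩ _ ⟨y, hy, rfl⟩ hxy
      exact hi hx hy (fun h => hxy (h ▸ rfl))

theorem Fresh.known_comap {P : Ins} {G : SimpleGraph ℕ} {E t v : ℕ} (hP : P.Valid)
    (h : Fresh P E t) (hv : 2 * t ≤ v) (hN : P.N.testBit (mate v) = true) (hE : Known E G) :
    Known E (G.comap (swapPair t v)) := by
  have hv' := hP.N_lt' _ hN
  have ht : t < P.NP := by have := mate_div v; omega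
  have hNP := hP.NP_le
  intro i j hj he
  rw [SimpleGraph.comap_adj]
  have hold : ∀ x, x < 2 * t ∨ 2 * P.NP ≤ x → swapPair t v x = x := by
    rintro x (hx | hx)
    exacts [swapPair_of_lt hv hx, swapPair_of_ge ht hv' hx]
  by_cases hi : i < 2 * t ∨ 2 * P.NP ≤ i
  · rw [hold i hi, hold j (h.old i j hi hj he)]
    exact hE i j hj he
  · obtain ⟨h3, h4⟩ := swapPair_mem (x := i) ht hv' hv (by omega) (by omega)
    rw [(h.row i j (by omega) (by omega) hj).1 he, swapPair_mate]
    have : mate (swapPair t v i) < 32 := by have := mate_div (swapPair t v i); omega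
    exact hE _ _ this ((h.row _ _ h3 h4 this).2 rfl)

theorem Path.comap {P : Ins} {G : SimpleGraph ℕ} {t v A tgt : ℕ}
    (hv : 2 * t ≤ v) (hNN : ∀ x, P.N.testBit x = true → P.N.testBit (swapPair t v x) = true)
    (hA : ∀ j, 2 * t ≤ j → A.testBit j = false) (htgt : tgt < 2 * t) (h : Path P G A v tgt) :
    Path P (G.comap (swapPair t v)) A (2 * t + 1) tgt := by
  have h' := Relation.ReflTransGen.lift (p := Step P (G.comap (swapPair t v)) A)
    (swapPair t v) (fun a b (hab : Step P G A a b) => ?_) _ _ h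
  · unfold Function.onFun at h'
    rwa [swapPair_of_lt hv htgt, show swapPair t v v = 2 * t + 1 by
      have := mate_eq v
      unfold swapPair
      split_ifs at * <;> omega] at h'
  · obtain ⟨h1, h2, h3, h4⟩ := hab
    refine ⟨hNN _ h1, ?_, ?_, ?_⟩
    · rw [← swapPair_mate]; exact hNN _ h2
    · rw [← swapPair_mate, SimpleGraph.comap_adj, swapPair_swapPair, swapPair_swapPair]; exact h3
    · rcases lt_or_ge b (2 * t) with hb | hb
      · rwa [swapPair_of_lt hv hb]
      · refine hA _ ?_
        have := mate_eq v
        unfold swapPair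
        split_ifs at * <;> omega

/-- The path lemma: a set of known edges provides alternating paths. -/
def HasPaths (P : Ins) (okl : ℕ → Bool) : Prop :=
  ∀ G, Hyp P G → (∀ e ∈ P.mx, G.Adj (hi e) (lo e)) → ∀ l, okl l = true → Path P G 0 l (mate l)

theorem auto_false {P : Ins} {E s : ℕ} {L rest : List ℕ} {r : ℕ × List ℕ} {G : SimpleGraph ℕ}
    (hP : P.Valid) (hG : Hyp P G) (hE : Known E G) (h : hAuto P.n P.tf E L s rest = some r) :
    False := by
  unfold hAuto at h
  simp only [frc_eq] at h
  obtain ⟨h1, h⟩ := bif_none.1 h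
  obtain ⟨h2, h⟩ := bif_none.1 h
  obtain ⟨h3, h⟩ := bif_none.1 h
  obtain ⟨h4, h⟩ := bif_none.1 h
  obtain ⟨h5, h⟩ := bif_none.1 h
  obtain ⟨h6, h⟩ := bif_none.1 h
  obtain ⟨h7, -⟩ := bif_none.1 h
  have hc := (lt_of_blt h7).trans_le hP.n_le
  exact hG.tri h1 _ _ _ (lt_of_blt h5) (lt_of_blt h6) (lt_of_blt h7)
    (hE.adj (lo_lt _) h2) (hE.adj hc h3) (hE.adj hc h4)

theorem prun_false {P : Ins} {okl : ℕ → Bool} {bs : List (List ℕ)} {xs : List ℕ} (hP : P.Valid)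
    (hbs : ∀ l ∈ bs, Refuted P l) (hxs : IsTab P.n P.F xs) (hp : HasPaths P okl) (fuel : ℕ) :
    ∀ (E : ℕ) (L : List ℕ) (I t A cur tgt s : ℕ) (rest : List ℕ) (r : ℕ × List ℕ),
      prun P okl bs xs (ones (chs P.n P.F)) fuel E L I t A cur tgt s rest = some r → Tab P E I →
      ∀ G, Hyp P G → Known E G → Path P G A cur tgt → False := by
  induction fuel with
  | zero => intro E L I t A cur tgt s rest r h; cases h
  | succ fuel ih =>
    intro E L I t A cur tgt s rest r h hI G hG hE hpath
    have h' : nxt (pdisp P okl bs xs (ones (chs P.n P.F))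
      (prun P okl bs xs (ones (chs P.n P.F)) fuel) E L I t A cur tgt) s rest = some r := h
    obtain ⟨s, rest, h⟩ := nxt_some h'
    unfold pdisp at h
    simp only [frc_eq] at h
    cases ht0 : Nat.beq (Nat.land s 3) 0
    · cases ht1 : Nat.beq (Nat.land s 3) 1
      · cases ht2 : Nat.beq (Nat.land s 3) 2
        · rw [ht0, ht1, ht2, cond_false, cond_false, cond_false] at h
          exact auto_false hP hG hE h
        · rw [ht0, ht1, ht2, cond_false, cond_false, cond_true] at h
          exact run_false hP hbs hxs _ _ _ _ _ _ _ _ h hI G hG hE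
            (fun i j _ h => by rw [Nat.zero_testBit] at h; cases h)
      · rw [ht0, ht1, cond_false, cond_true] at h
        obtain ⟨h1, h⟩ := bif_none.1 h
        obtain ⟨h2, h⟩ := bif_none.1 h
        exact ih _ _ _ _ _ _ _ _ _ _ h hI G hG hE
          (hp G hG (fun e he => hE.adj (lo_lt e) (allL_eq_true h1 e he)) _ h2)
    · rw [ht0, cond_true] at h
      unfold hExpand at h
      simp only [frc_eq] at h
      generalize clos _ _ _ _ _ _ = C at h
      obtain ⟨h1, h⟩ := bif_none.1 h
      have h2 : tb C tgt = false := by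
        cases hc : tb C tgt
        · rfl
        · rw [hc] at h; cases h
      rw [h2, cond_false] at h
      obtain ⟨h3, h⟩ := bif_none.1 h
      obtain ⟨h4, h⟩ := bif_none.1 h
      obtain ⟨h5, h⟩ := bif_none.1 h
      have hfr := fresh_sound hP h5
      have h3 : tgt < 2 * t := lt_of_blt h3
      have hA' : ∀ j, 2 * t ≤ j → (A ||| C).testBit j = false := fun j hj =>
        shiftRight_eq_zero h4 hj
      rw [tb_eq] at h1 h2
      obtain ⟨x, v, hx, hv, hxv, hvp⟩ := last_exit (C := fun i => C.testBit i = true) hpath h1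
        (by rw [h2]; simp)
      obtain ⟨hxN, hvN, hadj, hvA⟩ := hxv
      have hx2 : x < 2 * t := by
        by_contra hcon
        have := hA' x (not_lt.1 hcon)
        rw [Nat.testBit_or, hx] at this
        simp at this
      have hvA' : (A ||| C).testBit v = false := by
        rw [Nat.testBit_or, hvA]; simpa using hv
      have hvp' : Path P G (A ||| C) v tgt := by
        refine Relation.ReflTransGen.mono ?_ _ _ hvp
        rintro a b ⟨⟨k1, k2, k3, k4⟩, k5⟩
        refine ⟨k1, k2, k3, ?_⟩
        rw [Nat.testBit_or, k4]; simpa using k5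
      have hx32 : x < 32 := (hP.N_lt x hxN).trans_le hP.n_le
      obtain ⟨s1, rest1, r1, hr1⟩ := forN_some _ h x hx2
      rw [tb_eq, tb_eq, hx, hxN, cond_true, cond_true] at hr1
      have hstep := forN_some _ hr1
      have hNP := hP.NP_le
      rcases lt_or_ge v (2 * t) with hvt | hvt
      · obtain ⟨s2, rest2, r2, hr2⟩ := hstep v (Nat.lt_succ_of_lt hvt)
        unfold hStep at hr2
        simp only [frc_eq] at hr2
        rw [show Nat.beq v (Nat.mul 2 t) = false from
            Bool.eq_false_iff.2 fun hh => hvt.ne (Nat.eq_of_beq_eq_true hh), cond_false,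
          tb_eq, show (Nat.lor A C).testBit v = false from hvA', cond_false, tb_eq, hvN, cond_true,
          show Nat.beq x (mate v) = false from
            Bool.eq_false_iff.2 fun hh => hadj.ne (Nat.eq_of_beq_eq_true hh), cond_false] at hr2
        have hw32 : mate v < 32 := (hP.N_lt _ hvN).trans_le hP.n_le
        exact ih _ _ _ _ _ _ _ _ _ _ hr2 (tab_addI hxs hx32 hw32 hI) G hG
          ((known_addE hx32 hw32).2 ⟨hE, hadj⟩) hvp'
      · obtain ⟨s2, rest2, r2, hr2⟩ := hstep (2 * t) (Nat.lt_succ_self _)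
        have ht : t < P.NP := by have := mate_div v; have := hP.N_lt' _ hvN; omega
        unfold hStep at hr2
        simp only [frc_eq] at hr2
        rw [show Nat.beq (2 * t) (Nat.mul 2 t) = true from Nat.beq_refl _, cond_true,
          show Nat.blt t P.NP = true by rw [Nat.blt_eq]; exact ht, cond_true] at hr2
        obtain ⟨hNN, hG'⟩ := hfr.hyp_comap hP hG hvt hvN
        refine ih _ _ _ _ _ _ _ _ _ _ hr2 (tab_addI hxs hx32 (by omega) hI) _ hG'
          ((known_addE hx32 (by omega)).2 ⟨hfr.known_comap hP hvt hvN hE, ?_⟩)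
          (Path.comap hvt hNN hA' h3 hvp')
        rw [SimpleGraph.comap_adj, swapPair_of_lt hvt hx2,
          show swapPair t v (2 * t) = mate v from if_pos rfl]
        exact hadj

theorem known_initE {G : SimpleGraph ℕ} {l : List ℕ} (hl : ∀ e ∈ l, hi e < 32)
    (h : ∀ e ∈ l, G.Adj (hi e) (lo e)) : Known (initE l) G := by
  induction l with
  | nil => intro i j _ h; rw [show initE [] = 0 from rfl, Nat.zero_testBit] at h; cases h
  | cons e l ih =>
    exact (known_addE (hl e (by simp)) (lo_lt e)).2
      ⟨ih (fun e he => hl e (by simp [he])) fun e he => h e (by simp [he]), h e (by simp)⟩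

theorem tab_initI {P : Ins} {xs l : List ℕ} (hxs : IsTab P.n P.F xs) (hl : ∀ e ∈ l, hi e < 32) :
    Tab P (initE l) (initI xs (ones (chs P.n P.F)) l) := by
  induction l with
  | nil =>
    intro G _ b hb _
    rw [show initI xs (ones (chs P.n P.F)) [] = ones (chs P.n P.F) from rfl, ones_eq, chs_eq,
      Nat.testBit_two_pow_sub_one]
    exact decide_eq_true (idx_lt _ _ _ hb)
  | cons e l ih =>
    exact tab_addI hxs (hl e (by simp)) (lo_lt e) (ih fun e he => hl e (by simp [he]))

theorem runAll_sound {P : Ins} {okl : ℕ → Bool} {xs : List ℕ} (hP : P.Valid)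
    (hxs : IsTab P.n P.F xs) (hp : HasPaths P okl) (cs : List Cert)
    (hcs : ∀ c ∈ cs, ∀ e ∈ c.edges, hi e < 32) : ∀ bs : List (List ℕ),
    (∀ l ∈ bs, Refuted P l) → runAll P okl xs (ones (chs P.n P.F)) cs bs = true →
    ∀ c ∈ cs, Refuted P c.edges := by
  induction cs with
  | nil => intro bs _ _ c hc; cases hc
  | cons c cs ih =>
    intro bs hbs h
    obtain ⟨b, t, code⟩ := c
    cases ho : prun P okl bs xs (ones (chs P.n P.F)) 60 (initE b) b
        (initI xs (ones (chs P.n P.F)) b) t 0 0 0 1 code with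
    | none =>
      have h' : (Option.rec false (fun _ => runAll P okl xs (ones (chs P.n P.F)) cs (bs ++ [b]))
        (prun P okl bs xs (ones (chs P.n P.F)) 60 (initE b) b
        (initI xs (ones (chs P.n P.F)) b) t 0 0 0 1 code) : Bool) = true := h
      rw [ho] at h'; cases h'
    | some r =>
      have h' : (Option.rec false (fun _ => runAll P okl xs (ones (chs P.n P.F)) cs (bs ++ [b]))
        (prun P okl bs xs (ones (chs P.n P.F)) 60 (initE b) b
        (initI xs (ones (chs P.n P.F)) b) t 0 0 0 1 code) : Bool) = true := h
      rw [ho] at h'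
      have hb : Refuted P b := by
        intro G hG he
        have hl : ∀ e ∈ b, hi e < 32 := hcs ⟨b, t, code⟩ (by simp)
        exact prun_false hP hbs hxs hp _ _ _ _ _ _ _ _ _ _ _ ho (tab_initI hxs hl) G hG
          (known_initE hl he) .refl
      intro c hc
      rcases List.mem_cons.1 hc with rfl | hc
      · exact hb
      · refine ih (fun c hc => hcs c (by simp [hc])) (bs ++ [b]) ?_ h' c hc
        intro l hl
        rcases List.mem_append.1 hl with hl | hl
        · exact hbs l hl
        · rw [List.mem_singleton.1 hl]; exact hb

theorem checkAll_sound {P : Ins} {okl : ℕ → Bool} {cs : List Cert} (hP : P.Valid)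
    (hp : HasPaths P okl) (hcs : ∀ c ∈ cs, ∀ e ∈ c.edges, hi e < 32)
    (h : checkAll P okl cs = true) : ∀ c ∈ cs, Refuted P c.edges := by
  unfold checkAll at h
  rw [tabs_eq, List.append_nil] at h
  exact runAll_sound hP (isTab_range _ _) hp cs hcs [] (by simp) h

end Folkman

namespace Folkman
noncomputable def insBase : Ins :=
  ⟨18, 7, 2, 7, 3, true, 8, 65535, [1, 67, 133, 199, 265, 331, 397, 463, 529]⟩

noncomputable def certBase0 : Cert := ⟨[1, 2, 4, 133, 163, 38, 199, 226, 40, 265, 291, 74, 331, 364, 397, 430, 463, 483, 529], 8,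
   [174937109654272020783018511984095258654534575006516819433424391231946644695923853927343732681687936552519034610816278441540918920525260791231389843458570569167460980181413336486426,
    327479349678906500508101780149044894236856288513942848337347451601387678605181522272865153932413826333198850724899275460313571103311067072679454351867713594117926615032556933160,
    309025219783157891584845282449625373482694157774577323913253237842706835377137065807848694020774393267094265751143234807484457876803262498832881332815366816341733495788468709518,
    46172120085810751999842217796820]⟩

noncomputable def certBase1 : Cert := ⟨[1, 2, 4, 133, 166, 199, 227, 40, 265, 290, 42, 331, 355, 76, 397, 430, 463, 483, 529], 8,
   [123552366240671069930456865926189539625795961787342211854877864250598109368896396432148554043783541261653402634517662322307921459392811912244146421064106304454068302164881108144506,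
    625883124436]⟩

noncomputable def certBase2 : Cert := ⟨[1, 2, 4, 133, 163, 38, 199, 226, 40, 265, 298, 331, 355, 76, 397, 430, 463, 483, 529], 8,
   [240694922052967427455387990357255802098743279563700084996205936403276189715846374018851301694834675183810013543465955564208503257414566111279950000318447807091723409763911578980826,
    68015361558738113276644]⟩

noncomputable def certBase3 : Cert := ⟨[1, 2, 3, 36, 133, 162, 38, 199, 227, 72, 265, 298, 331, 364, 397, 430, 463, 483, 529], 8,
   [77131494803885128789914758554620042269289108475632536146602309133081887848850656205006838184730461587631655901397784989058605316563704660041822068228027442849781261949006769852570,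
    805221800612943756168462625605613300755274418231529233772638400808601059057731549110952609463690282945673201562130532350431630702499258832989276003153449168666466183122537619030,
    1191755533974957298806640147249482013126931762571161166833134494238069805243180768632384923354872546226368159228284501740652669680070841040345981206229133431767755643399550337112,
    764617019018670687392544973615708260724076244760424350658933458517544688373104854235158962501799879285431602544137114101508105339740838538267845995449635945653146996816]⟩

noncomputable def certBase4 : Cert := ⟨[1, 2, 3, 36, 133, 162, 38, 199, 232, 265, 291, 74, 331, 364, 397, 430, 463, 483, 529], 8,
   [105009041975623216406009326669140980920753152372176419797923375250562910305772108550554]⟩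

noncomputable def certBase5 : Cert := ⟨[1, 2, 3, 36, 133, 166, 199, 226, 40, 265, 298, 331, 355, 76, 397, 430, 463, 483, 529], 8,
   [168499522919564897150271083060294114982391442031169376091948069584051172263858770447245716208144446873157038968407672543816229962940141586686940934640540260524396884220511282565434,
    18607335437590551485868220687183290593440381805755324970936621145477460098749143728023183851956720190830997547648331671790807003348414138123843032546151958167218115628748984946742,
    171607450628632559939072388771843846510570791561024763911855002002594153584343502727684410778886893904997092]⟩

noncomputable def certBase6 : Cert := ⟨[1, 2, 4, 133, 163, 38, 199, 232, 265, 290, 42, 331, 355, 76, 397, 430, 463, 483, 529], 8,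
   [1469155635194599292824683516770538984883857114123438859225366197702263345626]⟩

noncomputable def certBase7 : Cert := ⟨[1, 2, 4, 133, 163, 38, 199, 232, 265, 298, 331, 354, 44, 397, 419, 78, 463, 483, 529], 8,
   [6670438923391231185726372024670993856999590226282186514201425693803877141189595451182838100361115749616198413507103496701924311101836975683288436538846186572016018054179491451322,
    124402233856548884322740980160758653314201856125797427323674360560401924253535682769260922476122235945241848253568500090025318671600342886551471809137689287952123183255899035521352,
    117178306862721045929604699782456495088794570327957242374893996927668628492293269672677864530688053137151417714652726372291641978068586132222578873091848948660652468549429614473765,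
    16336967668785717269569425238668627757996153856104373597725126276045123190672938148635373676400481637941752999329155294571507395833025351964033564695800272016751337065544]⟩

noncomputable def certBase8 : Cert := ⟨[1, 2, 4, 133, 166, 199, 227, 40, 265, 298, 331, 354, 44, 397, 419, 78, 463, 483, 529], 8,
   [13764973480505592327201915744769840780075695803338824995003080400169473449716478479815540288828416643835454421340215786045242065535976299236586267254061698544640016230634050326970,
    2429777314842517837436348202651758154218047879491656]⟩

noncomputable def certBase9 : Cert := ⟨[1, 2, 4, 133, 166, 199, 232, 265, 291, 42, 331, 354, 44, 397, 419, 78, 463, 483, 529], 8,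
   [69106764709646246200068880854751615266232083308343780431808934106139054956589374802713263662509941230829205090527115403402316350141219272546787429777785515794628308558106859442618,
    1868767516907002568185637362868278]⟩

noncomputable def certBase10 : Cert := ⟨[1, 2, 4, 133, 163, 38, 199, 226, 35, 72, 265, 298, 331, 364, 397, 430, 463, 483, 529], 8,
   [2759987910408977177478942474813702361767931454436188056638444156449415442096268189998656419701227793423521776566474625129842190638871330974246113438814753241953301097108223747199450,
    1979398527721047452451266377485944536406720652674476061241990110900644909343478800736851031291789240350082770963827495893296083893676584296994227994483033952927312480940274618142768,
    988414260170184912797069882858432119005896958718357635939298389566597722357159182604519042278194277458189477261019631957304730758197597696243836538617195130432438409411192695039630,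
    20137100559856584963656041962826481470334083081751280378055597370206270613986896942599031603765281970985715409635987116912170846077121135680260120306675387710838317162063406734,
    405052510465795007292110826826338054267096430214122663498234146249717880500198824847874247263004952113708622534140800074700008927487805301831648842471997400004914095622997037796,
    3854349765768069124003478489815909508523093483536242512925805575961290238520147201328802534644147902325059124347318138017296106680080170251285619717686367920331679178976429146460340,
    59802296191418038634731969983213738780348433353980149447035543690615056418921970080862]⟩

noncomputable def certBase11 : Cert := ⟨[1, 4, 133, 162, 6, 199, 227, 40, 265, 290, 42, 331, 355, 76, 397, 430, 463, 483, 529], 8,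
   [3538414575617351651232344572552424530776316950671011441941065621102836324216327943372792581903110898079280273843680104350738918669742642331126946672725932030071372545531875418,
    650851530450107546418178109882557953675826198700154736225497843659971830751023370115986209025385062685014412556232796571994445734456006263999150840675118872394482104335885478628,
    1001684129403910261507492055515656602123829222958057267207677909412403961472287309756390446558642571454015106011871950831922140435709239124363413010614203368466097698574884152950,
    34032849900674729564679680509336148438082061070573644565531589664550738967819249591258668543250539594582920304063348669659084423799663780962327709667036805878048423451067616504140,
    134492854757623693986972144166004915749098908381425717]⟩

noncomputable def certBase12 : Cert := ⟨[1, 4, 133, 162, 6, 199, 227, 40, 265, 290, 42, 331, 364, 397, 419, 78, 463, 483, 529], 8,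
   [15213922062762608416282605778861193053998401252734625058266145248478342655665613541647882911695055420999508877265677720139765687756306814356459952590553855563147680620680794903066,
    17437820806698072214658930580986571824279015371979402983747727261386742642378219283395956681521139088027267963193192650102339291997788024166162923911216106910230864]⟩

noncomputable def certBase13 : Cert := ⟨[4, 133, 161, 6, 199, 226, 8, 265, 291, 42, 331, 354, 44, 397, 419, 78, 463, 483, 529], 8,
   [984990919832600057869712063932754438177495735286273596470850094226446512078187465606297764997217468360387161873132413666457847901715540502985294879105329782967780620777712029754,
    3040845163835885063331914543971012732212904974434246551652170270590181217457953552014823334147780601108244011379034609075648205143750580554318625493747170586680]⟩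

noncomputable def certBase14 : Cert := ⟨[1, 2, 4, 133, 163, 38, 199, 232, 265, 290, 35, 74, 331, 364, 397, 430, 463, 483, 529], 8,
   [548505813725084779513791585815902301304767666486573020006155766949290234136945609628671652239865834836743087664036294099836530162700129942337252211901244800996687033287725322426,
    62682800534188865168381502958117247479908648396595223324029488241806669308183964885228608414701946676026411375109461186661968199828466019811359074309189691538806204361818074335972,
    1118202521376624112639788602040149644623418650347576578967277302574747683027104364352335962676195184248377969404887085608268970409997855843119827817222660466255464754880170611016,
    97930754683447903390603538409378179277233241735046719385340403014478091597273072561657022962511591474739968440259019091821787206620175272807091472925544697619809152742861356925016,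
    996906742512650232282438582837399153446829961207365358892731212239991342637377573397887757183692372833609888985208338639650541791960419710504555059015462104464302345890808409254,
    2700727041176840273102976417918657099629889309516049598479751670579414569992078155815368755757348142589510094658448455323815160832567712918941511974696951369244658819563901272,
    41327621126766055895513238590385283436591475621156644206728595490323897534438668731764598125274379226087960448702158922949505013001248940388609443480814397423373239655156855564,
    74178139810045367462959567322659991319333057734562607618861746193896325075525419176227429587818792005999340652025106203846303739542933350772219826503484132540770217641384033825548,
    170702656331736424359201991364677674027227620470978642190692854626619516629164825955655484897598317032257836824642122482630898721552312237492469234988933921499973792532571217923254,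
    3913663506955586370305433932195317868049228973881242807335137504813459018987499545963161097077276119446652741677854548210652105678611085058159274826275607881062583036399672]⟩

noncomputable def certBase15 : Cert := ⟨[1, 2, 4, 133, 163, 38, 199, 232, 265, 298, 331, 354, 35, 76, 397, 430, 463, 483, 529], 8,
   [944816074569270298981224190397288127757763965625970266881314669714206137107862290992391716075610353326114851242545609376285258688879860651539766919104677651820692973219586589364410,
    1693805621672819525550358280350665693148009814775757062850042046900532294611073308459373551436968677929808051977051861381299686517096780157233892120081491722309177866606504127204,
    16710741520212381147989577614673482220300019445111882875531149617011370592038657898214212137249570453618676991634403485635019074600586211512376520949827141694080283737792781142724,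
    154664366258693385383843520247325126857180767213106271519108996146793796841930188891091572255151300288384972769364331778675599170990400260075937927431357841442655780155038742268492,
    638466930627282206851688605856175096345558422125787051232470790172282514638434583225027640212281680872942118854678897592490377422822871733276598050280051932871055107570845954024582,
    4216631224799279976902050754112265896630731193737925481497876585142439773241995778555190588470075958893340327529979604056107148663070599669611314059826484428720228205067823163510,
    32638167026846330823528088593591881936397805436536218391782893567190680461509073749466963457456883651365941329592350456253049805010660676330816786846274474104405442540598206062,
    543070981044311019451650768343602447692407961665112757534425389710071611356541740652740460735136570974019239514087908151734462265450196485998619998000688932882574107972557525772,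
    19805498306730162497314484204352523888938775311675998049412857050307130667827400980753016800522057633128099624230147636955597734417352384676191268898816692561654310136361446986508,
    2677837237393037411368741225789062282591065796838757578141897900025819596878975897685161721689713880868631807877180637910196]⟩

noncomputable def certBase16 : Cert := ⟨[1, 2, 4, 133, 163, 38, 199, 232, 265, 298, 331, 364, 397, 418, 35, 78, 463, 483, 529], 8,
   [177126682727906677597967725566842956042433465969380785061985862345846251128230883067700510228652280489582348848913397138217240501521029599291327628363227832589362959393493685670298,
    578218482316348787362479264394128548736145230620578025448046363591117231191510254081745413563828797502270961571846771275328777297326182783074029607341013759214326714102752234116166,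
    1281910445319077823995730960216389481896874747108496201197901331426917533009297911721647577919279025886834775965544337875900327682089051358381785273202224123482664185899932283250326,
    5363133212857473908071399590982549525607944699712820307326842765717080446243484300008763694591887959882850275226928541789762024373605027155176190382863600896187103586122784551774388,
    218679336854434961219492640327149344843099620621177009734105305530047688556239683211090031609670156037901030761366667357093535823463049260942147496064884436088294248828429748187160,
    596401904783055997630032230530404000156017801215755716976393545455125152105978693546741747584351258982745471704175589696596401995814850488054847537993250126349996014159850842790,
    32826425675701459162044881317467682802919168368535942851726371457345180625191817296]⟩

noncomputable def certBase17 : Cert := ⟨[1, 2, 4, 133, 163, 38, 199, 232, 265, 298, 331, 364, 397, 430, 463, 482, 35, 67, 529], 8,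
   [522934698603971237974162542487238232526787245796021210739986302605151013228208806356147226319336213794944251396216604759884769528767939075666646050981230619211371446939090973135258,
    95148547427755158431060084588829020810257692228017292867826866671741023560420237203049795315625151758010920618378350921334373339805234624400493440794048438805497481421029559542584,
    4167776317590249804752636766148895351561183893277586167127674502192572227680611774260569216246342700573407114540738649819370793548914766311608711196953621190096064568415822521688,
    1477474316939398172034162139423930499384793648217755053599005997312835961030582048471742252471454831323303459944515607207913368522316068864652356576634482608251013114532097281803568,
    192660099812746681340802980530391992612839851986400890241006908615977895211834041130044508391921111778076975820905511580810568784875679077194140081375517825320894293415178302144603,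
    63844376627296549715639730806782563351536215399275734561261281388635875848439668408131430113889886149726458930761770755404489252365318199818274442584376727670692356637974778093166,
    38736807410721709383125265118663125031500394301316834483692756857372800686621312899815954202681696548913359295543511003329794834665052194682340778017069487803572527460918063434365,
    15272350901359572276921019845226281364831829]⟩

noncomputable def certBase18 : Cert := ⟨[1, 2, 4, 133, 166, 199, 227, 40, 265, 298, 331, 354, 35, 76, 397, 430, 463, 483, 529], 8,
   [354293288049085659528128963441685804648372550943417631316158852504802175574226870133712864697081894099706012892780992507019724938412043306838761235257829256393516454048624923152474,
    169430153737444981378511625775135370862631956947709641222568119153652529572616787042577150041157693426532504287672299019755508729998027713910633260272500649250768276709004879275590,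
    267748622727513830429727695316036886257209616669527323866502574587953581856545573172050519009281422455323299976313206735497463888909112005111908284713918159603483181859898827917644,
    61624277357130362646314968879592329005900096896257353050238112014988555762905798493368952756045102577734195296127633252694623283372606180890159569205166409552828606455184848638320,
    1192641073386915707002809565035894785931537141290496842061283976531196100087387384542529199378639650379411805501032647774611088932903611448010500305114016449177370378728320166,
    2974984531102894199237294689648889337459384317355908194926381227998550361437154060931479694935019288541357051848451075914147127613468526109038194613102547056177742998812326286926516,
    37668720078492493754158039403305036619756756199780235044662101650209335013687739109778186202786255602947496566660024442282532330254492940894900774262193404370357736932761391472,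
    7711783005394071082321193940843970546715855466567232721136614043770064773666569987304554791964835776024146636573888684558072614354452985515875357880882461840696456620419490635381,
    5516921516720730859475481950292561757147311046356620570723853344347289812878136199126391403807068739299592923147726257832262986605964533695851593804359492734424743585817655431011950,
    6236589023916742755349842933269421236661546238903790635476614921840335636460105938579183961612478369309562857598555948921676562344426577969244880094817924725928118641063585886448198,
    115721196067888338947665786055553573474221424809429464371759140314902810662607675282129556774115124657893938225377526898163038164994204480546389434666246978766872154975135011500058,
    87464558732410708431898741073888173379450865975007291009903472013474655616770901614]⟩

noncomputable def certBase19 : Cert := ⟨[1, 4, 133, 162, 6, 199, 227, 40, 265, 290, 42, 331, 364, 397, 430, 463, 483, 67, 529], 8,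
   [4846858543418780738462502063089853565971520903504727871712034631989752936700745056497211588694131627413874313031062106845972747215170734527166909318163366738998909255891810029850,
    13727422625986658320404189741016674128659495025445947454667847898462200742714072873695692107739442063170710758101050982170127174012987218660598754193391045966612422282999732807512,
    9728332797774478528731689232284265504725148531361310525752231652918248751108163484989844198672737420092730401751389155338103560377746738678103429906297487592579743984853077664838,
    352266257363118338802515048475166815576477682616797440123741629847345018666566464475806167952092845142938655120398382121897298154118358838069319438096243146318503879887284983671870,
    788594936454911228591840643515845639022773700928806054257970279845851599534889358957505067590658267659389411652160526824013325242671481594197439361975894387211659801223161128014,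
    278991874475366583862182841945776424530237477606309804153004667500029967892216773278931953079243968545371202369480369187268357095569365139260130069780089635020893499487162674782,
    5840333305218125854152902793800173698851105213634100252299684615511632396653043077082755558948762479004670964976763670298138113410150951225713545364363875869600991019434830485,
    4798278306376174220815167941551728196130244815274228176941491287563572829609815565206744382632295073168666677682667245693775354231300498197068784861345274964879938647774000730423988,
    23805673189183129989686543612964648797055049562004412027308046712590163519586300223792160576105304524017720204831038493941715076437640974413396738142307870661060431233603540006,
    6272999427419015855798697476304458198134031115535912557124293837264893373229620740428949118308405358741243127551029623528237319362019461519500016993579984378266499773872615896273620,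
    35799324980075379006258950031217171225699701796465765782921741750134398802129597000773696123166713632125855848072807916620551354003176512464141768621249460506261481868368742195286,
    759284983720708184072960295353513765306572059017484966458902587181414618403255761814124213012273483660878751872881161579487279891190460480154645148200484395058130846343072591534,
    1873605533348427082030985719602802244404805528374252487146338974336759821487937949105021390013964048127388581673191268608270770745257606927923270111584]⟩

noncomputable def certBase20 : Cert := ⟨[1, 2, 4, 133, 166, 199, 227, 40, 265, 298, 331, 364, 397, 418, 35, 78, 463, 483, 529], 8,
   [15006855517412496372694768189796584801135054725867437544085294150070640318527466786068308617712385957782747373586407622593376399157517561246579500667017584762064173355000473096282,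
    892106969101450663320683569942878602096113284575343971082338448342282073008162833772663230224453281560131798625189194667842197199831782151479424585100883487426585711941198934648462,
    1985932948573770842652391438723378327187108973217626235097492289251684442894773640277965489078907885581614309684756476715556878107265131839679983503505250906891724376971158654,
    90499500304928566996968273382038344327361717122952345416004745284264582139722960848687231735314301781623022400417161715964262850014580629555279102035745387925608289167924046564,
    111642910735890118512718977580933607473004598758727370142617447516059825222267494370899274528372169933392085830430731690180997730168877278744275566413981595557215130393148985002810,
    119401895132407427164398050262902470814157062210597328476366382434542645303528801546340260893179466618502140993670657305813223506333798779393548038923986897859554790726916423091800,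
    104533675121182662262013020855237113996056998642622416786366914664401630892073659294076587450179501520001501304041831268999891629427031049268707539896294912747696892231863476015128,
    36451592288306511559635181968937225603804180823614011549468149990292386109188921423578890873348897035177292719770171858567164929611914750602068792988795670157531705791552169046,
    69902125727093790618550221667893029202771242335339388754951710247202716094181226897148433266262011146302088072672036730327065332029711757656287404544719942535727791117560961606324,
    22325780351794515253546440094513237339316781093689194683672479996495027181468560678736214965296880092721230337558417666190122514143376683596008480214373690914218580043490233503848,
    2990177572553548467816221262851708737120620368770620722416892574408366320961034839324830090627708949251869544370207139974003574432811229707409301890402420701599785767666126817068632,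
    20516734237808538109325658401237896312653649584967212136895171211669020587403188478191542616760429244746872574405453620066109852714151160610886173978897949700204322325619658848,
    465738200351920480208866217011670534439519097036186567931391968453506564826927056156245888453052585443881677407358608180345922307473378684669612808032514350437984221589191914597,
    4018052767986341334387126942428624121987233637735085582668]⟩

noncomputable def certBase21 : Cert := ⟨[1, 4, 133, 162, 6, 199, 227, 40, 265, 298, 331, 354, 44, 397, 430, 463, 483, 67, 529], 8,
   [254550362830680364064419644978410530717439531679545230356563979659266911693851250769651643274121532037879525560194473443414409637265172794221496518205894791542694300363821498]⟩

noncomputable def certBase22 : Cert := ⟨[1, 4, 133, 162, 6, 199, 232, 265, 291, 42, 331, 364, 397, 418, 46, 463, 483, 67, 529], 8,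
   [47882862825592523373715785283670413556436041431374775120311308923253932823015148918772857447417694849435904722024224495825537917640149725605006608064350651846339309622762704986,
    3563868165110485775005356459005268892463799537139274686079960218810882884692278524909811235421007916226598945042652035813940531220570363301475990766363536168551880278214567456388117,
    17232739993535847709082237993196694086632857356584841035086560563727289181339817758859509453613921168888977725476646978623294229494984103201139716801532043214335231364820747429,
    1228423711022670992893029529853684700415153398146834805934247209999708095681419278057529824186440289569805187301856626783349492354189056709704768618048963065198637377028711677613,
    43949789544232170170643955861007200222491498141657067458700983789074511443755072889357228517359792856459725925845859204718432144337662977710853711830488381570570630469419517815390,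
    83698399406285749277550355747193741787420144737343341614343071388432494702657740812103784374801039483763934896101030058638054424126700509596302324464449346741618885941906633175152,
    4823350901245438992427120093848172494237747067103761585444147845784432111852014420205462668862988425086026508536086059652950391136404390292854868320750960339677810766942843903022,
    2855272364926832089929148733684581190091813350161052403199404890656535016110359940437121534727311968959048333406668294667823223694902758826942507909709069893551790335648771353182,
    1298296460458668704834594269212059786079092711441186384634496821881874036391733060028749563603184881621138089489324549618001936383996956410397232277826911602699882749706289253819478,
    5182341583160342261273319124944328607653226653868964504729124234157158277401204881637013120846044217264356888761562345978874500620785966847648231495679497395516975615418961700172,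
    5227378866097764910996291573355190578311059417029558815294994977882008741592318588228294437042101743147827473498451026725716]⟩

noncomputable def certBase23 : Cert := ⟨[1, 2, 4, 133, 166, 199, 232, 265, 291, 42, 331, 364, 397, 430, 463, 482, 35, 67, 529], 8,
   [306113759664604441888670518222549169458379552053904554216091259591718397012533612013064905621600307601647530364764078979034092694332694131396938631721842632076653827625876086100058,
    352254445785002054156445800626913214673552407269809229180397350399099663709528434623701567405754472686468649279633787014950244954357022048599788516101207398252234537025622289480,
    106124145886813564723981307518282220576904524030656340564032310507287667840145647963534306144059609774587887283616986246535851069514169377864969972333082895778252700041260818557,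
    146232917225006742539792447412616962904849385008183216065435701963827072648488570266385355123252771806551409508082104766487024968865324812277099334810212708919428167840164385453,
    622086588345962796353842803706393900570950437731925664592286094847952459306268697399288432292879946341415238016495744795309450328673711399929067690008247729651593013797546239535277,
    1451404774614685649938921807984365700176891254412729196187715852632843938405838827070210426174922258167777907149037351578911785920988338863969485572817086777444504845353192920128174,
    5227024835965302025945101267002242383008355866653745054893808227635934554250497039109903487095978054870538578198591455348583557738101722363243478850126212260417612521839253658184512,
    54977135137535546892321335798896595710035832250799152407766755131912315107508449155387028604215916502219756781671781146799990795372752513577367220353150096942650408184117115974317,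
    118714948086825066808936873995182264653078944938027431328172648302146246103514595053431097211033711621124093208907976858942703081922263670348258407289013223726443889306400328048253,
    394508512476212967288396821688230879820564257175457739718508902635806218243700878983892536923013180184899349655977676615670006662321803824213609066237014052595894251572603083073360,
    1302584560145528328131841841248907799888297357654474185518406564406393423500508461480580083529757522287980302309122098522463304817705956734234171689162769431946400486689799677542,
    8547977037363514861556857053579969981052302463502077470245218291882500817077078486231651788121493390310114855264995235659452171651543962994811441647766399094789915669356386342068,
    14943383701481378685156198357389452265134497869640157299979832852466720480897144528097850982061703222798764966948433625731502501714817158412192403934787694215641190783391729362800,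
    3481531372733124474440640337588211782820384840659005368317121495976108686393830118277931647425195350033264555142103533007717176293150765378545844769327612390990510147707594513623400,
    1377285722209568301897716451040335253542472648903083914305765520971459780350351338823184337794954932251303713566502613224021924182278098841304539594386444334932429625473115789394566,
    40376948708892386702664462832784799179399685301225410208432358244868080244674992946722825819991426458961831402930164399624048001083059242382242801711837598268325973592116176036454,
    1248756414214650249763764976307775868065667661520722361201670107765386118032379297402138959838746856615354643122157812415570764584602353384903521973871693187294868491777482430772349,
    92750938158518569256355838144283361448598101458021000480240042335818983033568154042464816691109387132561684252857198996156118664261250219730160152866481475507458547766731390]⟩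

noncomputable def certBase24 : Cert := ⟨[1, 2, 4, 133, 166, 199, 227, 40, 265, 298, 331, 364, 397, 430, 463, 482, 35, 67, 529], 8,
   [7617478105131542072340076106786322314498770743654148147359650114905098483631031432745082882826816547557405162923477822887206161481875752051554744452686178952966541178902183448666,
    35449555321971285377912057666185347933124012195707791862793361730470081812882736019580319980229624718523674537999066149476543472114339607122475634218572574123789072365121728324704,
    1035576598572698938491244495369063817996153277215040279030724003564485775811573544047663553583770964418981022660455536447300157089764691976885782353245616120299976609769025758661749,
    1246766581139286250949776065878977576826200359939358048256262384988581682647236843493125602339466609936958910719632563823234243803708550482362046038230580410125990768506811882302581,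
    29576116704973979377037117592925297948749734117943719600593273020189426163543245907681824473379583630579636622894905121204751497920201476832068354899388952870669313480030953220781,
    91742381241231409783905007955080437133941044190273918716590541842794156075962981641950926326141172990425177406539961675469925411923287005832923203264159360652337166066869144111253,
    219851286253670444750137546627729601771081352000488284102847752755571949176679575821665187335457341674290220319695877304772508821232046074980476649861439831958824557461538060257379,
    2891809916611248333472428213284716251544779922363593653174709826331710657904218213003131604995994663643557119989291307351742768418964327592382383042704304344268699711556079773,
    157847955820747589393710226985203201776747348529831185372609544623392815899884943752681805883064274819616526019351638839878935647588633924439618411745618704079921413507118852987053,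
    134650699587266803034252142001533638871155053459816126916622148377203028170321028812586432953499826851804504605761251860362851148027597336538843315963991247236903476191091584050512,
    302295160920230757895748312296888167321625563792365202711989470624563208344665147298309198141758326132594917970094914665756986781301293112421496615352308571771549135329665559830133,
    853535325114262690602508937568549740383682106418729291604126034465323886970072218755618481773890655973645938259490407139796091085431817218752279253439213478471624951569093376266576,
    884810751733833864049686052219903598799335393889672382356304334041532560757500548831921519184375554197257415791740439214535421167509264371882660128388421503963588940076896761189021,
    26712192786378343500916701968148537023832892963379969381840112933165459879047211584591021947396192717643171339640179288354099397269768885407895642719871638818172198226564772747941,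
    13839246861016005990838368184078033886947197816953025338423218815493021310340306945]⟩

noncomputable def certBase25 : Cert := ⟨[1, 34, 67, 100, 128, 166, 199, 232, 265, 298, 331, 364, 397, 430, 463, 485, 529, 5], 8,
   [2098738679088554859274809394675297270112988032987197530063438347558451406332481169189082652667449049569943351030642759476330171815590862479486872569238853380903760963901370171418,
    180183418824990688442721888745940077723069283072385558364487979986373677201806377831356618586106147079678196297016080111496531314730083673605785305173697401773567540571117888995422,
    480220882831799022048576875542256840585864896035891443640788493103438646786331023610082167478572575004461446450577421997431443905457143878118223226637740476768521418733942274467390,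
    2071911638579967123291733254884093392152098759476385408508685352580930526765660891783488792365670940159561141298129924552028775540721862896515807177865017403471965102145947060224,
    86756996714380226648472548207731463460146878508768905344747523011336361105557475907711601899515847178154782751168724574910349647378582894252777382608638749635526400101050937465989,
    1009477211134485916084344953766561462495482278044577130683352516578717832898640755788226502842192842776060791532953296890508436594124230519066478257169825308242024903375963861272,
    326052734457841003124586029620957525049897352756223400773551410252924265853271089741115151506608002352603531254930212467099769638563421356452948368317207008487761657784696812642416,
    434150454779388823989011728898342872834422570153706874119609498869043725718968566368957453891252359943197174611030555415167390380892662393055727871246822304307044037996494999691,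
    42807027600346806695111271775313695156020916301246230701326737381978749724657046975627025962683552951602354746475486844875160149671785972979110833190759511405262262218066277442118,
    41561059958413680439324348307406425215264255004948893246399798939285916229668292618387690954113420224123939107990221836006086604744187546051489096160042334323118228956383423563,
    2449191198905128923918973821154224250924650358347601362755116639698677603766736397801303199302210892712013554115899873102416161738074922165561115130983762122466246692902993314437,
    1578358945220211564110860947672875223143552915322546958543666056755199706591021245755672323852340327007264600852783586554274228425670175670127804897779887366006350057121593896217678,
    655694381817417201252596803976313458154564303663546923832581577767286161080424659881922885465554980050544232105123489550774925251593373667920520892145587004196181125661086120942694,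
    56843975211913020349477874000226059253557789509713543921519667644726371413406143845592212534186534691106731094949253595897574049647130408891676758269153449157878924203085090465942,
    1537292004981345259492791539320042765756973298890548928267716118336121014602334575048899545588708069370115121372863181519745509339030506839530588354251087095400411474480844446902358,
    9249617028793619717839543221308968441324357890880853478083030757962283381015081064600762304989188847890659687022413319825999564572637969405796170855722378252349898063970847174952,
    52521187997699386176012244421789264210664043622215790085844807701273033267392105426420459287964428677072669500131302677680400827038288381593791081342711942295986788477468568058501,
    566392982477280065116048538510249626409665003639065659838552415677126914776578162404867721262954530705099278428437330560334559553246140261029945781166872852113310508169379394481674,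
    76896023736008890090341812396430389290796729435238074834997019494706122342484526499067040185839475661216686203073713191796323611878481362327334378236652716946012666830447617080,
    36463348799599414735319869598802794989661423821836988117662430718656365322859519797806066248580122734000888336085639960905122168005874315581163935392011990864842676213246277551765,
    74275092406570835774196656930854908072883753965178341404920281123437590765306544309447199513862678341354334699248660575913544520332695361849747232572122766302344142484377033974398,
    365399520515594167762027700028649508567608199605223637587081512306345716855558201065786191674498946665338955249811495500649700255609447696327600763496457276908298627561958869766149,
    81282476576408773560824267016464195736280275244865333287173029639375306453155518007599738892530267941994326890598477729987142674911441335215498700746957502122700194613928837968,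
    759238260341478447460077391375579652180969699606291179075126931954788172347716940640425113030691378077179183470172904443801471569391895350537057509832539751133259359885965656709,
    2596408933035562500598279841776730269163231770800951615421055708305140707866124447174388495638805654576223013596695425926371674558642008379760011003950919957447541634842535697568120,
    777980690952357816659180797730722573135820508607599305369443362656603547505479300774835817458949358558265442757854629252841973598528886097179382183192774740315865636069642562387,
    481040696940215194827875191290399623115383997268633595297144021933477067888691035383706684762249046815253176707654992676414743225431677045739692529542995507375062997606883873397,
    685455493559763967964507176972024414370570747710728527180093982647720281421079467270321179351190578392473844508901334221086848293946836030991331881866575804790008252131722810708,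
    1335722330600245120600383144820746666923265166284656967149592717681800762639868339330542814042693589994869699961225016872226057149036311163615483792043944849210338368636945402439774,
    85197147688502584432996804245419693823263303050772249382414134368634096728746664264701313235722505518258055612069809866207508382360393058324162083502434001522354976189715139569696,
    2015564837930735035700384004937023594119899287596722668988672481561614082888316483556165151068441000748271099153247355369436178221384207042598762423622426869669811284542655832963,
    1025845202477722840366454327708643871942113101346533945867897050235453803319870671800952046094859837831554640501068686922516894403198285820243416010413431055336258751540220163113792,
    441535641685941349813603920416858549016934207729847934891421193219524862470607229903420275011086302963882242423783401822715219203719538086391011324451034497542381293307414775860099,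
    805548070766513210751018551222610653117721600802452798379228627982577596417667424818063161013713943970819592062281633178337215604635848305022149957295291986391410280475958330896,
    4413557250745212603624897755124318563245704806141521450308532441857115110784247680482537128557501105553891645302540549621898785337546494429784705706286761691056695222985614533,
    222499918976310661787409228935374800782501658446691061904251593590801991512247103318591692125172330083544521186569805323722793709190158803247349066183488790976916928263580968760469,
    482064179278554120398742151652562290746168485049382244989059190234955118085207625232283224444842536992362084887122631255652175284573044081753565102565046865626757281524933837432,
    119099983224323118013115010685180094663233757969235352711877498357457250184167534896392710661957329078858316577633803070213705217618657409081020600834155902393670478315651453559309,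
    3280753682026259026039157377805908308531405184370234854775849482095998364448428799598711081642411318000993143956141965840784756630526591018466487754037352656065081740636708660061318,
    1836620324344050295807024654039749316192296041698022811910761915357270225831281491057083381155283028997251119587364086865676591032006957813828607158851043705962828182189321692710,
    1039429401088729281533608831410408212352725396484146514195780886548314966441539940021200310559748008977106650205272830247699718718657080585813797476329938607196213784169843429481085,
    867924301909381244530869296836245702211438181933060146294735337332855705111884784627796184988192679185494691298564922629590766085069111421935054367094682190659758727919221982032,
    4614851521719458003676677154630429916257545481195146454611830851972888148082458505042377511899845143475811916176575310314255426352807647115958671001934955921745825618439608685829222,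
    3218771152342608971569581305253656261951556348044810407414171640868040770102094788767564576966802997336401154742944388242760083260007789541644115106518979631422278892839965794376,
    1802528214905319176995618302592482903346247067142784380631458619450708411533498388014783853182735232445646771345464695295786523070478776274833026712211937276641611771338199148126,
    867098985564016671314528234199228877999572734066084966372334468135829890475738374365575451890544706362434296429412099568046347529510008510402210232767921085600733835240938325235028,
    280861015130450054482577516572365919094005455714873187460504074613878847768207447536204548521432350240348803151881952325994732614948505334303181240279228613610763646353663006681644,
    17430144988479128430561701403610646708467482060371873877118135084307248113505331367205944789696781475056799429058235259371616888714753632896221479009705254943897086698354385625638,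
    18891173559036350294440021237549922626696914877824181250239321650859426538756942729860960372586051359617092704570422674512468445724284197277919661858535763094074410257928457289782,
    30146099480179474162944447358328776633341222516775531374033986946885303248227226049062324364367277948185354330623796910930445207182192031337757817458462327548262070457043927048709,
    919623170627604697529075666727664601025682248098128396250178038925875232541453695313294081877314266601811911515633893252123425164729999986759068463276435857787485729405331934290454,
    28099907195376806855210040833359772135008522366652039231570079249156607544440415132464058010318745264038788139157656722650475990850512726490177660257562662810784264457477217790046,
    2677612924250788950628198879224251630137888107843700051821801750839472712110833251383236066073454008451382181018994034881127543158645421383040983649173006661070820860012259258284043,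
    38483454535670770295298951185577617536572486050156930714701606235012485941459456671811108896770167711356681763821916931651347332236524736758825588383211358361662721479573496509,
    3337498784644659926811138434030622011737524876677600894115727560986938582494293935552012329327045079381968324329266068316855692519176929799804973370271716763647355738459391272157789,
    6407765433885958963421761913390289291283121420207828548455002227286225472305907309785240274981001287744686393339717152437236336314597957747859855066242396046401516178278510871416,
    42774823545493650678916047916672514130481966050015683689368410172481566315924798882091212808159995821247282594915427590662919965880683240515991796249825950062190407904946750760550,
    6182906902566634373535865570795040901071416325152972354403315139131241253729911678045349593026568769614934684211453689308990529057278321076837269859003339258745271164726686602660,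
    168003159502090055842805156285446511128559202771948708233276560649899969936215237584206847913911523637028297102586214906970512186201292558621526280119353140738194918445645977151514,
    2280072880388789728829076365040398908246905332463346702020127590895463505404861308349749332982356007156456495097711258702178664990863381802394111035038991801300792908776179486816,
    14966038819403794065974081768293315683165950204781429022214174701680302590503781223930447455900738387124856274463050534838544322029344068687106685435766265665366929077595188570668,
    921735647811814586911072834702145324017994410969812929764105265191422419909412996935751219200467935803152996766718148474674543781415050755077510375284826326953339141317249316592693,
    25407091407951766158580033514494431411639913929243102164291359045248010904643862465421506070881152308882382848842213785683355214990212732910809309702207293624364842845823395310214,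
    1588783419253399463748584355981569279034725734338001754377171946368251981303140417971247259923857802841036613609110488429666429825493687499580534870180642705834586628763494695272,
    54220775051222266936689592333330685743408945606363681762320154029823216377562084640147077071627107285737503976547279109236366]⟩

noncomputable def certBase26 : Cert := ⟨[1, 34, 67, 100, 133, 166, 192, 232, 265, 298, 331, 364, 397, 430, 463, 487, 529, 7], 8,
   [2098738709283939768027629999084532311546080524776732287343397482183604638228696665613114257456617757162054065991257019088737029281701222299698028371300904424507190342427285946394,
    4018324094249869106362491486112435433187964971352520711898733970869655619879740910439060308291848069403316965925239075564269924060562940120232726232180817396882640621484376174,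
    76994128806181177054264577238154022469521128855808976192177572363085781486238929392593463635734785026141827024583953869604060471483318321077412156214518032950245489928078149457492,
    3336736635505663837549526205127747680340631902436916853917098620718379668550438072566689502699770255192027779310480857589551563945890907088269418180925572489404943234834253890135630,
    45089334891129405471912136763481160154441932443816432521861383529786039151419343738461434814616966106727935964347087345210253253057563787373479881713536798313232554127565138582,
    1222641838089760572625674987052866252523712102860187990555921531570077817981247278020929879245409805546113329794207197020822473382734455603668636598385284399215160534059239211346220,
    40127386141020885391547284094939438370403625532651681145768588380810978517428924536036832714285107205820791121776321608449429941576007864906629089710808857727216927589077000784,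
    10310159311661607795102862684557159834013330936000357916606503824750122269650269013422886055147618904623902908114016096805337551704055488542297310369100569454082298882467797164069,
    1054262539337825108846522621158337073924452407718233599430398001234466521295410852649295748612298969196898840498683703063226238192897652797842272708738358001882474908316928845958,
    50885282427516030566337014280285258666489290993839027606546242930561327398959608848203541562330471709445539606631327760345542168248020705675021174049664427600038346020502314918728,
    9500590201891484331787846700644132706815974165820846386507274823620570504098135865516866215602285787062121678163484336813726709967943134717802815366687234080781960113694298208,
    2462549564292998425221853953960447476837170152792948962101373057170405417242180232361726167117508605520041469518387518061785787280575264212353360003150399153026643117712348588204,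
    172033129396613554177014253105606402627140253339912797231753919475993178155418340300915357519082385240002805479186418307151203046137101882472419283840976439840544086269166034022,
    26285948816627845295885473350090245847567907932011368552316597438003481901459879562740741298559543749665930189634226183486804635052223724796485705065395270186729825322331883692,
    938458280057508558672512981716814342550838113767005877543847711505015142280045136096683182358596111736632006526673660606846823349518991819203398112715119438047322959638741461292,
    1933924793923456860653906350740203547940651043570569910157580400841734006608954865305003470076024930400563903253525915577876718097320493085262988871948437922035787625984053683046672,
    1416596181615224561016266669480532101832371534119061445531163042238650876595153963896657827950759536391899205604290364611825653593068157643718069753592899198546177081579170873928,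
    24661653071733010003746431320298175932737107447359290528726568626460083928597674126103223416235189988595800433687550194516175547617811379068420430455092153096525530028473127152806,
    29350276031223104636351404051044269566441973271423945607303952726762876843835779179798783740264101892736002968120605772192424905536086650174080198786898378986916093808292375761990,
    380390633707723483523177491330705701010353244122593991320913817617483599368933438555083797184957078808286551917122835576155034834214993048406433339061326757271916264274073930504,
    276446488623124689940102342638677723017415350735121609162823869900242583974834260946344352995267104710691351023306443960915901511956241959283166193707358383755133646124659976790,
    84090493437109542517365650232345607208899662759884381984095577208836486952941820501580815046235815682777842244756248170318999175449330078099935145574972196452255912414282308855854,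
    16724177445350517598060869394549886091114391846572318091570722243209883523282178473409753134540349850039488586056646887478147871323307381184927707572406945326559906140105723076101,
    7135684333840867439247957537078088708787510471755315882057554880839503507891241681997361060860181517094846866656053022920547178001142146227124753891827245405788960516094835877,
    3566389441942839190514938542935579722288028903130720528821786909025409517050421556804986843921890123356986354193079574020962606586794980129210808703508643405475774440821136075084,
    201806260619905902331562350472197325158263815203252288633958103742075619537108661124238936317597175604102233992062746306974396741362467553183131304810609911041575010089461619814,
    740372533018367340766795439138964266137499717322048059489143381378118655923840915561133212671181594116726755668295179552245719198134770086602857561436423006151568463426141563045,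
    12388083932312595282259367789915028130910471905278376433918423116692380081703856658851391465697639403056732789140311230069620937022667999233401212105794490324800090899235042142540,
    1893629367205521272736080055607486919183840438323544776545303622049974306358478087042205325710599686146947477579320381694640214497383874909558550717464663368121266071610459768,
    1876751353791011882219803383972718597419268707610433578246885916454854584254785299348671509059605740462132653101090769729154964768485502807407405982211594925902489266768806576741,
    1109319288012510145247521148085585345725022419333091330511034390127045829235385882556826722472666167681088873364976799829878936623778563149891724431761753296856720498310072553824,
    47275981771949482382890495139196488746988432823942573471937312928800501140317369011641080983952882874848425525880203145230812298422378756201858710811059441681891499240997100130358,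
    233486515218662527513762327618870590663102299556357185561627573851625448270098879194345522206720718224930296211206286676414847759524328779984743492449789816949536144276167427182932,
    13439468609730588470242319375862601202377184238351471455294018350609162513493925056367290561870690779180553811529996320758805343367129170768472190026287961444666355850671962237100,
    526845419929429205882580531658433589289847809930641735356987439523764499513894645460276814567879702615002276252713691393726603323868724843189163970625594046162068650811772241792,
    437471857938600158540792149630161501940448882309127150325349717388941685554850675772646994439677081839501867070458829089070574805216533071253801401505223400613448482480696655816302,
    4482347602150062521414757961201237626608725040055282217320957707178227672672665571551162305047634940338175195739616746977428141821803200716409145442116676343862171171012923257004931,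
    496452914876203500324680156127239364912674026612112283687585596844090931737851416733080414118748174354187131795647222971883258771674350047132938290842416276323376487060042513827456,
    1309189199435704379250127967012389793345795393281119162866588145233838021059906618551252702315052897507142063933932870215699268497783587478761204286281371811219091525571956563167784,
    2074340252875054185744875414958604543808937888544082734312534161887017444168437923281504860403367631524547460969834055161353170888858911666155695572751260035828669157010887606342,
    298600574414568441952481917591619031058518839485160509615192360834852584278758946163672428906007864040910821649976391331130035291617645130002290496277871508081352250327439180390,
    4311894934115753328013551505065368246938643321041114528567362887961937192890855329708654770455233950830092282390441936683959223107869209985046340955805431194893410335052722669922604,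
    7077806616665226617606259831661304238659776970173388443236425095456371931223584309434610821673206023888635003012262277830436899740878570150796837921889894802843232477717452867144,
    1106484393294140169633404046268168061548499550425972838663096093932411502438093780814563969997013861890308274249021884716512031334227722427705541011787797765634597450345867164296808,
    925844276036466432971537997835076996424596303740915763330304749124791454898316662592143405963378214527254443596506436991650676857010855672296999876717728741116792266518389820953670,
    30146077465371964406503341639342306868926516570457321709353352395338347730273637987625868825069591223122421055142877578685499239437547484645181869833724538415553014339743044085366,
    3005323237350180561860687618924325610930081060557517546980274029243424838105686653305199533177871439025045737403507791368237027684712476830018189598271690847376596123242131136872,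
    1545890463564668297481071071849003330348558609487061044772727234137733478396255551818170989170723577538209888405543613642235107736147079942672694193637181789844755170073186340398,
    467035724865372119782521508951422936504390746022225511393515299489016700745262455597110208040713892851638983142612062069480933033129172280241015196091909980661450100917393670776,
    2254425730729017834115645861972396627737249217853900738411865956354204894713470458119950513009758426543005324738252640099199744160684952079283069117522018313239036906071719185941,
    5730107697322771288979495126756769626630140862052109609844270244536057319539833355277498655490631634832310946526163700567424057325709604742308135523687516694085010583111542390,
    4758132090440151327599485884719352654438295708682134294727642518935371836529442371880588426838385863068221171265653632478286261019626250122026870000603287419832902145852957349,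
    437641613045530299064764819888584108699751449439325043328330528056012900905059215068627789404889602073249454700782375509717601395224650793141512852852015065779550256064726211056980,
    114068288603546379153028606221174270745618276905399542951161345351093936298927091046905432089741637219305547428885858376779299545555758652412025667611800021221468684091977771142,
    120162940340104037287541696556019899914056699713332328610666968545406259157113120103367681441817803581831970928468523685203987639182019565362503088610827350705090358000466911010445,
    3782850495935840220248742964216998587990970944561807671230858664760057370946196807183382233839112977363263886376137139574687589739596386025560967819560326021888122880415398904995958,
    91568154145031346892620616349539660663893005526979270667682845377948074906261948807354121428925968175674901016183832939291600362043044166691239093708340962938027238627489655202168,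
    982691723857343813584969493235986919212107571408937207023602696956743143644600646031625556848950401163905505101807273578493899035743679816918414882355556295242384862061517214270,
    2599978561176990182172218303521303082701289748578326986710311660720535521289027740599907969846139696172627435985525347290877395415640574664806912218881911370129450948718023389480,
    241337265777382667691116614690029224629108120938740756778371028589492351992048630706429161447302474463977278599975867293344592692184167430888837723465381771569172585087952211685152,
    461048762061524800531597570070459741380521080645197391874285595870639670487234014480414080944012167560197302640982432148034027254823007740672862656708321345864987095824376582153560,
    3374004188599321543671620772747904591489255657359049723741035532262656182538300225631734109531270436859825025547461226830581329828961576588304395182224369267887694678641989332126,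
    222658753303228030398788920972324899312724262330809266017751445007445600166353817199500262766221101829484058669182692410280978537730210065900087772755666922581196849839389484662,
    1434743698917774458827405777129246859752899973950234975974582413205914019675391266001208345540946172703319052993513531491733587994245795835447519766488643581330131889563107230426774,
    846894936228777274770176380551915824023579403554969984099682943462084520179248008655191643962357763388041659034891870970031660310685265236162092681054847147704652934345012551278,
    5326260824224478609513930188599058351595379453910482774282213896780788478087594046727255016689866680566609566012612012990250006141540615529470029430784830195912576086769879361166,
    1591676618161979931045781979113299965732328183685343536895314129611573332815593320551832131565793874535396083393151670750832696615323328909134102606590768554509209234675831354774868,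
    97594725631398999181397462140342279762522304124898464700084888291900370809745300712775128785636844577142216629353465043106028179323617280092780685943761113604783458445670390011470,
    26770440791554156916878708885416346819965200382733120619038195712480423214278144556115687027664320927535747631553971817040760610302827187032556332114548180713700576376493367642138,
    264932599016632653958873555820716363821580173835851092658306163008083634776031394980471565415936810767363159099274781417818807331958909478969810073766364589932598788635557898886,
    417655980058066415399804011745001217223167918259902885980581470775435074433431735125076572465072211354184743319873534279986383687866079118999968302368887741389323409263895318169370,
    94829702223719450422544053520887714125330235236235121273335828721206242686191871444610993622218571496731007048409266668298748436426402504894651891863609869671586531755938789499480,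
    6550992261286683561069790139663809568810764578764927254183254262559335288725272441113235782917990956939983878268031649102836843700540630778585819225944072541301007875409011060760,
    1874331717176991120831087175392384325081087486659329980185859521551442801763940884094415118913476888626882017136341710926015446192302858461355237218234119233818720437123805094454,
    1321399792186274693351144117710955000124797127269518059003401636941695752896411598404749697438642528150696542105602507269734981379667733884558431635112594818116759776444562056351774,
    29555667760674808270499191638233237901015268664259482381458430081124485247649323116251266222654452239714636596204217818564236525310442109460115467314957899088748435710223459406,
    350413148663419389828215243961939616254165633283298758280513156538608082632760889537051871567312705979640376037606156908678820504526673394437617588378251931179246649053661761391781,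
    26812067813441146019788749461121559384853825707682982401418259956203514444885819404182222866002737659590029416933459240879173208166636199241115438806542664789363792622185886056,
    4525721562117002802369088399146468582508983933080855060747812794505736735868571305894600815129066595351455376341121018392496938939746524609751037904174710820376508985997280207461,
    763399804566781668420617363176018348568703270865952330062934582995047822644015103100748563107272308158784489575364956313208532330573440560905555593394379762882860145175074452,
    6462285537719814899172054015203842281841613717147460213559108916236650669598876995128647751119431836542765530312949271272578722734613212184840932892387074843402372106891161151828,
    4276498430499296070750571313828104076142659155512854819278861491583660049492986161263986688093333148890350541376883171812189356157857145969702279055295576462969997613825177565733398,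
    810093910576005932742308513862413401176723066068364248104880550384587745508090797369092132821444332018802907610112529371394529798853847453988534902578230618810529764836555891814,
    14102632892419522358533590437941198935809109172248842802286827515951124447803352139376215640103753012398836382177578346675507470158960520128079389120044714963085564463855191598214,
    136447746392263279388495566385249906719306566042394443680840451039569579791572710399389902419641516587397384720927127631212077235233499328001241934518288190573781778293096833585861,
    28581335125464858832562461102251524824989138276345776261889400516840447524205137846181019277831558675934875768055470332125773005802102533753118927001465830294611154211670764298878,
    198403197022147135812257451095996789051433653450565058245156016554439662975070205457150522820622870103793669542874480710258742626323357712745167686643897248906057284701528056453,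
    282212275756627348473860133151463650634904808679767399452045270637998716359451435324572391505690734715492442286949243383011588726522858260907951136365779893167023586534690080249508,
    465796029962610494037921716856618935645613762603845648187371124507995377201595483280267513856322369411235325753972168414606132578014311699246951720534675272218745314338025187390,
    2040240041712666360426776665721165494347587046396940462358939005296323843996660063596074380287445736820840464477859905391579389761892216950576515585992416797197719045417038665300,
    147189339622695592480934061531510605680595869843879699617645214432527361081203075470722919006565187451931027210028479756673297120480754346755764366394269397838573136001549027451958,
    5125428521565868505362602740137434104915525423820328660663214291348600808948874851104971392510498481851605956995065723959137264339604654147321305695395980854087975660744126863997,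
    770433577816293846723471511578504980326707872427245303715953641632562474472702826235500241735495141930658820183979239294066953885686761588017959184818089109638469558051493345690262,
    564006726211814524884606597645282236339914520861604508192218870467755249119229866162182012319137644165735488319546260723008023811437530332894667710156970473307301952029356468326,
    216989703639648484250230157019610111008769643780221008738040798507780968569976180914934774051836507470244639202223160089155604446024221361137982381605847133452686807154707942484558,
    602892921648054230116407431044757219798805584132883117101102533850792043224600315239358565951405551389381643013261008742786920157387628378696405533653850236263184824284666154461846,
    273066252369501452472385863596554702319657443005515836820116628892551937709488257769542499471517489988785536417243686259519218958498052400286600617270352788183901626196612920655949,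
    558551559520905284912044476134949505918820173706905070449225555224026639819534419719911458258632677591711322464747205536380879427446212663689133178671490392291529218151433939464,
    29037324859580051470364842179430834750470303568780018382695564541111208697779819943667496368675481243771799894264958160989903797380205912032961069138623599671606247876583380564,
    34201093202313713338844908597212460605521769261714718394776003393775144468558123009965772281131934932606781661706660746223745540212738794895871899688362374187047996170074187273876,
    348224191400134510843410290686648835472901773045046689484304884653907079739984402287743464990242354953123904911098643608251465703198897545941838484724509186944273221819604658039824,
    13040955241146858377806312620037508252940379623204062597586015410449199662901817500008364681059367523908330482605648688594960990161543460377559041682460626118958225684406780760,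
    1006099530974705161663692733498377012477568157121340244724739677556747631677966066674513807310807247892899860843088973881816074414295541121607504151372067617219058669137846885,
    894245499100797240508745137572132090933544304195645992467192413243979149297981982419276]⟩

noncomputable def certBase27 : Cert := ⟨[1, 67, 133, 199, 265, 331, 397, 463, 529, 2, 100, 160], 3,
   [1560983780445237649742372165832618663921288017352521191908539050728411206567166167891694495059848009056070217036429660926676545959259958411452082091560087040084152152297748391526405,
    4275593499473323944176245420419344912025056348557376973977609164573201200790994352676336451584400531237963200757167316634458597082350092143187652031914883990983667321623677859365,
    445315329937915827092986906973021286470667846748270097987449526405636818386587191799930993414668534601049697031400804816714476164034562123806708716304223077011836943158512298695281,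
    1345302280320047796715108247650788350691047499232451589126701087766167367135414914542615651145011016336364606327855761616208217515686040483741313123409498928803215437253077597313669,
    1611256903810244532812651562610850853475546566082739800713892795494165787850867941209971967312375496304083025378059291205394081587413263990762641735010888536763220861858330662768257,
    42109389692480585490042086254394847667108476035982914763634863621855579451235466042699530895945927423590326166693537506319024431637566236036992607591799974847601384357835946330476,
    9975933363400206198616066790555246213367643074838246542006351776767891426237889382896914785972464972736108647503534129748240989833672188183221789424628487305583255355442017749525,
    362895844566149769209833683607187059785290234845947556148454452568515310137251013578326999990720411503377285575909939655341326222930730264422839827559104102555464809814021049620181,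
    316454797634886699332960309380204013487993503607474761741378229649682981228248322904883487490001661275117452601958630521042065494540617346352726145406439694488067821389449348191849,
    2561679864414740371864281347931970187244999850272728767307391128951774039295958827565813516503871850808172130721688336405622339981265184297940596189675662644954440615638963095101,
    3648640156816470526782941181072477034108884318464035626536327733919376093871684910196896792052239986584363458059416784572299378926140708703558579323297936037832330287354761589234809,
    268371182450575971714336419465945574082456474040710971372020146751424181657378300139226274688806996915165489506908460714362493675523576055466281208221082206800728539517279824326,
    7266868179101328110396170247727270147119573874383559357653811213253679268184449183602898589953930428432154017952792400074041102397323174160064097000361161017957975346569349314261,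
    32421285353383041430255492852451106039974892430753063384008507049917197225249993382095095099540999679304733550713838839849375799424949688717346872742448606221883494495119485293117,
    1748364255311537753037719802152578717257557373186708315537035013149705976799486040130106748258952767399368412220919929603694655996316788901182441427465040562928309814432506741363833,
    1240315589788163969271577780460901549030930249932916041018716592979791229317311317230227911049330086270500485655000720123994832136790064841269060913248997891617032602995793215068982,
    181405790612449432276240348157577905429881029042591464611928421421479579976898985269228761507346567318578116244098943707717517695467831887966424803780935064021400464137597870684758,
    196671757474877985213118858407905958399589315196687486064268680798289580850485901933084814222800699522360420698620077734592620727127924908703382333692724295759279805907609001081,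
    2029284449887857893361222653520684894801547042275655656159378850063483554021150840166841918773952288875240828371768260893028791172244656791309354739142223066054613688159296676958925,
    310773725919401816874942440001359168086665751373337017845811593835639688648621569979640795428740138319822498934624932199425443757887946432282422647802055246717155980557477099878,
    204358829114785166828214252120108818278302166423573477116545282810533974995741483900205026514046548254059267639423128731410177830876203148865727176147008576695807652612093819164265,
    3756987422684145566591690899426328063576948970867222433532007559838302475114082990129571493818953819461969293060057628955576599067401773024965443583087899092561416669282069478841465,
    4949208154480692339915223152923187147592173765735046137865156994642580143142189162595274823938799386454874340599628219947197560484482538613654907434735208351671003090838476596984326,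
    1151689647980082479417536761209357868667576832492161134604828059576739855712860954398293556161916422111417408733682220801287833035651762897489850403986539905990689893566754232405633,
    453246123113610755579201164684840741190802727628910997186746931760391076137748974300983135386707987907999509412539889969006488550049284603907197110258355801976128191431063078201798,
    562869143018988378701719552215243608589184335460065938467732492525778455145327085126695733296293831113119057792237856492828802447706267456498048101516733075287097102203222170745,
    63703542382425694994468424594189527653881807781039465969000317414101450575279911319016313082856911000463432901958266738304600246112805229354770088039288863735908918099629653040249,
    32860675846290886281466471220860773321825289366608499464756282637593412047980241153078189037022380563736928261256777984036761855133102739241309158365982593119523270794147387346041,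
    5263099291377253036774463730213518581771169640646577533934874143631394797863505148977743834327038725296348203266254051369653632719182959535122663430423247813223601914588122691340921,
    177498759314118309682059712950508193635244951720622350191714693858241329867724409222333691473204007230586740645207355532678235417576709199308974409582172042725660941859756726346837,
    357009017216592488089603198123816409092293278786406558098644692884286885370777640980070678272235309030457115166319643282038142779685569465139468379920486118581852258076902076652665,
    3175820273823351967551081494540735745308203309343923261452048319581077113355749967941513405065623761751309770274238517069052742263057374697346349877939790081602703134160971753528441,
    6209399772722976920040906183291010269227949294473365527101490773991322639649590]⟩

noncomputable def certBase28 : Cert := ⟨[1, 67, 133, 199, 265, 331, 397, 463, 529, 2, 100, 166, 224], 4,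
   [5968480288356614118232528859088678447441342136359676383051308947229771609143020344092935705852198329644698574323469637962225663277392240220041485161683134311171658486727195969847301,
    2278687114214995132903230945197235508908733348579284334709338923581367357166106666256958235767996292902895035941883418276854669606150794301978336945237004073977821973853675957664630,
    189103714599716105017431806117252482349460866211245498128395673904237322299975680362627624112812023553536069747036784372485236256719683087922566125546205974711141618533174725494,
    4365820795294615627825464192224699217360021681745280822626927536982854363327229248088678036312444298698401330690505545902092319629146892046872146471000785023222826988945117,
    112080780822222731072208293112689800278033962028788224556249699633972788362216901221214096547615480604244746700500445801519421289318702126439381095081244228218584867491464641221341,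
    467792575361956490123231487038158440875479972313890737502442933167189796640420779509668180444575558773426484987462956031451870844446758181431797086976235670204537304836127270478449,
    13184349273211956903674495002178288717879621676539116158548260520859882637017374509831787649584740929733970317770058061783926712872426328345261757947517068458649584146649165301981,
    1788937758386484710121330167934106086321082811386436150351968634314182245727744701549408293752393047828131826979052270839382006361456064720820931794742545799058542434767027496130665,
    1056832413389200458875529430993505214776388247419937385582617596811833561169527894756597698372017002183471375620126381024726111288001620995331747471469513665755299631975890098281,
    46569634561466733528790243370184003489875559605966923233230752838509213853845835750566758978308387771273571152244207676065727980530518292372308243892994348574214840328149406802141,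
    22295292387139383570908578522934015289622307979674021402744037843570046386269200524129038689578756769011383079269345065235289493585804085203313358226782660209981119002523307129,
    4119296201920533409460161647570545357803832250263855891604925050546446793813128285150103402405247895092687941856680652344291723915361287101374743962669984511175704618127312426023645,
    2022831940074540230749935192351044564488080203201011495151034732733902860233029417121350131510290827293216041498369018872454692176344147527885000449143871727081514198592995739450230,
    25971491260311296527649033026401609257705985324607942161201606737341395894520722492876234835440276621908659865190919504328151461199663157989262329930756651919711861028055021361257,
    444103107566105443303639532256415675699948445319424304208121257001922027590094671195512583684449471227930639550466574555791855304363296046679895551748339350347533321705955203177,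
    3990545816534869239630573575305548122585825691294044737405487432432572857862697077945047559625634181836942162240500349296603577411690511240648282186351227223478837620804261090929,
    981576193772649721823155611481460701374754660051284001248735067605289310108536880669814191628939046756184559258002493332165943761058155702745721576705253008178099756377431051799153,
    414538830084558129126570600136517748739085451100791474935280875120438610588890873934716423830685842948616982963908765844242207468795087835695758559139928727271455041376005535764601,
    4999447841018444571821499216448426986161591911265595824425167341211891741060632742422333950541154756045844482742689960873890143699993106081223803385116535097416975074390098205055097,
    64412766677363706710908519655171248194992908559189116576519037144703682247624778367506917581830268386250366323249851888968071841073519413884964323327449919175692588702441585,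
    79005772724305366872018975709010602320383833482614442930047728792422762332565184389128231003000465287371107377447900674332744247972626676458201978130020283979083489957484912861,
    6030863786024039068163358246162105468407805677935272118160453848792079355599166242773874789568534424106101475252087867069883732132900567013884762655344714324334480626750342382853341,
    6687369519620179464412662835467556130418601645423955940644538034182097721389313762947635800314493770205405991638789872637773918664302324583611219468530170171077231812122911453,
    1546492033459303660797361191139262014234086032164182796500397274224254829432518509864435284399751928572815901318830123439916556065959887953611790452157228454158995087505969605341,
    2710372286946704476059150066879044664020450313887821316497312011207115340196486614928208006338664524917608118139825819041136727720188682661699118339713528558366036454322932857,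
    12146677055914344382318364122620434090909006924625093173249838465137091724802122131050134272327411313589723560877566236360463451298394232399365215627805852747459904902188949803741,
    1512332742873570467209988523300217064883914332968205833369574009268834945000322613294793041288338037796679768034080941906305309305789974267463509642772566635278589604744220167578233,
    6596127486005893238942286126913061458282082815587875108284567770050518567504711107480060969652286915695610277404214597633238968651992379990853619682756095675885758467664745181,
    1531704739626120433142027552507502990542401002340654542100471648050887727353267085544106533781738213367178910166119153077476506480505672734563052870285703455094665419715625585885,
    148574619676824993487856193412569874215397411594882638757916808801399032528362007848305610199740745703982860866278049974070186977475026377946643600638422026886718649550690894501,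
    5379355467674130897042189901690174284598870100064645944663838847964672655198999753356558006373863870848535293607829367680795608844446885788175860460433104750186901188627741666153181,
    1866662336093353856476276264852493252473712841249453530856884653285069568628610516912551248670510530267937494641699202977674269987162397408270202731908887586589251036675400475769,
    29639851886885804976665491895094853094421789281116373638479502042902887179747060492686205786606849281141183980966334607773853360321955443834529892681532469189716923768834249398377,
    41579184264478779823356966613774967898521695554154380809578821500302999303348920629214405141864344724935953630690980763154404977756941938685091751998700850067213421927215497681521,
    161630544382969544452862617347688459911033092158126139509647527380139497715743171964003775715515596121506670010562646012503700116222878883467524168215728548397397898042076519381725,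
    3233857991414002941049462218975021648513072738469452728145674193679414650417430517215647494211263050097889428255816088009378136080743291916604364678031057412407723119005142699153001,
    586294024769595622251825053213763722992188642154295515854618753636687429569223082186042815574190548736643921221621831706903544748211060218203391587889401523173050217777320139377,
    2591088853045517385313017302408798510030321818170315712728315623051351227143290791340029233459668478936709308905748951190194289381720437460455586222655659552178815348798358491225,
    6140438236651939354554455933553099987373058568912067956748461234678356998855076039409484188703162925626288675447884791839885054691128807229418527988572115697795805782282528060964917,
    2586060545829320179614454063940341397242010086232685825505414491201322163001553468707238741522896484158507214932094665421840769943811592621870516036058598269282262704668709151859206,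
    3059837018870110406792787476285596856897104500344960610418675187199196046504988383531138814785303388021156169402021954810846500187107175288524953099768808524727924148999157928416821,
    4466852036183216976350518340022995342857867904168383463080925922879363908669943405140807631793914157889070852836450979462508108253691647085834476417394177476931774040843330516505174,
    505861038280130874759000653676723476368500046889264073556998748971838578899770758386458454042188270261340642486130169531765117495406081910054689037278043107681016848264587250101595,
    78349917859328890784278045137167821439444973118279206784756823656639672299467737104410854455037690644325077484330151916071116060398399572128175019585380341805675107129264638577,
    77394981756096039702047086165670113883092600556818842751952664369521758770485765436106642419209327466015084809368931287302175647548397930673049679920339166764681126026908381,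
    6822695125235892415974109088046418237283283043614008335636268173264178113128215614252196987151532315988487237279744024539819042354851522656374141130834098245640413638998901695418589,
    125031551778913604061814087968806295957862342833623340588310480479144767380501284476705157526271937122546782322650920727611974339105517310248304652707048344644979978176867045438991,
    22085700708283977919918078459540961038293333199177520531128281692670701498356835910517877462913049035449307260049659788376798884645507376491316521898458284534271511980947110304369,
    351218334990266647476447458425589965333869885858779707538636015591003017991494386904707084996267032562814267329453281546184620218390775404755668239202366365061314400663783021169,
    1065846688679790413288339725904459003484853820385038121548125152097726056693598082384309643585922546448206855921365864111129965369504154691059620169929704454986123127032456315865721,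
    4586826596773731053027790898539480744506457135300744418053230199924616210027306222149047290860663932623498317810509264461370302728656653923675642624793826715051556400100919931509361,
    2739178832156486963426189563938619563125101511954974694352518446325440528052485310015132300818445359704588033163774522080406571483808128093723542075788580916728482890433616242331,
    969458212082037188366005616060489054313510086865729189037226053429553452274168396537099445425769840786694101167238544526405646407869002433362365912614355028615142619854502992497,
    56859844864780262097996500520751313881402549200182187641267288376431510536743388512076703863156647302126542941494833231531396377650756158719336138018207683763063546187845108341881,
    249484815754420155724620260046635995399511537287049159134672956509642864957163585715073228761194784231069294375562581073724327933721903355290565441142801824267982196442550742517981,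
    1622096932911637290329718088018986287498340128253588784794884467027754246990606857265973900197799708196290648891178677078043446188576180086051099101356257391206421062167498881,
    110221685567097505172355813788173090823299004790574213373355029324403023269040486822245622979220277396323782125790474976219223731390492923567069324969843338769582006384693981,
    253972551395699261650312017675807803362529138118542128730510481164744832694665995056189661430864393772471335831323449695771494266214920537887979153120494105996188397823485408477,
    1968030537856106945827528946938982305017436932739194512593379579826511475224982781556201145032477988863133953044565958140260898189906426572954324710244095429646570218682300877672501,
    63883941089060262630333565383658208124187620908626576507064890315667729071344084265415107443715221145531868385035198918247289034042376499840640721088607178187309521312286384405597,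
    31203799675339364139243762090727868926789810208465138061656423295259783258696879271449916120518150769195913702373244118760919979466459799250659247750120212793423346280663773,
    419774176276971311535054767635721676767334269156140055325707827646784950249122931932569960397888741738630936047220268094385877647870499437261813267329791131960300263866105478475485,
    45574898878365472615032081793740282525075771864370739006020860609664117603932198756249944803149664359566849566395944764192353992635171628784155750776386879058660092491099723928277,
    6947131557322017498384739277059290145344507442407448062671636444979344714814969122693171549659846690977133530879404961359866099940621627246547273409604342446384174343162282301918321,
    2318860044976647295151986040970759164118628837724592772043765342206662286869135320936871410350159795912808383088793542662824416725999594781727008955166744302265387286801428966,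
    16456297534663469412817417779985078186688672640150705057093748191863324049513781081009991807186975843789643962841573478505539215576811277721106606526649465964738449689031663906525,
    3926192112874516305670875690239030618108324702837620837602207664500523242321030625456891799842688306146832796328602017536379718556200828108540857514520751180693506071325170667649,
    1783959014357188261909237237344864653832455247659600421473952715753248120880197593419136711777939046515817122366369524401598760969710271952947872920567323442766862826103607572477661,
    12578074243960831073731864452402735550247988086895307993697803535430349122631349720622617465577697123345493496937521221789723]⟩

noncomputable def certBase29 : Cert := ⟨[1, 67, 133, 199, 265, 331, 397, 463, 529, 2, 100, 166, 232, 288], 5,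
   [40166873617237039192178915350312751525257605225305233786553145352228444638218314213389058365407559161185579568840664831573358822220408191185959505643394724746618920381470674354181,
    104247567614565181331461974002101203419335025444287394605116136542303180195904910293940969438333352924238694169622447971341652735415471387526470410676845857100350984206316261,
    6412185563241853514827839986100838514688116873681554004808587649561057296946548608606032248999182274958935301413072727554653710435163425583573825222878907230387199125829787290845,
    12480894116409522600727394455793133610938720722766678056255952575063230942965968265206194638440148519196111476952217430118661519204783915359542683400933210362809485056430096846557,
    16212528154927645250745022565359822969503828737856508468845540185294763016811554502391796527453878885724142224467957156041634766242491260305388724519261494122984042508789333258973,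
    787042165832446198809322271582629434922240603598051695238547400458584407463880902881191935298779814208882135304755666312746776633380652718550826760551843016290584206338235256405685,
    61776396852632821237314483673992923077589446008172350639505695410763325883942576846253586406437363176136755042056115463088507618083988760712591983328727598531966267429982437,
    2846650661088669130620226882958597316187395256009663711682813741075155719499007700238622181622934886794960783700288963015233974461071563317080518237678289684657782850070773667549,
    12145721939890033286643979584173429058295642540550963490329125023966983839117652110465372844340694892991348050033234944666985684567540254805178004188055531542690728950829708154465,
    1490677826826125806398755863784961793341423992354984237809901723996695466711836376031418538834001700910271009738402377701164065376871373660125642925284992704586970867626966735883485,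
    558411794368945668209164706078857897835247748169790164282457663419934601917812683783581403120881063437439502730631917231992170263911092117624426981886071247107739317919448731382501,
    2235370809107205054729597524972209626387585643007120050149801580626144365563722515834491891085555718003288594317977287463465226755623855212672993357170226937281078192490881129,
    7019252682603677805771409649944264970880997851774648521447521500468238807279122166987685950115555920677981856186559261003083827835558939956798523762333895187480694028562828330241245,
    4913426143689407173504442454286197327846598792737615403212920779442151870679116826476888776441716740075626959818323960826452666285375978350833136955821315651553717775729168041257414,
    1976825384491890574762522373536071893098808206994904417865651661527578262467763772071828060259769878373325715023683655902743361343709449662633001023310960321487159915194530533,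
    1554654387010781632692393758113532782733937433686447549969609616110738735712986140108447565441221714495921260175388050426565793120976677987056755716728127072788000938571887856761573,
    16888131855554686986482124615968875349204160453902566082252600577658078149428697919889291028460741667678714126361922002656864201191678078833478689549583032711779522363900531421,
    714927871757022922641274571596706302303944009522571973970119233547738128677468017996768807263951690224219681814626225369061592819845008146034715346236702065298919903461543744229,
    51162660443955208596667601632548064908687510371610054494112124935296842434284863199591698089600180385497811497584770667393424766595119193657222606685820775076883925403138852064377,
    19992917983614487061033661792759666937435158508610908156180696960070416039181921473404165834494767100535837160681197496717551099523885780268363680371942699289254984459201929949,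
    272355378547257714852562874352958546728811142553279880628124713027260525429235127409342848751933277672722198691644178092650459817471711306936420754080720593527192165956787803869,
    7092589370508145043611503514256043292224635707999321489100723231038366150416323575585404923670716337516755208282123935475000028800361126156626664378658620258729112496730183397,
    5944098297391150850665455956589779006424638621318392042989793945740881888188870905062276545968465949396646242956302472297849637641808374205572191281533603460594727382662019723485,
    2297997157056580384032100446787583515010687995080452360874721003467207362295155473901557344781283113822597191390946604094110700749990555318770156371425747994375012908252874642149,
    1021330495726608289781481672999443864060094483706067197086099515813011681256855218529119947395039604886724772277576474583709378949133017041810522605425257086597545799294480519901,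
    14468423022183768809201414444125734890567728059059935049653106076804014885964495064846928044273581863486299850784804777778333097085105137503995385838093411715746580550789323767517,
    25253274137914709969983932944834793182492677562227478514016909072874131073427119650527342542116387272146718455954312036676411700648065920569675688504225442877341889030335243327593,
    619753739365784727394526377443709189319863872075603276246233530918291638753127920870365847087108303904157816684136401186973515561608466318501742344221770080630045856732855548747889,
    304410234886511711082672726289170397094858720875598581593767061614681535612821711008979314312787426847615553985007336826246245970876263717091384091943732268602245811755989733,
    2998155122746850229654361583581263276820884566483281195619459830732462557698191733031481920343936443493751277901402551402646563877876360403565018516151571669746524286487343409369821,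
    5271569944475127274391866342756614186830277356558999743400494329412706958595358490660496004828983206198136529584486689527195058179311846325993566664907139198031228635036727148,
    233944054269220270659923315651948338540525711818018520232729211958966590302757855757746560201317144703356566001241406335543926123664810405426635932791139986790706843452619485,
    518217875296668006672423236892112861087157397569145582091232735960937316417842376825372006038385812866659116283458010554432654281785326803071197559986259735623687387989474467955429,
    2882241224274703902076240950854601290731698465325452853041430470767220033820176558882093477034111169822321388208734088198651129169591569458697788666080268084263925688922863013085,
    815354452703188609595116870963998119752688537800339580049879301291581829382987019696329824565449422246931516076000537655056153874035541033818599006088379730100339532075741,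
    23722117442606099152605013820907238918412357998667074892213587030294559447207568563498316352395472529219082642520434321717096826372639484280883641666718020044487906050105643741,
    13899686567992007911358969874227394039540664192037542941823711813501195506942867827145848927482412144939367789521955935393428359037571713643418970859537930843478252501045981,
    4586322425553086098525479141082836703560802227856687426928968069165050544430840099829927229170829097981473854232081659190112378855947380470722580640606814583590297584040643805,
    2300473606699651272078094865820002873876172798597838714956355302727629926863617043272578826137419863241116073768458156398497841687797800243267741673562881619736160563867106021,
    45235924420345221053258607966515192601942485262447805610702535331000830258178887805569579538967359529304816538124318813991223548379706247193619664628402240579294944370331365,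
    3870365580144837442344657351407472524268429982597809731739362208845935524984027137870282036139548740099590398525733469081826536369544240415996595711367515754304086492975954091021021,
    33835473316339166972490847188311627832281584837947050483621029622053518271627147712019421428510978388608066590811773293233520475784284416221297457621738901230056845434693690730395,
    508554875222784820297831213815619333520508632079225832909811192627155258850868010790818077614482648014212425817203712472301523679585919092527133876210900456738315160912728560679653,
    1568755718071728655395010046813534685938934414594275559722190924676300021798720804154214718484218347524080088839848264268545467817629553251039634347303978243383982054558476039555705,
    184041830679572622169409615260484901914334917903879558078773724191573683119201657779642088361901173947837080857427296370187651068855560486495395353346327077953144303527597325557469,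
    41184259542572761983738764896252269469730396706748162049727343549884864548017422198144145020682957830693236418504947372803715766598342128777887067505681077750591583860780765,
    208456595100211157242137535503006633320057208569407258479681279858976370574547448152317407495230128162651705365599664453258832998870137329019952332599421728855847377410354909,
    86467102482224946544817310442460256545892862231505029802335032804325475346551327677070243519779433562788555542128566767620513452921823741526808662802137141881620520936982295212261,
    49421127150282664810536788018408126935344622140274538724315507248493000297378572048426828871326168363277279863316409095112136534543810174037456622126029744858152258551784049,
    198917733027764643926960662115809833412804836455593115723376614623581026762936095126842419487405670481513006457053246939091611892903865640691729508396578785074707623991752748765,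
    57843843019190757140910952585480726399809518854026978531775768021183049964515225311696477492978315744832334956537277299402676673271513541551508409120974186889115826571870481520745,
    68939995466904873672360134372290117182973762506496081730471869635271664795304828417996367276975880523558331656730533125488007883688216213072576090951266924115545987064900457695865,
    925483425553129276823833790125208283097206754605655767491284432606201650593329902142885905740616404768518386235231630692319433606629126570404715706000349179679025218417957096165,
    661280275978172908148038742372618895638985028751824344073284337181266041507279749457816118179097193138627089445984143639580068267068999067667402375324184567236510548227672550117,
    201972639792392762587204844811600985075166682987629240418540543194093287363821972858677736055386768494170405357517603948863284043744945750803482707100312058149566950146902789753,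
    65268020802012058040281110933503586938937687311121801039559905406616649291865358396167682207163406770766061811983192645651766771343488165146339351330678160081309433662059178801885,
    6279985108794765840435472807196744249354062202187081369196098075595194753864205838150563258962990467418031091549206506523439383071372424417234522732184991184708704422158317600477,
    249782520281608018738666805126341406378836250819357149866912227398890960903164850565486697]⟩

noncomputable def certBase30 : Cert := ⟨[1, 67, 133, 199, 265, 331, 397, 463, 529, 2, 100, 166, 232, 298, 352], 6,
   [1062496944595941083952559406607139381903120448078002940185668639432656777293470325912278012746090929014466005251303614217775061381070321968116621832117327785406879928315819431714821,
    83492223037007106250615369772104335720518953744831356376869731337718907382715996928776528654674360566414682091518470178408181417665593781673769405258261405665192114095362789,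
    55661087230324410781673023038801654849229002552593781316711010861185546171570054230573181730528406195752228645848098174135937820597833130256428761142423305520919229822373093,
    8549566840072658719461259170840020859902992998569151274086412285173646766777899782565384260646062768999490008841213592541975773490758979157639395239885267270272258454165885661,
    2142528409529672936981998790726938280906624020185909993615933390510213132189832538504598720105194906746038707919975136821369288720128445091332769337325286493649071096416989,
    3891023010009082090405807637346401030970060324381986516328987532692044353255609691879432786791000782292178585042443357822543286719287323124545305836019514238750343942727709386461,
    456549145955414448332495082285006813860685156029940688076336323654042417918644215678876082243064241299589067712942982246416737376087164472557056278174934267042347477865189,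
    600464109158429637940577809315289127903352439385037308668212287870797414534265767333869712807119555947998988492626345406191469352117478165478843420374059492082472531284247261,
    4034163164235876416670814545173269297350736870627658384112577798878302467002836038807263373366660106588409620639525126600173951901204588379183602055227920349654789096738739317607645,
    1375133214082355133918193794588169946801519124408949741066218581370769401416009118013143646537864853740113472372570155295483470347076370215584176328346225832909765315487136208525037,
    2766949696006458335533779712057854998176833244618361840732822229382193655135928949189737661844187449364131674804435329733235854146134441531452206352403378218949370391132928525029,
    216168052480298686568063060722589242300400630856299198623978330725682807435939756831550819128137062669669090454195605751820953251721798603006727327921142014707775696099344356069,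
    1750960196593834865204638622246368004115153149147448987411984855291649280304285224970982745485772852389175368987028342586434664144433747751958172192703015978149878214154224876253,
    1231128604173924584952832433820147850174074698921432600256139718406167580407116805256707313520552411273759212471164240007024868108730960685914708005304063268533281489081136549093,
    6839685591868969661973432163420971764307997097806238909600501813625819235945441179616641905873635790399089840484524034150127226351649846428738787261786284652816884708175511524061,
    29182624251904947904133328270516013939012188455570693018053096194651064825092815484351858634028094827374009503718848645221675305202088637058343238402576429993665234978685817581,
    35623399645339395667856131068995300486175716375838883027986249517105117116639374359013452466681745751892261182954933274452214967930364637649094002431032516897557369606605021,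
    4425741917216299266159580065429522128040483390779850283991591860330805122849506713676373950723966562355034280826106213804318873897480671052428244288559238674823228272167585004253,
    101328754760313925411862975276210495556370632698256715564263667874718450793228657912955932652140917605328918077913874427139879363574296645426754811896018836192875156029235490525,
    3933799056227559969509600884488986846805929480084423807760275640646513142660590252185498578131739367143474450879932377119277845891198121299256043453465967390405779391916571275493,
    31274282541696245460541123695672038331912089077699150583693262750657659743133792209368471856333812741391480944018240058873132923824488213745163979315778195180165187910973157,
    189962813260945302303365434601865848035800511852554358761950578636390435685010168452382038513267561965357642305537102744775796979209115890528646010263179417842678482264361181,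
    1167253195922349760485329473283047906976172991647678237524172936595820330491549324176874330893275140359383173847260180627671682311154650309483731688310298300472026880879608380133,
    181563651691880816193769970450919120018818911860270298800097751748102454084232387666766204422095844619755527812837]⟩

noncomputable def certBase31 : Cert := ⟨[1, 67, 133, 199, 265, 331, 397, 463, 529, 2, 100, 166, 232, 298, 364, 416], 7,
   [101991326232323268939644168878793147327854848725500913997206979369855387882449945675690524076843170927856479848165536235786873464088943990862191406143418301981469964343786498383877,
    2127405815948959535889996300903891432428400410464351161697674574429833095600569349939289596668282589203131585370699894344460068897597257823462817444516485903481271635696734409453,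
    1953707229704151836822862438542848315638178342267894325274244915607220742387902983338079110546303010929907723509918618212724930072688950076665050053572542411800594685782909695005429,
    291821974573743147569036790661248452957367957411125816300463784500958295603817515681045470576722563815855035199598122863688281710572903613380320939045435527150273120150156732,
    2625786106399539473755492287953541391129556364462071959947457887539638365538935459697200054420428805475768799835031079105898905126193870526450830068383418750531579991199552229,
    1621117553211464651995031396671756569589155579570799192809232390272661574931874225918796763436491418254308985302314562144143192144398774426284391959881599728513765364157149,
    810049051443659376102542450629325425985062499757476077854963667487301943345148436753892841884284716454327226674874866076863440444597301383901]⟩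

noncomputable def certBase32 : Cert := ⟨[1, 67, 133, 199, 265, 331, 397, 463, 529, 2, 100, 166, 232, 298, 364, 430, 480], 8,
   [31990714721728806580309897208709476267477738973993083360761843447954534280380346325486108658130914770411887186385405669074085619087246989650419882876076530693142931388745363461,
    96912798430059092604624184770005142012663372878688982454762775999947395706573827837]⟩

noncomputable def certBase33 : Cert := ⟨[1, 67, 133, 199, 265, 331, 397, 463, 529], 1,
   [1032754304172283223620193763394326522655805176171479345041417821942988046721914893117818922686060256118209142251561795525810686803911960195457286039679120428856594198042249642639361,
    20384289501]⟩

noncomputable def certsBase : List Cert :=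
  [certBase0, certBase1, certBase2, certBase3, certBase4, certBase5, certBase6, certBase7, certBase8, certBase9, certBase10, certBase11, certBase12, certBase13, certBase14, certBase15, certBase16, certBase17, certBase18, certBase19, certBase20, certBase21, certBase22, certBase23, certBase24, certBase25, certBase26, certBase27, certBase28, certBase29, certBase30, certBase31, certBase32, certBase33]

theorem checkBase : checkAll insBase (fun l => Nat.blt l 16) certsBase = true := by decide +kernel

noncomputable def insTri : Ins :=
  ⟨18, 7, 2, 7, 3, false, 8, 65533, [67, 133, 199, 265, 331, 397, 463, 48, 529, 49]⟩

noncomputable def certTri0 : Cert := ⟨[67, 133, 199, 265, 331, 397, 463, 48, 529, 49], 1,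
   [1046706131704750726619888655075429577726418354013700087547770326120004927423713078728736183786334942571494196639510999087338924217210059053064148911460092444315069805585405837313,
    2355712315872083141990285624491991856215620307853376487076958899001270358819556881609155024880874941642403977002038969452087509125239977986214396955846365725634255235327418444284184,
    37769978753575538135068014665688705406002258187857445713595365515175758663141354614983138767150458408461310083107400942603397316583439754729254561081288472759163880225596642283608,
    1160761700131766171319284404115542614173028716736135397125565158566607494998653837851460135265642766202551735203055412260045503622142482568825329790898985403787624837659510428294,
    1307788089626232652923312240752176819975777634096829063795531304347119754766668560535452702552162408857037065222829685731822205311099851881968294202787098695734787211581903184,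
    294886430772352874019177786667112822986656221356800271893129494739174193238081083340946343282764949211596915563249321787024728607993492982167633143352309951454137500812815067448942,
    18572186892486440932794350592180726969284438187939223195237294382036282807365151168630274014186221219934653005053132965341017523448256489053492559270163860503251457262047283957784,
    77408677855072545314411876259204964105216460750737713282829116156351536191793932687313408105023169794345831955635397240569941250663257641256166290172134649710104279267592348029232,
    5947587185860694658646669790485048030675018526678608453857412568142409232851153707834669432908279201054724334279393028981750089644011017158900101245474566780705069068271769734,
    194890708966535816395298688723678958158788241214172816213795726631427132305354778255523771902012502539970095456000829604001465703012002976896638965712396240788986903504208968024577,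
    199197143020392574065154196143352302761646292534604392612322791063797074203474259890478953518718029265973264184627478854055282506007878027663950414869209653072820626721501564174624,
    2488950747142342625862957651387372151520755707838951064505874282526429918021487364730741242826529726517696079199229972248450196621023599585952289271122628112340797205841756262,
    43740480203836170797006841643541293358341354890330398341417861769093459133620216576170358458846605698325040187291559960994225246911471890606417323154918062470041220810593587445862,
    131092887413609282826451470128754004843314730177448261065423601516916384733639506196454673768433499540123069481840341380959317841794910969289341318389547980410390949292093557412,
    2488256957825143725084807880453086613317120560631601707755015510040108789136459218858859163866919914115375204631496276859791782300083527457474212436522398884986463751169842938513998,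
    3047135186360390928938697140512657072911482946017184144945414347109109337346379598297343317580902491722293971087691569282864407276391775691081111360949415623586851512410518114600,
    4954155320897457986138115797701441750169233277239556951881949626313509402117667246153495208912381538481957091237756010497822248472086814130444912770222342201590971462762344546009601,
    23837096847332067293337928044375451564467604458871390078066238477601621234261879697842523942601227887436483943150478286421324040830793021331801028633477292741909574831646726278,
    97571431155086953656907567601636792889051084160786395492278393259511780650694215357109705135760308899604493470672968925141686448936114362984607499016625348884729287784709004444790,
    2969544007204217634222785214912516505045394447752932668017791846307064206393613152281537857234635360602077829045541213710357591341853034611797361405967452897483343334564970598,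
    395497614977141474463925437623021829602384306540242921487672864010326974588543987846259152689590551748430862758070590021973856343457636977]⟩

noncomputable def certsTri : List Cert :=
  [certTri0]

theorem checkTri : checkAll insTri (fun l => Nat.beq l 0) certsTri = true := by decide +kernel

noncomputable def insFifteen : Ins :=
  ⟨19, 8, 3, 7, 2, false, 8, 65533, [67, 133, 199, 265, 331, 397, 463, 529, 50]⟩

noncomputable def certFifteen0 : Cert := ⟨[67, 133, 199, 265, 331, 397, 463, 529, 50], 1,
   [528364122473784523056720197690482313719757108918027137795587205396333104418200352160140387349278527849756832758998909723363735975535136560446263911915394054667000172511233,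
    2089572757470294121163449270267405532638524296224024357417071122850951044695083233500485336614617486274413992768653156325274259027446723192787113117421317836374013976643189874182,
    2064396374621722270382611837235246893666497373769997077494463971233228949252951473985019581454406420564069292194859658752169145432299665711501562515150831608983902759170560,
    310877149781602291831310411416894469080637268047717589203635378782002657809258703699169517312791601168156071702485690511087583040645096345614915660357951669592171821064716958,
    286953796906596773096154608593985611523011576372696189207120412800114992842208246339574192093930558872392340997237679656105962361904043590322488103469689331866703460944592918,
    2406600028296707395005903618936602744675881518428450170680873057834308442320789891820388916309055348457525749318570939918526784545652603256150620809702578098740767782663676545352350,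
    349214240571399911411113665893580992715425749770389822069466188117011449667656997097332138700764000078053468237925757722715101304052653063978248853214133961030682395443214,
    386582715754747584074686774270440640201293013866760602494885185727661786339186532112306736739226795655877386856299730848750844144514932241697467663193291848487141090256963686,
    2954180269698333873796974615215750333924952048598880577790232610031777914083160296898269343330191809691578643640717514314819294697217597701070547733299059201895813273200527149285398,
    2486869053403547455560239412487845559425581070251809209407706326476264308149034334542685016600071295991510427522660433293501189676171513586172232856463886114571422400537174536,
    373664343981539196088084718147548436713061600659267820380737184950299124815535035810169922132510286058083481861758717765341502078656815144525969294260051363870555112624930902,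
    342050210101608621430604308640843180997255444179316370414319269725941720783809627198834934329064289822537463354212110529220074302296039136122851859770691911851164826879541334,
    2822862108002302993253780587191714997178605661758364608874014882696314013938018714620872711318673503488003119564498061546751518655356605824598852568450642623376852188568557458558,
    3057099087202579854309971029894187151898516716649995471773992273732059916728599291743038709436371176724568376105945255973549554168735227806505369781922851674010452877185928908824,
    295290627611600654155201536960126172107746225319684950341893290542035814878314755455656166991604627403248676236281951788073940459097010576325333791258140827380110783051711134,
    2999060837888531126493912485429646426510814317332575230449751876089574446576272335874290881603060541878239811441977054043206425329700791707961338695750208148258320610985406378494054,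
    775638219461268004097436959054327797112485250660356689796607542889671652334765972320982619484788127897824344505285036341230085267318635431499149488132005017554977984791509112140,
    2801855886937656110920740766611252321289438948830736748417042352139635753520086412636417577274615164675044839427548231877933419575555687654351623063018368300111210406739499589142,
    2808890933225034905313868163552636736891011553927351789734770460904262708276450159323666672262483111945877150666308808798919348650963735770218799210875459642762206976179749090639958,
    2674233399775677019731134054347807260839843494406993592755982141474829337336309973556976745776010051714880902582453772862470446095274091037964592563029815197013552935094103135580,
    302298641746396709153568669665263698622002339282967289054373691702891013601745707252780186650969240823676119409523502105813178056768807643714577667472651538922634616654413910,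
    2546610912617414517703259066266889247330574874642079911464630438566446533648764936608088010997344518345756970415432459199570495867691883157527302346219967248290392778694030656606,
    310877155107196828984524156395019606963306922997311167820917830812942191385835060337353984365066392992727625690937529616912133909584610915485539239461138237056622971382284374,
    2344787530963754911298153494774530148299003341819588567669342111950671366241058321504585061465863602948279029060621611526361554306047292207614716873558453207689951895546392448110,
    348060601081109528249304787629407475418250891876975786683164136655233967595975330594585872695073152698456390028941712216200401121362247075230944308028611004968421355057024110,
    10681516989249116794772648976520651922660082900041168369817282345509290259030297594726840615560530949400034242381085728403547826835188362864447495935978378342140670467245646,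
    2362088378282762106212510085788453056479709063132544132225249050998959685261182078576081083558729694490250021225458374242091473437581589469713575279853470451392873163358278,
    279763895443954498659632282198816220588182758918382981983884567550286863721778250991990578092770115743693721348562771308487612013923413482424961721864590768198547422889139742,
    2475349548303506723849164974019959426476510358201359986631013981081260360032536071824683072830573259082577733646460642967103924409682128529126636959611586973437420929316294778398,
    280224741611119943048200924878713596220832758796110686931426209392999674618072314204531315012131882752008247848149275753961320005510326677335399171284693416960688778288662,
    279704102216282112315746901979581983912620347592375520466220808450711984193796031487656945045072443386311716935593448283047584174977787536415851589682559374738651093124046366,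
    363248183184215231307262815391129132187527590688814666260759871299594870768422888181650070241807969105032843645024313356257105658557953678348516538144818176190579514475166,
    373898408255539130044238871967432765880867809776688336783383248530668367212043908331678584407848385622761141620457340705557407919549674588226456892016964633603919577291611678,
    3041300402681195410229713611694636768708531729441336543210748051696969350732667780561110134514807333271513604868292099908237453739658436468400894494880095230939971226818777891486,
    3051103901880883443048718719490968663372779077916489415715080433018839816516174109305628433637020312527335151456802138142275088709994428291834194350954574969991393948368869470472,
    326463671461493038774866924263129045777115421796664236148754763048293750771088286977673968904268747032881921269603897784133237288719199710950023510510694581853880150283960990,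
    8944833935725307832939643705125656850720319080560767010562255606002021543060787215717804065835882953718720717462970242315522986293342815329883326452950970177132290776481878,
    2361708310045392714865680707221956456176684491705637426918082263191476644371199751239231777575674681267995498658113894088293109635912454693224220858638349586396120204119134,
    271672545831020872806836359579237547775556741774746339339061245007492112443318050990572770134377324627366185658220031963753061456591003926806221216549883089520262764073868830,
    293953080588203593227392693749296019603693385398060124638498792078432859049902525451052789458085161725793610553437975554144033804065530655175242361545833310510671884619809438,
    377522185154021806263877887366212809294287583474228281187262682830442518451715914077210211111420444161350207686373203346792002206604515084283690499909394517603358354710041,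
    386582717597746342561564795230390293491904413127734708978106906750571257842171983618250700542149099274581984110721887269230438699475061415070001429435948036595702177680514590,
    318786668520833454809581264468738843124638771563637715170110602391651337868288119826561293621222827049501539209784278693060246941180091088979600135702444489144375590444574,
    373898408025648308299214696124916557589493557768331426530376762541711642497980099389764357437986514996222502498688182218295465211639252294259550840676313649939676634681753686,
    2419020808183146933425371299091387131373831618589865656251204842259517972749020896235529123538154900205410914472431869306075791679454131249075711841323806169267269094882414871198,
    279704102216268053206775777407006279548094965687961480329048913457963611053508163380041175443089584642505909194836819964364711052607218521154934756387940624898424817891721302,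
    2998772294851241320149365905292629793044872682133763380203455766187540745455090612156335326840575041366480345639707621620942929808708745085708573216920684405746138492595148710665758,
    4815227177060078114346738365067662374883901203643400267619064497338226080092070348177767397488268677977905833589408232044425946814650083954322612630820167901647693594938298663523660,
    386582717597725359167018231057066030720187011424014566103611869105594799320746957424119699324667643056635973015605992183096235578195798557816426236379861410772502820818181662,
    386582743425288205719966137684273681168346631638662392326542946256405703802062264432352681553794994781313271837862484530336179005317172480137693519673871399966822044071550494,
    2929421372171169868062559386624220664140562201467734599910171966446713064479127011774736488462139100360044750272353808231710159558494314493629883210107154432605944709779279594006,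
    279704101726793261899875486786483800288984249843453667258329525790325607691775931736106869158092593702313629867043783081700716456346679907590292038995518392784496302803157078,
    3045167971537911496005566482063981608144635658076379403887477419231367239291657481115405984385828432873235448989106376922244562268605354849970149024710153149295100501242450992670,
    373415340835271151006127777138550059171456191830781009498824767233405210400201030811234124454396497877731157233217573834690066251881906044226336418705851322727668633527583390,
    293956351271007134841286257164316784618731887075378025873544967212258279026914757632898814560441174001377248927163095508985015595517590016603619777786781682003169010474205854,
    2291336212912430006875985622041051364393491413740096484678261136716470405589133703077696498919972266095921537415726865068370925417284875638646857758527857252454281142554908958233,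
    2377243918310457524208696918460035676190176308898654204211879744054185644103240785486312142460503021678224752738102580042613281143383566788465452348962405477738241494736776940683934,
    619207254856650909633349647140543487296484559252240028493709925736738291014617901449470511673722933671541023488629024195616602821472680599960027545973140938110539792050536753500,
    279704101726786337624336315541729807851382885854587075788050884052915313316228553388786854739546271585503487946508442113311104530315236820938594715213234486295166737145060894,
    2629938646741773557265778782755983843683290056477985344964547197079115164994627302743352902256518133244069588575889577440043125033674453948741890887219532187481001964320718892228126,
    2225024388773918525257655610729087265525275650325682506361479763631907147978978950652431179982180989403852321269016238203031816130954860025350354842678471719483946617547385904662,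
    295290625508098408350183143091414287832131742045624499350086207056383676989459697188692752347648784134537076099473532422955083835929903194243873959780944413718985108983152726,
    271609422457526374433556921957791692286627971117483233407399102329498614934764651374854061540830382332062521967356487002744398687954293387328008184464619845183443257109201430,
    2376990667565872848068486358013484181977442143477555443639141364707270883827444558041400928981150126204597931669722973134460723358125400734701263591281083165398512327859833173852246,
    303590971784371903282288932490242791437778669708670096320470525368613181574523197792328379964361280306223513353776795708924825150035970440946517270582668298070810229461104,
    373898407104497576949561800356056254563296548778277745011791203915664177244229997350517854626273293702402351685534145792424985317355371008835878773791423546210617064705802326,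
    2868311444008841049593651030845873874863594865651865936084793841342161712922701275371152524626181812984561590338479081709482854724023531602482955510786942551102322581464265213002398,
    604730802848440055915345406629916945234301978094081437406586947775979949969029150962311393481920203386842528715820328287673843371246973090645593397405450049933966237979089436750,
    373905641703047650748331891826566232597294497434952054451507505211182788765830788895002204726659174783649958234690862807631929749039660723154520654584118925095854713294848086,
    295290627611322971030105865399605819833945970363426113026271999324443969655690907473745877155160742681304174175516335533991386787933536708261759158596555442993723154492473878,
    2874401729722211732177619778699035238878480178140243518758467521256133907507313841906942501690227447221996337174497271194189239426611569207415917629180351304146631887833036184832102,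
    2802315780118935405359013930090245126550638004767765390205739486253848324814631621997460496570515747247993803615276678160846305091974770535147807983005261669207084808224398037064,
    2375977547387187906264599261551024443456126590347265300988189295317210935340526847727816564201649488809229010626755564400291906624990850213997657859117135924594930134415886274172252,
    2291336212912430006875988123448616733358439277827172505323710312821856717172389005545721991764587432268030571612405104561359775006281336487142247629247581801632012946225998581816,
    2418931423526970014697992634920814062554086317075973569734927386806129529282759806299600245749462039603285702359181145017146753135562212879489490646932207034503605456430124171934,
    279704102216275188023440055735864538954035972145188505067786443402275242284619929701182239097949630597325610968557768997264661431936964794050373154055653537220633761542357078,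
    3213548731392917587626082197415935026694230256805042601274997432047618188083144759347815577541713428814395043214723406473584378496559417661959234519822833258634368915387812002586142,
    732440038602372132154680198425532041139671367607934874794046786845875373749329914228943916640871909477114455120077174777260707531758225292138135659615361128629847006838566142030,
    373173728922646630085207722142435099818670869977434250340431082688867264050610308034569744818249625092692757912198382805849916154815430819738707456303183877563594610415146332,
    2759610389943286162644048190889652591853980330386602318185316614711475903950199984473166748274894320484269875717189923125732559920319755426122267424863909413859743978338827943264926,
    303590966105586293536616011250146200916784876253115541083189059745867593829267968082101677930388713426138302090193629903353867651233702226936100822779419995123173566917128,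
    2874401745066553269873143138765801814177499875047384250711304192657103429707853658576168769339561968593170381459820900196132444661552944477327840900783994871869771694328458195995758,
    2546705654638156422790684417281608596975126282880230741520796925211763432923689425955856120836286966010158177417147904673435752519529942756245857708454490119250993994914750189680,
    2874401729722211732177619778699036849700733629576232587991648216912741429585414471181546083808554060919161716868752545583723865172965759039692175333258315704260742767519877555060822,
    2674390487895267124900300199069448823618403165363456273277400335602921784639668974268570959143486655097153772623732601697332149330899116127218193837769672093090385430573566054488,
    2371925286089452561805365815090587697579175713034987715689398225517229991818298906419753838533762994102980628463471090814881837882507075764573604729142432767139236839285063590072438,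
    375345644298300653994630149377667778701948781568924281306255993747628779250009614843564562134502952328437890317480046871055146122583125984568672022991541603376678989318049864,
    717077865408942437883028622209472081522504247684453012653995897233514716365761372241284598908301939171626510700898367662561977084482585312843433015148594702357553474533115410105926,
    6217181638895557636746226902256031779672779578088611157497284082229932569682542954519124770673207478725861267064701080004941063100419042395553447202929828142828124917702582326390,
    2744729454066773039051559392273873834286151894564089468722402922945988894936666367927333856459469597995643045413457162295348141864626875768984237782072615598961932422816546003552350,
    2475440668270227375834560503615560434043857936924108708461796980547569387312231111429753431753832747016730720154735285755472617976138092483754264980460528404816144550258042327352,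
    341929369449843722477350360986053938144921188344431174019833732100365980011460189590449200715420819827729888618615932906070682318039115008540590613862130945218762443129471638,
    2874401744945727476346207817531584257231699513692635903544562037065824324200497971066753969185100495828700418680497981685545111502847519484356124076052595943597337579423555297460302,
    286712114508934547338556037498149077956403018857823696651644080623130473334610798416129224461074276375799978340671964115850089301818465384609297540259758302373884694109443420,
    2355716319653509981995414234991799153177709075120744649298659159297670783687989277434834147199381874077186803337213660948106413167586486405708962629526557023418516938662785276198982,
    204782256896194882108277094465979864232024917988359133025856260083990499241625549730023701991073963287556078474497170963204428611563391062820673729235669853857492105517444083832156,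
    114581688920955244889589318770102437601232952256458695330967466483801]⟩

noncomputable def certsFifteen : List Cert :=
  [certFifteen0]

theorem checkFifteen : checkAll insFifteen (fun l => Nat.beq l 0) certsFifteen = true := by decide +kernel

noncomputable def insSeventeen : Ins :=
  ⟨19, 8, 2, 8, 3, false, 9, 262141, [67, 133, 199, 265, 331, 397, 463, 529, 50]⟩

noncomputable def certSeventeen0 : Cert := ⟨[67, 133, 199, 265, 331, 397, 463, 529, 50], 1,
   [311594639202952173249742141531884990444497394104420224376445530286046436575383956916743913055502737563799174224995816751880822631740506729422365575210290665681862547881236365312001,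
    1593764097398668367164959582633403131243611528943822733982886235711083134035799815661486016205365521130360043286688957676123113033033804098774451883744766085959299744497008683,
    21949489385017977039347776433401037288121222817551354033498398148774983591459575888561268984958214956197014332587599020657]⟩

noncomputable def certsSeventeen : List Cert :=
  [certSeventeen0]

theorem checkSeventeen : checkAll insSeventeen (fun l => Nat.beq l 0) certsSeventeen = true := by decide +kernel

end Folkman

namespace Folkman

/-! ### Alternating paths from maximum independent sets -/

theorem Step.reverse {P : Ins} {G : SimpleGraph ℕ} {u v : ℕ} (h : Step P G 0 u v) :
    Step P G 0 (mate v) (mate u) := by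
  obtain ⟨h1, h2, h3, -⟩ := h
  exact ⟨h2, by rwa [mate_mate], by rw [mate_mate]; exact h3.symm, Nat.zero_testBit _⟩

theorem Path.reverse {P : Ins} {G : SimpleGraph ℕ} {u v : ℕ} (h : Path P G 0 u v) :
    Path P G 0 (mate v) (mate u) := by
  induction h with
  | refl => exact .refl
  | tail _ hs ih => exact .head hs.reverse ih

theorem path_of_cliques {P : Ins} {G : SimpleGraph ℕ} (hG : Hyp P G) (hNP : P.NP = P.F + 1)
    {l : ℕ} (hl : P.N.testBit l = true) (cs : List (Finset ℕ)) (hlen : cs.length = P.K)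
    (hcl : ∀ C ∈ cs, G.IsClique (C : Set ℕ))
    (hcov : ∀ v < P.n, (∀ C ∈ cs, v ∉ C) → P.N.testBit v = true ∧ v / 2 ≠ l / 2)
    (hlt : ∀ v, P.N.testBit v = true → v < 2 * P.NP)
    (hpair : ∀ v, P.N.testBit v = true → v / 2 ≠ l / 2 →
      P.N.testBit (mate v) = true ∧ G.Adj v (mate v)) : Path P G 0 l (mate l) := by
  classical
  by_contra hno
  obtain ⟨S, hSn, hSi, hSc, hSd⟩ := hG.rob cs hlen hcl
  have hS : ∀ v ∈ S, P.N.testBit v = true ∧ v / 2 ≠ l / 2 := fun v hv =>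
    hcov v (Finset.mem_range.1 (hSn hv)) fun C hC => Finset.disjoint_left.1 (hSd C hC) hv
  have hstep : ∀ u v, Path P G 0 l u → P.N.testBit u = true → P.N.testBit v = true →
      G.Adj u v → Path P G 0 l (mate v) := fun u v hu h1 h2 h3 =>
    .tail hu ⟨h1, by rwa [mate_mate], by rwa [mate_mate], Nat.zero_testBit _⟩
  have hmate : ∀ v, Path P G 0 l v → ¬ Path P G 0 l (mate v) := by
    intro v h1 h2
    have h3 := h1.reverse
    exact hno (h2.trans h3)
  set T : Finset ℕ := (Finset.range (2 * P.NP)).filter fun v => P.N.testBit v = true ∧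
    (Path P G 0 l v ∨ v ∈ S ∧ ¬ Path P G 0 l (mate v)) with hT
  have hTm : ∀ v, v ∈ T ↔ P.N.testBit v = true ∧
      (Path P G 0 l v ∨ v ∈ S ∧ ¬ Path P G 0 l (mate v)) := by
    intro v
    rw [hT, Finset.mem_filter, Finset.mem_range]
    exact ⟨fun h => h.2, fun h => ⟨hlt v h.1, h⟩⟩
  have hTi : G.IsIndepSet (T : Set ℕ) := by
    intro u hu v hv _ huv
    obtain ⟨hu1, hu2⟩ := (hTm u).1 hu
    obtain ⟨hv1, hv2⟩ := (hTm v).1 hv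
    rcases hu2 with hu2 | ⟨hu2, hu3⟩
    · rcases hv2 with hv2 | ⟨hv2, hv3⟩
      · exact hmate v hv2 (hstep u v hu2 hu1 hv1 huv)
      · exact hv3 (hstep u v hu2 hu1 hv1 huv)
    · rcases hv2 with hv2 | ⟨hv2, hv3⟩
      · exact hu3 (hstep v u hv2 hv1 hu1 huv.symm)
      · exact hSi hu2 hv2 huv.ne huv
  have hle := hG.pairs T (fun v hv => ((hTm v).1 hv).1) hTi
  have hSinj : Set.InjOn (fun v => v / 2) (S : Set ℕ) := by
    intro u hu v hv huv
    rcases eq_or_eq_mate huv with h | h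
    · exact h
    · subst h
      exact absurd (hpair v (hS v hv).1 (hS v hv).2).2.symm (hSi hu hv (mate_ne v))
  have hSimg : S.image (fun v => v / 2) = (Finset.range P.NP).erase (l / 2) := by
    apply Finset.eq_of_subset_of_card_le
    · intro i hi
      obtain ⟨v, hv, rfl⟩ := Finset.mem_image.1 hi
      have := hlt v (hS v hv).1
      exact Finset.mem_erase.2 ⟨(hS v hv).2, Finset.mem_range.2 (by omega)⟩
    · rw [Finset.card_image_of_injOn hSinj, hSc, Finset.card_erase_of_mem, Finset.card_range, hNP]
      · omega
      · have := hlt l hl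
        exact Finset.mem_range.2 (by omega)
  have hTimg : Finset.range P.NP ⊆ T.image (fun v => v / 2) := by
    intro i hi
    by_cases hil : i = l / 2
    · exact Finset.mem_image.2 ⟨l, (hTm l).2 ⟨hl, Or.inl .refl⟩, hil.symm⟩
    · have : i ∈ S.image (fun v => v / 2) := by
        rw [hSimg]; exact Finset.mem_erase.2 ⟨hil, hi⟩
      obtain ⟨v, hv, rfl⟩ := Finset.mem_image.1 this
      by_cases hm : Path P G 0 l (mate v)
      · exact Finset.mem_image.2 ⟨mate v, (hTm _).2
          ⟨(hpair v (hS v hv).1 (hS v hv).2).1, Or.inl hm⟩, mate_div v⟩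
      · exact Finset.mem_image.2 ⟨v, (hTm v).2 ⟨(hS v hv).1, Or.inr ⟨hv, hm⟩⟩, rfl⟩
  have := (Finset.card_le_card hTimg).trans Finset.card_image_le
  rw [Finset.card_range] at this
  omega

/-! ### The configurations excluded by the certificates -/

theorem adj_of_mem {G : SimpleGraph ℕ} {l : List ℕ} (h : ∀ e ∈ l, G.Adj (hi e) (lo e)) {a b : ℕ}
    (hb : b < 32) (hm : 32 * a + b ∈ l) : G.Adj a b := by
  have := h _ hm
  rwa [(hi_lo a b hb).1, (hi_lo a b hb).2] at this

theorem refuted_of_last {P : Ins} {okl : ℕ → Bool} {cs : List Cert} {c : Cert} (hP : P.Valid)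
    (hp : HasPaths P okl) (hcs : ∀ c ∈ cs, ∀ e ∈ c.edges, e < 1024)
    (h : checkAll P okl cs = true) (hc : c ∈ cs) (hm : ∀ e ∈ c.edges, e ∈ P.mx)
    {G : SimpleGraph ℕ} (hG : Hyp P G) : ¬ ∀ e ∈ P.mx, G.Adj (hi e) (lo e) := fun hadj =>
  checkAll_sound hP hp (fun c hc e he => by
    have := hcs c hc e he
    have e1 : hi e = e >>> 5 := rfl
    rw [e1, Nat.shiftRight_eq_div_pow]; omega) h c hc G hG fun e he => hadj e (hm e he)

theorem testBit_lt {N k v : ℕ} (hN : N < 2 ^ k) (h : N.testBit v = true) : v < k := by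
  by_contra hv
  rw [Nat.testBit_lt_two_pow (hN.trans_le (Nat.pow_le_pow_right (by norm_num) (not_lt.1 hv)))] at h
  cases h

theorem valid_insBase : insBase.Valid where
  n_le := by decide
  N_lt v h := (testBit_lt (k := 16) (by decide) h).trans (by decide)
  N_lt' v h := testBit_lt (k := 16) (by decide) h
  NP_le := by decide

theorem hasPaths_insBase : HasPaths insBase (fun l => Nat.blt l 16) := by
  intro G hG he l hl
  have hl := lt_of_blt hl
  have hpair : ∀ v < 16, G.Adj v (mate v) := by
    intro v hv
    rw [mate_eq]
    split_ifs with h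
    · exact (adj_of_mem he (by omega) (by interval_cases v <;> revert h <;> decide)).symm
    · exact adj_of_mem he (by omega) (by interval_cases v <;> revert h <;> decide)
  have hN : ∀ v < 16, insBase.N.testBit v = true := by decide
  have hlt : ∀ v, insBase.N.testBit v = true → v < 16 := fun v h => testBit_lt (by decide) h
  refine path_of_cliques hG rfl (hN l hl) [{16, 17}, {l, mate l}] rfl ?_ ?_ hlt ?_
  · have h1 : G.Adj 16 17 := adj_of_mem he (by decide) (by decide)
    have h2 := hpair l hl
    simp only [List.mem_cons, List.not_mem_nil, or_false, forall_eq_or_imp, forall_eq,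
      Finset.coe_pair, SimpleGraph.isClique_pair]
    exact ⟨fun _ => h1, fun _ => h2⟩
  · intro v hv hC
    have hv : v < 18 := hv
    simp only [List.mem_cons, List.not_mem_nil, or_false, forall_eq_or_imp, forall_eq,
      Finset.mem_insert, Finset.mem_singleton, not_or] at hC
    refine ⟨hN v (by omega), fun h => ?_⟩
    rcases eq_or_eq_mate h with h | h
    exacts [hC.2.1 h, hC.2.2 h]
  · intro v hv _
    have := hlt v hv
    exact ⟨hN _ (by have := mate_div v; omega), hpair v this⟩

theorem not_base {G : SimpleGraph ℕ} (hG : Hyp insBase G) :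
    ¬ ∀ e ∈ insBase.mx, G.Adj (hi e) (lo e) :=
  refuted_of_last (c := certBase33) valid_insBase hasPaths_insBase (by decide) checkBase
    (by simp [certsBase]) (by decide) hG

theorem hasPaths_of_zero {P : Ins} (h0 : P.N.testBit 0 = true) (hNP : P.NP = P.F + 1)
    (cs : List (Finset ℕ)) (hlen : cs.length = P.K)
    (hcl : ∀ G : SimpleGraph ℕ, (∀ e ∈ P.mx, G.Adj (hi e) (lo e)) →
      ∀ C ∈ cs, G.IsClique (C : Set ℕ))
    (hcov : ∀ v < P.n, (∀ C ∈ cs, v ∉ C) → P.N.testBit v = true ∧ 2 ≤ v)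
    (hlt : ∀ v, P.N.testBit v = true → v < 2 * P.NP)
    (hmx : ∀ v < 2 * P.NP, 2 ≤ v → P.N.testBit v = true ∧
      (v % 2 = 0 → 32 * v + (v + 1) ∈ P.mx)) (hNP' : P.NP ≤ 16) :
    HasPaths P (fun l => Nat.beq l 0) := by
  intro G hG he l hl
  have hl : l = 0 := Nat.eq_of_beq_eq_true hl
  subst hl
  refine path_of_cliques hG hNP h0 cs hlen (hcl G he) (fun v hv hC => ?_) hlt fun v hv hv2 => ?_
  · have := hcov v hv hC
    exact ⟨this.1, by omega⟩
  · have hvlt := hlt v hv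
    have hm : 2 ≤ mate v ∧ mate v < 2 * P.NP := by have := mate_div v; omega
    refine ⟨(hmx _ hm.2 hm.1).1, ?_⟩
    have hv2 : 2 ≤ v := by omega
    rcases Nat.mod_two_eq_zero_or_one v with h | h
    · rw [mate_eq, if_neg (by omega)]
      exact adj_of_mem he (by omega) ((hmx v hvlt hv2).2 h)
    · have e : v = mate v + 1 := by rw [mate_eq, if_pos h]; omega
      have := adj_of_mem he (a := mate v) (by omega) ((hmx _ hm.2 hm.1).2 (by omega))
      rw [← e] at this
      exact this.symm

theorem valid_insTri : insTri.Valid where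
  n_le := by decide
  N_lt v h := (testBit_lt (k := 16) (by decide) h).trans (by decide)
  N_lt' v h := testBit_lt (k := 16) (by decide) h
  NP_le := by decide

theorem not_tri {G : SimpleGraph ℕ} (hG : Hyp insTri G) :
    ¬ ∀ e ∈ insTri.mx, G.Adj (hi e) (lo e) := by
  refine refuted_of_last (c := certTri0) valid_insTri (hasPaths_of_zero (by decide) rfl
    [{1, 16, 17}, {0}] rfl (fun G he => ?_) (by decide) valid_insTri.N_lt' (by decide) (by decide))
    (by decide) checkTri (by simp [certsTri]) (by decide) hG
  have h1 : G.Adj 1 16 := adj_of_mem he (by decide) (by decide)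
  have h2 : G.Adj 16 17 := adj_of_mem he (by decide) (by decide)
  have h3 : G.Adj 1 17 := adj_of_mem he (by decide) (by decide)
  simp [SimpleGraph.isClique_insert, h1, h2, h3]

theorem valid_insFifteen : insFifteen.Valid where
  n_le := by decide
  N_lt v h := (testBit_lt (k := 16) (by decide) h).trans (by decide)
  N_lt' v h := testBit_lt (k := 16) (by decide) h
  NP_le := by decide

theorem not_fifteen {G : SimpleGraph ℕ} (hG : Hyp insFifteen G) :
    ¬ ∀ e ∈ insFifteen.mx, G.Adj (hi e) (lo e) := by
  refine refuted_of_last (c := certFifteen0) valid_insFifteen (hasPaths_of_zero (by decide) rfl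
    [{16, 17}, {1, 18}, {0}] rfl (fun G he => ?_) (by decide) valid_insFifteen.N_lt' (by decide)
    (by decide)) (by decide) checkFifteen (by simp [certsFifteen]) (by decide) hG
  have h1 : G.Adj 16 17 := adj_of_mem he (by decide) (by decide)
  have h2 : G.Adj 1 18 := adj_of_mem he (by decide) (by decide)
  simp [SimpleGraph.isClique_insert, h1, h2]

theorem valid_insSeventeen : insSeventeen.Valid where
  n_le := by decide
  N_lt v h := (testBit_lt (k := 18) (by decide) h).trans (by decide)
  N_lt' v h := testBit_lt (k := 18) (by decide) h
  NP_le := by decide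

theorem not_seventeen {G : SimpleGraph ℕ} (hG : Hyp insSeventeen G) :
    ¬ ∀ e ∈ insSeventeen.mx, G.Adj (hi e) (lo e) := by
  refine refuted_of_last (c := certSeventeen0) valid_insSeventeen (hasPaths_of_zero (by decide) rfl
    [{1, 18}, {0}] rfl (fun G he => ?_) (by decide) valid_insSeventeen.N_lt' (by decide)
    (by decide)) (by decide) checkSeventeen (by simp [certsSeventeen]) (by decide) hG
  have h2 : G.Adj 1 18 := adj_of_mem he (by decide) (by decide)
  simp [SimpleGraph.isClique_insert, h2]

end Folkman

namespace Folkman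

/-! ### Independent sets after the deletion of cliques -/

section

variable {H : SimpleGraph ℕ}

/-- Independent subsets of `W` have at most `k` elements. -/
def AlphaLe (H : SimpleGraph ℕ) (W : Finset ℕ) (k : ℕ) : Prop :=
  ∀ S ⊆ W, H.IsIndepSet (S : Set ℕ) → S.card ≤ k

/-- After the deletion of any `r` cliques, `W` contains an independent set of size `k`. -/
def Robust (H : SimpleGraph ℕ) (W : Finset ℕ) (r k : ℕ) : Prop :=
  ∀ L : List (Finset ℕ), L.length = r → (∀ C ∈ L, H.IsClique (C : Set ℕ)) →
    ∃ S ⊆ W, H.IsIndepSet (S : Set ℕ) ∧ S.card = k ∧ ∀ C ∈ L, Disjoint S C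

open Classical in
/-- The neighbours in `W` of the vertices in `A`. -/
noncomputable def nb (H : SimpleGraph ℕ) (W A : Finset ℕ) : Finset ℕ :=
  W.filter fun v => ∃ a ∈ A, H.Adj a v

theorem mem_nb {W A : Finset ℕ} {v : ℕ} : v ∈ nb H W A ↔ v ∈ W ∧ ∃ a ∈ A, H.Adj a v := by
  classical
  unfold nb
  rw [Finset.mem_filter]

theorem nb_mono {W W' A A' : Finset ℕ} (hW : W ⊆ W') (hA : A ⊆ A') : nb H W A ⊆ nb H W' A' := by
  intro v hv
  obtain ⟨h1, a, ha, h2⟩ := mem_nb.1 hv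
  exact mem_nb.2 ⟨hW h1, a, hA ha, h2⟩

theorem indep_mono {S T : Finset ℕ} (h : H.IsIndepSet (T : Set ℕ)) (hST : S ⊆ T) :
    H.IsIndepSet (S : Set ℕ) :=
  Set.Pairwise.mono (by exact_mod_cast hST) h

theorem indep_union {S T : Finset ℕ} (hS : H.IsIndepSet (S : Set ℕ))
    (hT : H.IsIndepSet (T : Set ℕ)) (h : ∀ a ∈ S, ∀ b ∈ T, ¬ H.Adj a b) :
    H.IsIndepSet ((S ∪ T : Finset ℕ) : Set ℕ) := by
  intro a ha b hb hab hadj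
  rw [Finset.mem_coe, Finset.mem_union] at ha hb
  rcases ha with ha | ha <;> rcases hb with hb | hb
  exacts [hS ha hb hab hadj, h a ha b hb hadj, h b hb a ha hadj.symm, hT ha hb hab hadj]

theorem disjoint_nb {W A : Finset ℕ} (hA : H.IsIndepSet (A : Set ℕ)) : Disjoint A (nb H W A) := by
  rw [Finset.disjoint_left]
  intro v hv hv'
  obtain ⟨-, a, ha, hadj⟩ := mem_nb.1 hv'
  exact hA ha hv hadj.ne hadj

theorem clique_singleton (v : ℕ) : H.IsClique (({v} : Finset ℕ) : Set ℕ) := by simp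

theorem clique_empty : H.IsClique ((∅ : Finset ℕ) : Set ℕ) := by simp

theorem clique_pair {x y : ℕ} (h : H.Adj x y) : H.IsClique (({x, y} : Finset ℕ) : Set ℕ) := by
  rw [Finset.coe_pair, SimpleGraph.isClique_pair]
  exact fun _ => h

theorem AlphaLe.mono {W W' : Finset ℕ} {k k' : ℕ} (h : AlphaLe H W k) (hW : W' ⊆ W)
    (hk : k ≤ k') : AlphaLe H W' k' := fun S hS hi => (h S (hS.trans hW) hi).trans hk

/-- Deleting some of the cliques beforehand. -/
theorem Robust.sdiff {W : Finset ℕ} {r k : ℕ} (h : Robust H W (r + 1) k) {C : Finset ℕ}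
    (hC : H.IsClique (C : Set ℕ)) : Robust H (W \ C) r k := by
  intro L hl hL
  obtain ⟨S, hS, hi, hc, hd⟩ := h (C :: L) (by simp [hl]) (by
    intro D hD
    rcases List.mem_cons.1 hD with rfl | hD
    exacts [hC, hL D hD])
  exact ⟨S, Finset.subset_sdiff.2 ⟨hS, hd C (by simp)⟩, hi, hc, fun D hD => hd D (by simp [hD])⟩

theorem Robust.pred {W : Finset ℕ} {r k : ℕ} (h : Robust H W (r + 1) k) : Robust H W r k := by
  simpa using h.sdiff (C := ∅) clique_empty

theorem Robust.one {W : Finset ℕ} {k : ℕ} (h : Robust H W 1 k) {C : Finset ℕ}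
    (hC : H.IsClique (C : Set ℕ)) :
    ∃ S ⊆ W, H.IsIndepSet (S : Set ℕ) ∧ S.card = k ∧ Disjoint S C := by
  obtain ⟨S, h1, h2, h3, h4⟩ := h [C] rfl (by simpa using hC)
  exact ⟨S, h1, h2, h3, h4 C (by simp)⟩

theorem exists_matching {A : Finset ℕ} (t : ℕ → Finset ℕ)
    (h : ∀ B ⊆ A, B.card ≤ (B.biUnion t).card) :
    ∃ f : ℕ → ℕ, Set.InjOn f A ∧ ∀ a ∈ A, f a ∈ t a := by
  classical
  have := (Finset.all_card_le_biUnion_card_iff_exists_injective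
    (fun a : (A : Set ℕ) => t a)).1 (by
      intro s
      have h' := h (s.image Subtype.val) (by
        intro x hx
        obtain ⟨y, -, rfl⟩ := Finset.mem_image.1 hx
        exact y.2)
      rwa [Finset.card_image_of_injective _ Subtype.val_injective, Finset.image_biUnion] at h')
  obtain ⟨f, hf, hf'⟩ := this
  refine ⟨fun a => if ha : a ∈ A then f ⟨a, ha⟩ else 0, ?_, ?_⟩
  · intro a ha b hb hab
    rw [Finset.mem_coe] at ha hb
    simp only [ha, hb, dif_pos] at hab
    exact congrArg Subtype.val (hf hab)
  · intro a ha
    simp only [ha, dif_pos]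
    exact hf' ⟨a, ha⟩

/-- A matching of `A` into `R`, from Hall's condition. -/
theorem exists_matching_nb {A R : Finset ℕ} (h : ∀ B ⊆ A, B.card ≤ (nb H R B).card) :
    ∃ f : ℕ → ℕ, Set.InjOn f A ∧ ∀ a ∈ A, f a ∈ R ∧ H.Adj a (f a) := by
  obtain ⟨f, hf, hf'⟩ := exists_matching (A := A) (fun a => nb H R {a}) (by
    intro B hB
    refine (h B hB).trans (Finset.card_le_card ?_)
    intro v hv
    obtain ⟨h1, b, hb, h2⟩ := mem_nb.1 hv
    exact Finset.mem_biUnion.2 ⟨b, hb, mem_nb.2 ⟨h1, b, by simp, h2⟩⟩)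
  refine ⟨f, hf, fun a ha => ?_⟩
  have := mem_nb.1 (hf' a ha)
  simpa using this

/-- A set with a unique clique-deletion property has the expansion property of
`2`-bicritical graphs. -/
theorem card_lt_card_nb {W : Finset ℕ} {p : ℕ} (ha : AlphaLe H W p) (hr : Robust H W 1 p) :
    ∀ (n : ℕ) (A : Finset ℕ), A.card = n → A ⊆ W → A.Nonempty → H.IsIndepSet (A : Set ℕ) →
      A.card + 1 ≤ (nb H W A).card := by
  intro n
  induction n using Nat.strong_induction_on with
  | _ n ih =>
    intro A hAn hAW hAne hA
    by_contra hcon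
    obtain ⟨a0, ha0⟩ := hAne
    have hhall : ∀ B ⊆ A, B.card ≤ (nb H (nb H W A) B).card := by
      intro B hB
      have hsub : nb H W B ⊆ nb H (nb H W A) B := fun v hv =>
        mem_nb.2 ⟨nb_mono subset_rfl hB hv, (mem_nb.1 hv).2⟩
      refine le_trans ?_ (Finset.card_le_card hsub)
      rcases B.eq_empty_or_nonempty with rfl | hBne
      · simp
      rcases eq_or_ne B A with rfl | hBA
      · rcases (B.erase a0).eq_empty_or_nonempty with he | he
        · have hB1 : B = {a0} := by
            rw [← Finset.insert_erase ha0, he]; rfl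
          rw [hB1, Finset.card_singleton]
          by_contra h0
          have h0 : nb H W {a0} = ∅ := Finset.card_eq_zero.1 (by omega)
          obtain ⟨S, hS, hi, hc, hd⟩ := hr.one (clique_singleton a0)
          have := ha ({a0} ∪ S) (Finset.union_subset (by simpa using hAW ha0) hS)
            (indep_union (by simp) hi (by
              intro a ha b hb hab
              have : b ∈ nb H W {a0} := mem_nb.2 ⟨hS hb, a, ha, hab⟩
              rw [h0] at this
              simp at this))
          rw [Finset.card_union_of_disjoint hd.symm, Finset.card_singleton] at this
          omega
        · have hc := Finset.card_erase_of_mem ha0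
          have hpos := Finset.card_pos.2 ⟨a0, ha0⟩
          have := ih _ (by omega) (B.erase a0) rfl
            ((Finset.erase_subset _ _).trans hAW) he (indep_mono hA (Finset.erase_subset _ _))
          have := Finset.card_le_card (nb_mono (H := H) (subset_refl W) (B.erase_subset a0))
          omega
      · have := ih _ (hAn ▸ Finset.card_lt_card (hB.ssubset_of_ne hBA)) B rfl (hB.trans hAW) hBne
          (indep_mono hA hB)
        omega
    obtain ⟨f, hf, hf'⟩ := exists_matching_nb hhall
    obtain ⟨S, hS, hi, hc, hd⟩ := hr.one (clique_pair (hf' a0 ha0).2)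
    have himg : A.image f = nb H W A := by
      refine Finset.eq_of_subset_of_card_le ?_ ?_
      · intro v hv
        obtain ⟨a, ha, rfl⟩ := Finset.mem_image.1 hv
        exact (hf' a ha).1
      · rw [Finset.card_image_of_injOn hf]; omega
    have hT := ha (S \ nb H W A ∪ A) (Finset.union_subset (Finset.sdiff_subset.trans hS) hAW)
      (indep_union (indep_mono hi Finset.sdiff_subset) hA (by
        intro v hv a ha hva
        rw [Finset.mem_sdiff] at hv
        exact hv.2 (mem_nb.2 ⟨hS hv.1, a, ha, hva.symm⟩)))
    have hU : (S ∩ (A ∪ nb H W A)).card ≤ (A.erase a0).card := by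
      classical
      refine Finset.card_le_card_of_injOn (fun v => if v ∈ A then v else
        Function.invFunOn f A v) ?_ ?_
      · intro v hv
        rw [Finset.mem_coe, Finset.mem_inter, Finset.mem_union] at hv
        rw [Finset.mem_coe, Finset.mem_erase]
        have hd' := Finset.disjoint_left.1 hd hv.1
        simp only [Finset.mem_insert, Finset.mem_singleton, not_or] at hd'
        by_cases hvA : v ∈ A
        · simp only [hvA, if_true]; exact ⟨hd'.1, trivial⟩
        · simp only [hvA, if_false]
          have hv2 : v ∈ f '' A := by
            have := hv.2.resolve_left hvA
            rw [← himg] at this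
            simpa using this
          refine ⟨fun h => hd'.2 ?_, Function.invFunOn_mem hv2⟩
          rw [← h, Function.invFunOn_eq hv2]
      · have key : ∀ u ∈ S, ∀ v ∈ S, u ∈ A → v ∉ A → v ∈ A ∪ nb H W A →
            u ≠ Function.invFunOn f A v := by
          intro u hu v hv huA hvA hv2 h
          have hv2 : v ∈ f '' A := by
            have := (Finset.mem_union.1 hv2).resolve_left hvA
            rw [← himg] at this
            simpa using this
          have hfu : f u = v := by rw [h]; exact Function.invFunOn_eq hv2
          have := (hf' u huA).2
          rw [hfu] at this
          exact hi hu hv this.ne this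
        intro u hu v hv huv
        rw [Finset.mem_coe, Finset.mem_inter] at hu hv
        by_cases huA : u ∈ A <;> by_cases hvA : v ∈ A
        · simpa [huA, hvA] using huv
        · simp only [huA, hvA, if_true, if_false] at huv
          exact absurd huv (key u hu.1 v hv.1 huA hvA hv.2)
        · simp only [huA, hvA, if_true, if_false] at huv
          exact absurd huv.symm (key v hv.1 u hu.1 hvA huA hu.2)
        · simp only [huA, hvA, if_false] at huv
          have : ∀ w, w ∈ A ∪ nb H W A → w ∉ A → f (Function.invFunOn f A w) = w := by
            intro w hw hwA
            refine Function.invFunOn_eq (s := (A : Set ℕ)) ?_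
            have := (Finset.mem_union.1 hw).resolve_left hwA
            rw [← himg] at this
            simpa using this
          rw [← this u hu.2 huA, huv, this v hv.2 hvA]
    have h1 : Disjoint (S \ (A ∪ nb H W A)) A := by
      rw [Finset.disjoint_left]
      intro v hv hvA
      exact (Finset.mem_sdiff.1 hv).2 (Finset.mem_union_left _ hvA)
    have h2 : S \ (A ∪ nb H W A) ∪ A ⊆ S \ nb H W A ∪ A :=
      Finset.union_subset_union_left (Finset.sdiff_subset_sdiff subset_rfl
        Finset.subset_union_right)
    have h3 := Finset.card_le_card h2
    rw [Finset.card_union_of_disjoint h1] at h3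
    have h4 := Finset.card_sdiff_add_card_inter S (A ∪ nb H W A)
    have h5 := Finset.card_erase_of_mem ha0
    have h6 := Finset.card_pos.2 ⟨a0, ha0⟩
    omega

theorem AlphaLe.expand {W A : Finset ℕ} {p : ℕ} (ha : AlphaLe H W p) (hr : Robust H W 1 p)
    (hA : A ⊆ W) (hne : A.Nonempty) (hi : H.IsIndepSet (A : Set ℕ)) :
    A.card + 1 ≤ (nb H W A).card :=
  card_lt_card_nb ha hr _ A rfl hA hne hi

theorem AlphaLe.expand_two {W A : Finset ℕ} {p : ℕ} (ha : AlphaLe H W p) (hr : Robust H W 2 p)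
    (hA : A ⊆ W) (hne : A.Nonempty) (hi : H.IsIndepSet (A : Set ℕ)) :
    A.card + 2 ≤ (nb H W A).card := by
  have h1 := ha.expand hr.pred hA hne hi
  obtain ⟨c, hc⟩ := Finset.card_pos.1 (show 0 < (nb H W A).card by omega)
  have hcA : c ∉ A := fun h => Finset.disjoint_left.1 (disjoint_nb hi) h hc
  have h2 := (ha.mono (W' := W \ {c}) Finset.sdiff_subset le_rfl).expand
    (hr.sdiff (clique_singleton c)) (A := A)
    (Finset.subset_sdiff.2 ⟨hA, by simpa using hcA⟩) hne hi
  have h3 : nb H (W \ {c}) A ⊆ (nb H W A).erase c := by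
    intro v hv
    obtain ⟨h4, h5⟩ := mem_nb.1 hv
    rw [Finset.mem_sdiff, Finset.mem_singleton] at h4
    exact Finset.mem_erase.2 ⟨h4.2, mem_nb.2 ⟨h4.1, h5⟩⟩
  have := Finset.card_le_card h3
  rw [Finset.card_erase_of_mem hc] at this
  omega

theorem AlphaLe.two_mul_lt {W : Finset ℕ} {p : ℕ} (ha : AlphaLe H W p) (hr : Robust H W 1 p)
    (hp : 0 < p) : 2 * p + 1 ≤ W.card := by
  obtain ⟨S, hS, hi, hc, -⟩ := hr.one clique_empty
  have h1 := ha.expand hr hS (Finset.card_pos.1 (by omega)) hi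
  have h2 := Finset.card_le_card (Finset.union_subset hS
    (show nb H W S ⊆ W from fun v hv => (mem_nb.1 hv).1))
  rw [Finset.card_union_of_disjoint (disjoint_nb hi)] at h2
  omega

/-! ### Perfect matchings -/

/-- `W` has a perfect matching. -/
inductive PM (H : SimpleGraph ℕ) : Finset ℕ → Prop
  | nil : PM H ∅
  | cons {W : Finset ℕ} {x y : ℕ} : H.Adj x y → x ∉ W → y ∉ W → PM H W →
      PM H (insert x (insert y W))

theorem PM.union {A B : Finset ℕ} (hA : PM H A) (hB : PM H B) (hd : Disjoint A B) :
    PM H (A ∪ B) := by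
  induction hA with
  | nil => simpa using hB
  | cons hxy hx hy _ ih =>
    rw [Finset.disjoint_insert_left, Finset.disjoint_insert_left] at hd
    rw [Finset.insert_union, Finset.insert_union]
    refine .cons hxy ?_ ?_ (ih hd.2.2)
    · simp [hx, hd.1]
    · simp [hy, hd.2.1]

theorem pm_pair {x y : ℕ} (h : H.Adj x y) : PM H {x, y} := by
  have := PM.cons h (by simp) (by simp) PM.nil
  simpa using this

theorem pm_of_matching {f : ℕ → ℕ} (A : Finset ℕ) : Set.InjOn f A → (∀ a ∈ A, H.Adj a (f a)) →
    Disjoint A (A.image f) → PM H (A ∪ A.image f) := by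
  induction A using Finset.induction_on with
  | empty => intro _ _ _; simpa using PM.nil
  | insert a A ha ih =>
    intro hf hadj hd
    rw [Finset.image_insert, Finset.disjoint_insert_left, Finset.disjoint_insert_right] at hd
    have := ih (hf.mono (by simp)) (fun b hb => hadj b (by simp [hb])) hd.2.2
    rw [Finset.image_insert, Finset.insert_union, Finset.union_insert]
    refine .cons (hadj a (by simp)) ?_ ?_ this
    · rw [Finset.mem_union, not_or]
      exact ⟨ha, fun h => hd.1 (Finset.mem_insert_of_mem h)⟩
    · rw [Finset.mem_union, not_or]
      refine ⟨hd.2.1, fun h => ?_⟩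
      obtain ⟨b, hb, hba⟩ := Finset.mem_image.1 h
      have := hf (by simp [hb]) (by simp) hba
      exact ha (this ▸ hb)

theorem pm_of_hall {U S : Finset ℕ} (hSU : S ⊆ U) (hcard : U.card = 2 * S.card)
    (h : ∀ B ⊆ S, B.Nonempty → B.card ≤ (nb H (U \ S) B).card) : PM H U := by
  obtain ⟨f, hf, hf'⟩ := exists_matching_nb (H := H) (A := S) (R := U \ S) (by
    intro B hB
    rcases B.eq_empty_or_nonempty with rfl | hne
    · simp
    · exact h B hB hne)
  have hd : Disjoint S (S.image f) := by
    rw [Finset.disjoint_right]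
    intro v hv
    obtain ⟨a, ha, rfl⟩ := Finset.mem_image.1 hv
    exact (Finset.mem_sdiff.1 (hf' a ha).1).2
  have hU : S ∪ S.image f = U := by
    refine Finset.eq_of_subset_of_card_le (Finset.union_subset hSU ?_) ?_
    · intro v hv
      obtain ⟨a, ha, rfl⟩ := Finset.mem_image.1 hv
      exact (Finset.mem_sdiff.1 (hf' a ha).1).1
    · rw [Finset.card_union_of_disjoint hd, Finset.card_image_of_injOn hf]; omega
  rw [← hU]
  exact pm_of_matching S hf (fun a ha => (hf' a ha).2) hd

/-- Deleting `j` matching edges. -/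
theorem PM.remove {W : Finset ℕ} (h : PM H W) : ∀ j, 2 * j ≤ W.card →
    ∃ L : List (Finset ℕ), L.length = j ∧ (∀ C ∈ L, H.IsClique (C : Set ℕ)) ∧
      ∀ S : Finset ℕ, H.IsIndepSet (S : Set ℕ) → (∀ C ∈ L, Disjoint S C) →
        2 * ((S ∩ W).card + j) ≤ W.card := by
  induction h with
  | nil =>
    intro j hj
    have : j = 0 := by simpa using hj
    subst this
    exact ⟨[], rfl, by simp, by simp⟩
  | @cons W x y hxy hx hy _ ih =>
    intro j hj
    have hx' : x ∉ insert y W := by simp [hx, hxy.ne]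
    have hc : (insert x (insert y W)).card = W.card + 2 := by
      rw [Finset.card_insert_of_notMem hx', Finset.card_insert_of_notMem hy]
    rw [hc] at hj ⊢
    cases j with
    | zero =>
      obtain ⟨L, hl, -, hL⟩ := ih 0 (by omega)
      have hL0 : L = [] := List.length_eq_zero_iff.1 hl
      subst hL0
      refine ⟨[], rfl, by simp, fun S hS _ => ?_⟩
      have h1 := hL S hS (by simp)
      have h2 : (S ∩ {x, y}).card ≤ 1 := by
        rw [Finset.card_le_one]
        intro u hu v hv
        simp only [Finset.mem_inter, Finset.mem_insert, Finset.mem_singleton] at hu hv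
        by_contra huv
        obtain ⟨hu1, rfl | rfl⟩ := hu <;> obtain ⟨hv1, rfl | rfl⟩ := hv
        · exact huv rfl
        · exact hS hu1 hv1 huv hxy
        · exact hS hu1 hv1 huv hxy.symm
        · exact huv rfl
      have h3 : S ∩ insert x (insert y W) ⊆ (S ∩ {x, y}) ∪ (S ∩ W) := by
        intro v hv
        simp only [Finset.mem_inter, Finset.mem_insert, Finset.mem_union,
          Finset.mem_singleton] at hv ⊢
        tauto
      have := (Finset.card_le_card h3).trans (Finset.card_union_le _ _)
      omega
    | succ j =>
      obtain ⟨L, hl, hc, hL⟩ := ih j (by omega)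
      refine ⟨{x, y} :: L, by simp [hl], ?_, fun S hS hd => ?_⟩
      · intro C hC
        rcases List.mem_cons.1 hC with rfl | hC
        exacts [clique_pair hxy, hc C hC]
      · have h1 := hL S hS (fun C hC => hd C (by simp [hC]))
        have h2 := hd {x, y} (by simp)
        have h3 : S ∩ insert x (insert y W) ⊆ S ∩ W := by
          intro v hv
          have h4 := Finset.disjoint_left.1 h2 (Finset.mem_inter.1 hv).1
          simp only [Finset.mem_inter, Finset.mem_insert, Finset.mem_singleton] at hv h4 ⊢
          tauto
        have := Finset.card_le_card h3
        omega

theorem PM.alpha {W : Finset ℕ} (h : PM H W) {S : Finset ℕ} (hS : H.IsIndepSet (S : Set ℕ)) :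
    2 * (S ∩ W).card ≤ W.card := by
  obtain ⟨L, hl, -, hL⟩ := h.remove 0 (by omega)
  have hL0 : L = [] := List.length_eq_zero_iff.1 hl
  subst hL0
  simpa using hL S hS (by simp)

/-- Adjacent consecutive entries. -/
theorem PM.list {W : Finset ℕ} (h : PM H W) : ∃ l : List ℕ, l.Nodup ∧ l.toFinset = W ∧
    l.length = W.card ∧ ∀ i, 2 * i + 1 < l.length →
      H.Adj (l.getD (2 * i) 0) (l.getD (2 * i + 1) 0) := by
  induction h with
  | nil => exact ⟨[], by simp⟩
  | @cons W x y hxy hx hy _ ih =>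
    obtain ⟨l, h1, h2, h3, h4⟩ := ih
    have hx' : x ∉ insert y W := by simp [hx, hxy.ne]
    refine ⟨x :: y :: l, ?_, by simp [h2], ?_, ?_⟩
    · rw [← h2, List.mem_toFinset] at hx hy
      simp [h1, hx, hy, hxy.ne]
    · rw [Finset.card_insert_of_notMem hx', Finset.card_insert_of_notMem hy]
      simp [h3]
    · intro i hi
      cases i with
      | zero => simpa using hxy
      | succ i =>
        have := h4 i (by simp at hi; omega)
        simpa [Nat.mul_succ] using this

theorem pm_erase {W : Finset ℕ} {p v : ℕ} (ha : AlphaLe H W p) (hr : Robust H W 1 p)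
    (hc : W.card = 2 * p + 1) (hv : v ∈ W) : PM H (W.erase v) := by
  obtain ⟨S, hS, hi, hSc, hd⟩ := hr.one (clique_singleton v)
  have hvS : v ∉ S := by simpa using hd
  have hSW : S ⊆ W.erase v := fun u hu => Finset.mem_erase.2 ⟨fun h => hvS (h ▸ hu), hS hu⟩
  refine pm_of_hall hSW (by rw [Finset.card_erase_of_mem hv]; omega) fun B hB hne => ?_
  have h1 := ha.expand hr (hB.trans hS) hne (indep_mono hi hB)
  have h2 : nb H W B ⊆ insert v (nb H (W.erase v \ S) B) := by
    intro u hu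
    obtain ⟨hu1, b, hb, hbu⟩ := mem_nb.1 hu
    rw [Finset.mem_insert]
    by_cases huv : u = v
    · exact Or.inl huv
    · refine Or.inr (mem_nb.2 ⟨Finset.mem_sdiff.2 ⟨Finset.mem_erase.2 ⟨huv, hu1⟩, fun huS => ?_⟩,
        b, hb, hbu⟩)
      exact hi (hB hb) huS hbu.ne hbu
  have := (Finset.card_le_card h2).trans (Finset.card_insert_le _ _)
  omega

end

end Folkman

namespace Folkman

/-! ### Even order -/

section

variable {H : SimpleGraph ℕ}

theorem Robust.left {W V V' : Finset ℕ} {r a a' : ℕ} (h : Robust H W r (a + a'))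
    (hW : W ⊆ V ∪ V') (ha : AlphaLe H V a) (ha' : AlphaLe H V' a') : Robust H V r a := by
  intro L hl hL
  obtain ⟨S, hS, hi, hc, hd⟩ := h L hl hL
  have h1 := ha (S ∩ V) Finset.inter_subset_right (indep_mono hi Finset.inter_subset_left)
  have h2 := ha' (S ∩ V') Finset.inter_subset_right (indep_mono hi Finset.inter_subset_left)
  have h3 : S ⊆ S ∩ V ∪ S ∩ V' := by
    rw [← Finset.inter_union_distrib_left]
    exact Finset.subset_inter subset_rfl (hS.trans hW)
  have h4 := (Finset.card_le_card h3).trans (Finset.card_union_le _ _)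
  exact ⟨S ∩ V, Finset.inter_subset_right, indep_mono hi Finset.inter_subset_left, by omega,
    fun C hC => Finset.disjoint_of_subset_left Finset.inter_subset_left (hd C hC)⟩

/-- Hall's condition after the deletion of one vertex. -/
theorem pm_erase_of_expand {U S : Finset ℕ} {b : ℕ} (hb : b ∈ U) (hSU : S ⊆ U) (hbS : b ∉ S)
    (hi : H.IsIndepSet (S : Set ℕ)) (hcard : U.card = 2 * S.card + 1)
    (h : ∀ B ⊆ S, B.Nonempty → B.card + 1 ≤ (nb H U B).card) : PM H (U.erase b) := by
  refine pm_of_hall (S := S)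
    (fun u hu => Finset.mem_erase.2 ⟨fun h => hbS (h ▸ hu), hSU hu⟩)
    (by rw [Finset.card_erase_of_mem hb]; omega) fun B hB hne => ?_
  have h1 := h B hB hne
  have h2 : nb H U B ⊆ insert b (nb H (U.erase b \ S) B) := by
    intro u hu
    obtain ⟨hu1, c, hc, hcu⟩ := mem_nb.1 hu
    rw [Finset.mem_insert]
    by_cases hub : u = b
    · exact Or.inl hub
    · refine Or.inr (mem_nb.2 ⟨Finset.mem_sdiff.2 ⟨Finset.mem_erase.2 ⟨hub, hu1⟩, fun huS => ?_⟩,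
        c, hc, hcu⟩)
      exact hi (hB hc) huS hcu.ne hcu
  have := (Finset.card_le_card h2).trans (Finset.card_insert_le _ _)
  omega

theorem pm_of_expand_two {W S : Finset ℕ} {x y : ℕ} (hx : x ∈ W) (hy : y ∈ W) (hxy : H.Adj x y)
    (hSW : S ⊆ W) (hi : H.IsIndepSet (S : Set ℕ)) (hd : Disjoint S {x, y})
    (hcard : W.card = 2 * S.card + 2)
    (h : ∀ B ⊆ S, B.Nonempty → B.card + 2 ≤ (nb H W B).card) : PM H W := by
  rw [Finset.disjoint_insert_right, Finset.disjoint_singleton_right] at hd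
  have hy' : y ∈ W.erase x := Finset.mem_erase.2 ⟨hxy.ne', hy⟩
  have hpm : PM H ((W.erase x).erase y) := by
    refine pm_erase_of_expand hy' (S := S)
      (fun u hu => Finset.mem_erase.2 ⟨fun h => hd.1 (h ▸ hu), hSW hu⟩) hd.2 hi
      (by rw [Finset.card_erase_of_mem hx]; omega) fun B hB hne => ?_
    have h1 := h B hB hne
    have h2 : nb H W B ⊆ insert x (nb H (W.erase x) B) := by
      intro u hu
      obtain ⟨hu1, hu2⟩ := mem_nb.1 hu
      rw [Finset.mem_insert]
      by_cases hux : u = x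
      · exact Or.inl hux
      · exact Or.inr (mem_nb.2 ⟨Finset.mem_erase.2 ⟨hux, hu1⟩, hu2⟩)
    have := (Finset.card_le_card h2).trans (Finset.card_insert_le _ _)
    omega
  have := PM.cons hxy (by simp) (by simp) hpm
  rwa [Finset.insert_erase hy', Finset.insert_erase hx] at this

theorem AlphaLe.exists_adj {W : Finset ℕ} {k : ℕ} (ha : AlphaLe H W k) (hr : Robust H W 1 k)
    (hne : W.Nonempty) : ∃ x ∈ W, ∃ y ∈ W, H.Adj x y := by
  obtain ⟨v, hv⟩ := hne
  have h1 := ha.expand hr (A := {v}) (by simpa using hv) (by simp) (by simp)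
  obtain ⟨u, hu⟩ := Finset.card_pos.1 (show 0 < (nb H W {v}).card by omega)
  obtain ⟨h2, a, ha, h3⟩ := mem_nb.1 hu
  rw [Finset.mem_singleton] at ha
  exact ⟨v, hv, u, h2, ha ▸ h3⟩

/-- The structure at order `2 * k + 2`. -/
theorem pm_or_split {W : Finset ℕ} {k : ℕ} (ha : AlphaLe H W k) (hr : Robust H W 1 k)
    (hc : W.card = 2 * k + 2) : PM H W ∨ ∃ V V' : Finset ℕ, ∃ a a' : ℕ,
      Disjoint V V' ∧ V ∪ V' = W ∧ (∀ x ∈ V, ∀ y ∈ V', ¬ H.Adj x y) ∧ a + a' = k ∧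
      V.card = 2 * a + 1 ∧ V'.card = 2 * a' + 1 ∧ AlphaLe H V a ∧ AlphaLe H V' a' ∧
      Robust H V 1 a ∧ Robust H V' 1 a' := by
  classical
  obtain ⟨x, hx, y, hy, hxy⟩ := ha.exists_adj hr (Finset.card_pos.1 (by omega))
  obtain ⟨S, hSW, hSi, hSc, hSd⟩ := hr.one (clique_pair hxy)
  set F : Finset (Finset ℕ) := W.powerset.filter fun A =>
    A.Nonempty ∧ H.IsIndepSet (A : Set ℕ) ∧ (nb H W A).card = A.card + 1 with hF
  have hmF : ∀ A, A ∈ F ↔ A ⊆ W ∧ A.Nonempty ∧ H.IsIndepSet (A : Set ℕ) ∧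
      (nb H W A).card = A.card + 1 := by
    intro A
    rw [hF, Finset.mem_filter, Finset.mem_powerset]
  rcases F.eq_empty_or_nonempty with hFe | hFne
  · left
    refine pm_of_expand_two hx hy hxy hSW hSi hSd (by omega) fun B hB hne => ?_
    have h1 := ha.expand hr (hB.trans hSW) hne (indep_mono hSi hB)
    have h2 : B ∉ F := by simp [hFe]
    rw [hmF] at h2
    by_contra h3
    exact h2 ⟨hB.trans hSW, hne, indep_mono hSi hB, by omega⟩
  obtain ⟨A, hA, hmax⟩ := F.exists_max_image Finset.card hFne
  obtain ⟨hAW, hAne, hAi, hAt⟩ := (hmF A).1 hA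
  have hNW : nb H W A ⊆ W := fun v hv => (mem_nb.1 hv).1
  set V := A ∪ nb H W A with hV
  have hVW : V ⊆ W := Finset.union_subset hAW hNW
  have hVc : V.card = 2 * A.card + 1 := by
    rw [hV, Finset.card_union_of_disjoint (disjoint_nb hAi), hAt]; omega
  have hAk := ha A hAW hAi
  have hRc : (W \ V).card = 2 * (k - A.card) + 1 := by
    rw [Finset.card_sdiff_of_subset hVW]; omega
  have hAR : ∀ u ∈ A, ∀ v ∈ W \ V, ¬ H.Adj u v := by
    intro u hu v hv huv
    rw [Finset.mem_sdiff] at hv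
    exact hv.2 (Finset.mem_union_right _ (mem_nb.2 ⟨hv.1, u, hu, huv⟩))
  have hAd : ∀ T ⊆ W \ V, Disjoint A T := by
    intro T hT
    rw [Finset.disjoint_left]
    intro u hu hu'
    exact (Finset.mem_sdiff.1 (hT hu')).2 (Finset.mem_union_left _ hu)
  have hRa : AlphaLe H (W \ V) (k - A.card) := by
    intro T hT hTi
    have h1 := ha (A ∪ T) (Finset.union_subset hAW (hT.trans Finset.sdiff_subset))
      (indep_union hAi hTi fun u hu v hv => hAR u hu v (hT hv))
    rw [Finset.card_union_of_disjoint (hAd T hT)] at h1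
    omega
  have hVpm : ∀ b ∈ nb H W A, PM H (V.erase b) := by
    intro b hb
    refine pm_erase_of_expand (Finset.mem_union_right _ hb) (S := A) Finset.subset_union_left
      (fun h => Finset.disjoint_left.1 (disjoint_nb hAi) h hb) hAi hVc fun B hB hne => ?_
    refine (ha.expand hr (hB.trans hAW) hne (indep_mono hAi hB)).trans (Finset.card_le_card ?_)
    intro v hv
    exact mem_nb.2 ⟨Finset.mem_union_right _ (nb_mono subset_rfl hB hv), (mem_nb.1 hv).2⟩
  have hVa : ∀ b ∈ nb H W A, ∀ T : Finset ℕ, H.IsIndepSet (T : Set ℕ) → b ∉ T →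
      (T ∩ V).card ≤ A.card := by
    intro b hb T hT hbT
    have h1 := (hVpm b hb).alpha hT
    rw [Finset.card_erase_of_mem (show b ∈ V from Finset.mem_union_right _ hb), hVc] at h1
    have h2 : T ∩ V ⊆ T ∩ V.erase b := by
      intro v hv
      rw [Finset.mem_inter] at hv ⊢
      exact ⟨hv.1, Finset.mem_erase.2 ⟨fun h => hbT (h ▸ hv.1), hv.2⟩⟩
    have := Finset.card_le_card h2
    omega
  have hRx : ∀ B ⊆ W \ V, B.Nonempty → H.IsIndepSet (B : Set ℕ) →
      B.card + 1 ≤ (nb H (W \ V) B).card := by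
    intro B hB hne hBi
    have h1 : A ∪ B ⊆ W := Finset.union_subset hAW (hB.trans Finset.sdiff_subset)
    have h2 : H.IsIndepSet ((A ∪ B : Finset ℕ) : Set ℕ) :=
      indep_union hAi hBi fun u hu v hv => hAR u hu v (hB hv)
    have h3 := ha.expand hr h1 (hAne.mono Finset.subset_union_left) h2
    have h4 : (A ∪ B).card = A.card + B.card := Finset.card_union_of_disjoint (hAd B hB)
    have h5 := Finset.card_pos.2 hne
    have h6 : A ∪ B ∉ F := fun h => by
      have := hmax _ h
      omega
    have h7 : (nb H W (A ∪ B)).card ≠ (A ∪ B).card + 1 := fun h =>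
      h6 ((hmF _).2 ⟨h1, hAne.mono Finset.subset_union_left, h2, h⟩)
    have h8 : nb H W (A ∪ B) ⊆ nb H W A ∪ nb H (W \ V) B := by
      intro v hv
      obtain ⟨hvW, c, hc, hcv⟩ := mem_nb.1 hv
      rw [Finset.mem_union]
      by_cases hvN : v ∈ nb H W A
      · exact Or.inl hvN
      · rcases Finset.mem_union.1 hc with hc | hc
        · exact absurd (mem_nb.2 ⟨hvW, c, hc, hcv⟩) hvN
        · refine Or.inr (mem_nb.2 ⟨Finset.mem_sdiff.2 ⟨hvW, fun hvV => ?_⟩, c, hc, hcv⟩)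
          rcases Finset.mem_union.1 hvV with hvA | h
          · exact hAR v hvA c (hB hc) hcv.symm
          · exact hvN h
    have h9 := (Finset.card_le_card h8).trans (Finset.card_union_le _ _)
    omega
  have hsplit : ∀ T : Finset ℕ, (T ∩ V).card + (T \ V).card = T.card := fun T =>
    Finset.card_inter_add_card_sdiff T V
  by_cases hcon : ∃ b ∈ nb H W A, ∃ r ∈ W \ V, H.Adj b r
  · left
    obtain ⟨b, hb, r, hr', hbr⟩ := hcon
    obtain ⟨T, hTW, hTi, hTc, hTd⟩ := hr.one (clique_pair hbr)
    rw [Finset.disjoint_insert_right, Finset.disjoint_singleton_right] at hTd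
    have h1 := hVa b hb T hTi hTd.1
    have hDi := indep_mono hTi (Finset.sdiff_subset (s := T) (t := V))
    have hDR : T \ V ⊆ W \ V := Finset.sdiff_subset_sdiff hTW subset_rfl
    have h2 := hRa (T \ V) hDR hDi
    have h3 := hsplit T
    have hRpm : PM H ((W \ V).erase r) := by
      refine pm_erase_of_expand hr' hDR (fun h => hTd.2 (Finset.mem_sdiff.1 h).1) hDi
        (by omega) fun B hB hne => hRx B (hB.trans hDR) hne (indep_mono hDi hB)
    have hbV : b ∈ V := Finset.mem_union_right _ hb
    have hrV := (Finset.mem_sdiff.1 hr').2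
    have := PM.cons hbr ?_ ?_ ((hVpm b hb).union hRpm ?_)
    · convert this using 1
      ext v
      have hrW := (Finset.mem_sdiff.1 hr').1
      have hbW := hVW hbV
      simp only [Finset.mem_insert, Finset.mem_union, Finset.mem_erase, Finset.mem_sdiff]
      constructor
      · intro hv
        by_cases hvV : v ∈ V <;> by_cases hvb : v = b <;> by_cases hvr : v = r <;> simp_all
      · rintro (rfl | rfl | h | h)
        exacts [hbW, hrW, hVW h.2, h.2.1]
    · simp [hbV]
    · simp [hrV]
    · rw [Finset.disjoint_left]
      intro v hv hv'
      exact (Finset.mem_sdiff.1 (Finset.mem_erase.1 hv').2).2 (Finset.mem_erase.1 hv).2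
  · right
    obtain ⟨b, hb⟩ := Finset.card_pos.1 (show 0 < (nb H W A).card by omega)
    have hno : ∀ u ∈ V, ∀ v ∈ W \ V, ¬ H.Adj u v := by
      intro u hu v hv huv
      rcases Finset.mem_union.1 hu with hu | hu
      · exact hAR u hu v hv huv
      · exact hcon ⟨u, hu, v, hv, huv⟩
    have hVal : AlphaLe H V A.card := by
      intro T hT hTi
      obtain ⟨Q, hQW, hQi, hQc, hQd⟩ := hr.one (clique_singleton b)
      have h1 := hVa b hb Q hQi (by simpa using hQd)
      have h2 := hsplit Q
      have hQR : Q \ V ⊆ W \ V := Finset.sdiff_subset_sdiff hQW subset_rfl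
      have h3 := ha (T ∪ Q \ V) (Finset.union_subset (hT.trans hVW) (hQR.trans Finset.sdiff_subset))
        (indep_union hTi (indep_mono hQi Finset.sdiff_subset)
          fun u hu v hv => hno u (hT hu) v (hQR hv))
      rw [Finset.card_union_of_disjoint (Finset.disjoint_of_subset_left hT
        Finset.disjoint_sdiff)] at h3
      omega
    have hk : A.card + (k - A.card) = k := by omega
    refine ⟨V, W \ V, A.card, k - A.card, Finset.disjoint_sdiff,
      Finset.union_sdiff_of_subset hVW, hno, hk, hVc, hRc, hVal, hRa, ?_, ?_⟩
    · exact (hk ▸ hr).left (Finset.union_sdiff_of_subset hVW).superset hVal hRa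
    · have hr2 : Robust H W 1 (k - A.card + A.card) := by
        rwa [Nat.add_comm, hk]
      exact hr2.left (by rw [Finset.union_comm]; exact (Finset.union_sdiff_of_subset hVW).superset)
        hRa hVal

end

end Folkman

namespace Folkman

/-! ### From graphs to labelled instances -/

section

variable {H : SimpleGraph ℕ}

theorem hyp_of_list {P : Ins} {l : List ℕ} {V : Finset ℕ} (hl : l.Nodup) (hn : l.length = P.n)
    (hN : ∀ i, P.N.testBit i = true → i < P.n)
    (ha : AlphaLe H l.toFinset P.p) (hr : Robust H l.toFinset P.K P.F)
    (hd : ∀ v ∈ l.toFinset, P.d ≤ (nb H l.toFinset {v}).card)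
    (ht : P.tf = true → ∀ a ∈ l.toFinset, ∀ b ∈ l.toFinset, ∀ c ∈ l.toFinset,
      H.Adj a b → H.Adj b c → H.Adj a c → False)
    (hV : ∀ i, P.N.testBit i = true → l.getD i 0 ∈ V) (haV : AlphaLe H V P.F) :
    Hyp P (H.comap fun i => l.getD i 0) := by
  have hmem : ∀ i < P.n, l.getD i 0 ∈ l.toFinset := by
    intro i hi
    rw [List.mem_toFinset, List.getD_eq_getElem _ _ (hn ▸ hi)]
    exact List.getElem_mem _
  have hinj : ∀ i < P.n, ∀ j < P.n, l.getD i 0 = l.getD j 0 → i = j := by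
    intro i hi j hj hij
    rw [List.getD_eq_getElem _ _ (hn ▸ hi), List.getD_eq_getElem _ _ (hn ▸ hj)] at hij
    exact (hl.getElem_inj_iff).1 hij
  have hsurj : ∀ v ∈ l.toFinset, ∃ i < P.n, l.getD i 0 = v := by
    intro v hv
    obtain ⟨i, hi, h⟩ := List.getElem_of_mem (List.mem_toFinset.1 hv)
    exact ⟨i, hn ▸ hi, by rw [List.getD_eq_getElem _ _ hi, h]⟩
  have himg : ∀ S : Finset ℕ, (∀ i ∈ S, i < P.n) →
      (S.image fun i => l.getD i 0).card = S.card := by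
    intro S hS
    refine Finset.card_image_of_injOn fun i hi j hj hij => hinj i (hS i hi) j (hS j hj) hij
  have hind : ∀ S : Finset ℕ, (H.comap fun i => l.getD i 0).IsIndepSet (S : Set ℕ) →
      H.IsIndepSet ((S.image fun i => l.getD i 0 : Finset ℕ) : Set ℕ) := by
    intro S hS u hu v hv huv hadj
    obtain ⟨i, hi, rfl⟩ := Finset.mem_image.1 (Finset.mem_coe.1 hu)
    obtain ⟨j, hj, rfl⟩ := Finset.mem_image.1 (Finset.mem_coe.1 hv)
    exact hS hi hj (fun h => huv (by rw [h])) hadj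
  constructor
  · intro S hS hSi
    rw [← himg S fun i hi => Finset.mem_range.1 (hS hi)]
    refine ha _ ?_ (hind S hSi)
    intro v hv
    obtain ⟨i, hi, rfl⟩ := Finset.mem_image.1 hv
    exact hmem i (Finset.mem_range.1 (hS hi))
  · intro L hL hcl
    obtain ⟨S, hS, hSi, hSc, hSd⟩ := hr (L.map fun C => C.image fun i => l.getD i 0)
      (by simpa using hL) (by
        intro C hC
        obtain ⟨D, hD, rfl⟩ := List.mem_map.1 hC
        intro u hu v hv huv
        obtain ⟨i, hi, rfl⟩ := Finset.mem_image.1 (Finset.mem_coe.1 hu)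
        obtain ⟨j, hj, rfl⟩ := Finset.mem_image.1 (Finset.mem_coe.1 hv)
        exact hcl D hD hi hj fun h => huv (by rw [h]))
    have hfi : ((Finset.range P.n).filter fun i => l.getD i 0 ∈ S).image
        (fun i => l.getD i 0) = S := by
      ext v
      simp only [Finset.mem_image, Finset.mem_filter, Finset.mem_range]
      constructor
      · rintro ⟨i, hi, rfl⟩
        exact hi.2
      · intro hv
        obtain ⟨i, hi, rfl⟩ := hsurj v (hS hv)
        exact ⟨i, ⟨hi, hv⟩, rfl⟩
    refine ⟨(Finset.range P.n).filter fun i => l.getD i 0 ∈ S, Finset.filter_subset _ _,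
      ?_, ?_, ?_⟩
    · intro i hi j hj _ hadj
      rw [Finset.mem_coe, Finset.mem_filter] at hi hj
      exact hSi hi.2 hj.2 (SimpleGraph.Adj.ne hadj) hadj
    · rw [← himg _ fun i hi => Finset.mem_range.1 (Finset.mem_filter.1 hi).1, hfi, hSc]
    · intro C hC
      rw [Finset.disjoint_left]
      intro i hi hiC
      exact Finset.disjoint_left.1 (hSd _ (List.mem_map_of_mem hC)) (Finset.mem_filter.1 hi).2
        (Finset.mem_image_of_mem _ hiC)
  · intro v hv D hD
    refine (hd _ (hmem v hv)).trans ((Finset.card_le_card ?_).trans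
      (Finset.card_image_le (s := D) (f := fun i => l.getD i 0)))
    intro u hu
    obtain ⟨hu1, a, ha, hau⟩ := mem_nb.1 hu
    rw [Finset.mem_singleton] at ha
    subst ha
    obtain ⟨i, hi, rfl⟩ := hsurj u hu1
    exact Finset.mem_image_of_mem _ (hD i hi hau)
  · intro htf a b c ha hb hc h1 h2 h3
    exact ht htf _ (hmem a ha) _ (hmem b hb) _ (hmem c hc) h1 h2 h3
  · intro S hS hSi
    rw [← himg S fun i hi => hN i (hS i hi)]
    refine haV _ ?_ (hind S hSi)
    intro v hv
    obtain ⟨i, hi, rfl⟩ := Finset.mem_image.1 hv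
    exact hV i (hS i hi)

theorem getD_mem_toFinset {l : List ℕ} {i : ℕ} (h : i < l.length) : l.getD i 0 ∈ l.toFinset := by
  rw [List.mem_toFinset, List.getD_eq_getElem _ _ h]
  exact List.getElem_mem _

theorem two_le_card_nb {W : Finset ℕ} {p k : ℕ} (ha : AlphaLe H W p) (hr : Robust H W 2 p) {v : ℕ}
    (hv : v ∈ W) (hk : k ≤ 3) : k ≤ (nb H W {v}).card := by
  have := ha.expand_two hr (A := {v}) (by simpa using hv) (by simp) (by simp)
  rw [Finset.card_singleton] at this
  omega

theorem false_of_pm {W : Finset ℕ} (hc : W.card = 18) (ha : AlphaLe H W 7) (hr : Robust H W 2 7)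
    (ht : ∀ a ∈ W, ∀ b ∈ W, ∀ c ∈ W, H.Adj a b → H.Adj b c → H.Adj a c → False)
    (h : PM H W) : False := by
  obtain ⟨l, hnd, rfl, hlen, hadj⟩ := h.list
  have h18 : l.length = 18 := hlen.trans hc
  refine not_base (hyp_of_list (P := insBase) (V := l.toFinset) hnd h18 valid_insBase.N_lt ha hr
    (fun v hv => two_le_card_nb ha hr hv le_rfl) (fun _ => ht)
    (fun i hi => getD_mem_toFinset (by rw [h18]; exact valid_insBase.N_lt i hi)) ha) ?_
  intro e he
  obtain ⟨i, hi, h1, h2⟩ : ∃ i < 9, lo e = 2 * i + 1 ∧ hi e = 2 * i := by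
    revert e; decide
  rw [SimpleGraph.comap_adj, h1, h2]
  exact hadj i (by omega)

theorem list_facts {w a : ℕ} {l t : List ℕ} {E : Finset ℕ} (hl : l.Nodup) (hE : l.toFinset = E)
    (ht : (w :: a :: t).Nodup) (hd : ∀ v ∈ w :: a :: t, v ∉ E) :
    (w :: a :: (l ++ t)).Nodup ∧
    (w :: a :: (l ++ t)).toFinset = (w :: a :: t).toFinset ∪ E := by
  subst hE
  simp only [List.mem_toFinset] at hd
  constructor
  · simp only [List.nodup_cons, List.mem_cons, List.mem_append, List.nodup_append, hl,
      not_or] at ht ⊢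
    refine ⟨⟨ht.1.1, hd w (by simp), ht.1.2⟩, ⟨hd a (by simp), ht.2.1⟩, trivial, ht.2.2, ?_⟩
    rintro u hu v hv rfl
    exact hd u (by simp [hv]) hu
  · ext v
    simp only [List.toFinset_cons, List.toFinset_append, Finset.mem_insert, Finset.mem_union]
    tauto

theorem getD_of_isPrefix {w a i : ℕ} {l t : List ℕ} (hi : i < l.length) :
    (w :: a :: (l ++ t)).getD (i + 2) 0 = l.getD i 0 := by
  simp [List.getD, List.getElem?_append_left hi]

theorem false_of_triangle {W E : Finset ℕ} {w a b c : ℕ} (hc : W.card = 18) (ha : AlphaLe H W 7)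
    (hr : Robust H W 2 7) (hW : W = (w :: a :: [b, c]).toFinset ∪ E)
    (hnd : (w :: a :: [b, c]).Nodup) (hE : ∀ v ∈ w :: a :: [b, c], v ∉ E)
    (hab : H.Adj a b) (hbc : H.Adj b c) (hac : H.Adj a c) (h : PM H E) : False := by
  obtain ⟨l, hl, hlE, hlen, hadj⟩ := h.list
  obtain ⟨h1, h2⟩ := list_facts hl hlE hnd hE
  rw [← hW] at h2
  have h18 : (w :: a :: (l ++ [b, c])).length = 18 := by
    rw [← List.toFinset_card_of_nodup h1, h2, hc]
  have h14 : l.length = 14 := by simpa using h18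
  refine not_tri (hyp_of_list (P := insTri) (V := W) h1 h18 valid_insTri.N_lt (h2 ▸ ha) (h2 ▸ hr)
    (fun v hv => two_le_card_nb (h2 ▸ ha) (h2 ▸ hr) hv le_rfl) (fun h => by cases h)
    (fun i hi => h2 ▸ getD_mem_toFinset (by rw [h18]; exact valid_insTri.N_lt i hi)) ha) ?_
  have hb' : (w :: a :: (l ++ [b, c])).getD 16 0 = b := by simp [h14]
  have hc' : (w :: a :: (l ++ [b, c])).getD 17 0 = c := by simp [h14]
  have ha' : (w :: a :: (l ++ [b, c])).getD 1 0 = a := rfl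
  intro e he
  rw [SimpleGraph.comap_adj]
  obtain ⟨i, hi, h3, h4⟩ | ⟨h3, h4⟩ | ⟨h3, h4⟩ | ⟨h3, h4⟩ :
      (∃ i < 7, lo e = 2 * i + 1 + 2 ∧ hi e = 2 * i + 2) ∨ (lo e = 16 ∧ hi e = 1) ∨
        (lo e = 17 ∧ hi e = 16) ∨ (lo e = 17 ∧ hi e = 1) := by
    revert e; decide
  · rw [h3, h4, getD_of_isPrefix (by omega), getD_of_isPrefix (by omega)]
    exact hadj i (by omega)
  · rw [h3, h4, ha', hb']; exact hab
  · rw [h3, h4, hb', hc']; exact hbc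
  · rw [h3, h4, ha', hc']; exact hac

theorem false_of_two_edges {W E : Finset ℕ} {w a b c d : ℕ} (hc : W.card = 19)
    (ha : AlphaLe H W 8) (hr : Robust H W 3 7) (hdeg : ∀ v ∈ W, 2 ≤ (nb H W {v}).card)
    (hW : W = (w :: a :: [b, c, d]).toFinset ∪ E)
    (hnd : (w :: a :: [b, c, d]).Nodup) (hE : ∀ v ∈ w :: a :: [b, c, d], v ∉ E)
    (hbc : H.Adj b c) (had : H.Adj a d) (h : PM H E) (haE : AlphaLe H (insert w E) 7) : False := by
  obtain ⟨l, hl, hlE, hlen, hadj⟩ := h.list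
  obtain ⟨h1, h2⟩ := list_facts hl hlE hnd hE
  rw [← hW] at h2
  have h19 : (w :: a :: (l ++ [b, c, d])).length = 19 := by
    rw [← List.toFinset_card_of_nodup h1, h2, hc]
  have h14 : l.length = 14 := by simpa using h19
  have hV : ∀ i, insFifteen.N.testBit i = true →
      (w :: a :: (l ++ [b, c, d])).getD i 0 ∈ insert w E := by
    intro i hi
    have hi16 : i < 16 := testBit_lt (by decide) hi
    have hi1 : i ≠ 1 := by rintro rfl; revert hi; decide
    match i, hi16, hi1 with
    | 0, _, _ => simp
    | i + 2, hi16, _ =>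
      rw [getD_of_isPrefix (by omega), ← hlE]
      exact Finset.mem_insert_of_mem (getD_mem_toFinset (by omega))
  refine not_fifteen (hyp_of_list (P := insFifteen) h1 h19 valid_insFifteen.N_lt (h2 ▸ ha)
    (h2 ▸ hr) (by rw [h2]; exact hdeg) (fun h => by cases h) hV haE) ?_
  have hb' : (w :: a :: (l ++ [b, c, d])).getD 16 0 = b := by simp [h14]
  have hc' : (w :: a :: (l ++ [b, c, d])).getD 17 0 = c := by simp [h14]
  have hd' : (w :: a :: (l ++ [b, c, d])).getD 18 0 = d := by simp [h14]
  have ha' : (w :: a :: (l ++ [b, c, d])).getD 1 0 = a := rfl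
  intro e he
  rw [SimpleGraph.comap_adj]
  obtain ⟨i, hi, h3, h4⟩ | ⟨h3, h4⟩ | ⟨h3, h4⟩ :
      (∃ i < 7, lo e = 2 * i + 1 + 2 ∧ hi e = 2 * i + 2) ∨ (lo e = 17 ∧ hi e = 16) ∨
        (lo e = 18 ∧ hi e = 1) := by
    revert e; decide
  · rw [h3, h4, getD_of_isPrefix (by omega), getD_of_isPrefix (by omega)]
    exact hadj i (by omega)
  · rw [h3, h4, hb', hc']; exact hbc
  · rw [h3, h4, ha', hd']; exact had

theorem false_of_edge {W E : Finset ℕ} {w a d : ℕ} (hc : W.card = 19) (ha : AlphaLe H W 8)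
    (hr : Robust H W 2 8) (hW : W = (w :: a :: [d]).toFinset ∪ E) (hnd : (w :: a :: [d]).Nodup)
    (hE : ∀ v ∈ w :: a :: [d], v ∉ E) (had : H.Adj a d) (h : PM H E) : False := by
  obtain ⟨l, hl, hlE, hlen, hadj⟩ := h.list
  obtain ⟨h1, h2⟩ := list_facts hl hlE hnd hE
  rw [← hW] at h2
  have h19 : (w :: a :: (l ++ [d])).length = 19 := by
    rw [← List.toFinset_card_of_nodup h1, h2, hc]
  have h16 : l.length = 16 := by simpa using h19
  refine not_seventeen (hyp_of_list (P := insSeventeen) (V := W) h1 h19 valid_insSeventeen.N_lt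
    (h2 ▸ ha) (h2 ▸ hr) (fun v hv => two_le_card_nb (h2 ▸ ha) (h2 ▸ hr) hv le_rfl)
    (fun h => by cases h) (fun i hi => h2 ▸ getD_mem_toFinset
      (by rw [h19]; exact valid_insSeventeen.N_lt i hi)) ha) ?_
  have hd' : (w :: a :: (l ++ [d])).getD 18 0 = d := by simp [h16]
  have ha' : (w :: a :: (l ++ [d])).getD 1 0 = a := rfl
  intro e he
  rw [SimpleGraph.comap_adj]
  obtain ⟨i, hi, h3, h4⟩ | ⟨h3, h4⟩ :
      (∃ i < 8, lo e = 2 * i + 1 + 2 ∧ hi e = 2 * i + 2) ∨ (lo e = 18 ∧ hi e = 1) := by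
    revert e; decide
  · rw [h3, h4, getD_of_isPrefix (by omega), getD_of_isPrefix (by omega)]
    exact hadj i (by omega)
  · rw [h3, h4, ha', hd']; exact had

end

end Folkman

namespace Folkman

/-! ### No graph is robust with few vertices -/

section

variable {H : SimpleGraph ℕ}

theorem not_robust_two {W : Finset ℕ} (hc : W.card = 18) (ha : AlphaLe H W 7)
    (hr : Robust H W 2 7) : False := by
  by_cases ht : ∃ a ∈ W, ∃ b ∈ W, ∃ c ∈ W, H.Adj a b ∧ H.Adj b c ∧ H.Adj a c
  · obtain ⟨a, haW, b, hbW, c, hcW, hab, hbc, hac⟩ := ht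
    have hcl : H.IsClique (({a, b, c} : Finset ℕ) : Set ℕ) := by
      simp [SimpleGraph.isClique_insert, hab, hbc, hac]
    have hsub : ({a, b, c} : Finset ℕ) ⊆ W := by
      intro v hv
      simp only [Finset.mem_insert, Finset.mem_singleton] at hv
      rcases hv with rfl | rfl | rfl <;> assumption
    have h3 : ({a, b, c} : Finset ℕ).card = 3 :=
      Finset.card_eq_three.2 ⟨a, b, c, hab.ne, hac.ne, hbc.ne, rfl⟩
    have h15 : (W \ {a, b, c}).card = 2 * 7 + 1 := by
      rw [Finset.card_sdiff_of_subset hsub]; omega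
    obtain ⟨w, hw⟩ := Finset.card_pos.1 (show 0 < (W \ {a, b, c}).card by omega)
    have hpm := pm_erase (ha.mono Finset.sdiff_subset le_rfl) (hr.sdiff hcl) h15 hw
    simp only [Finset.mem_sdiff, Finset.mem_insert, Finset.mem_singleton, not_or] at hw
    refine false_of_triangle (w := w) (a := a) (b := b) (c := c) hc ha hr ?_ ?_ ?_ hab hbc hac hpm
    · ext v
      simp only [List.toFinset_cons, List.toFinset_nil, Finset.mem_union, Finset.mem_insert,
        Finset.mem_erase, Finset.mem_sdiff, Finset.mem_singleton, Finset.notMem_empty, or_false]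
      constructor
      · intro hv
        by_cases h1 : v = w
        · exact Or.inl (Or.inl h1)
        · by_cases h2 : v = a ∨ v = b ∨ v = c
          · exact Or.inl (Or.inr h2)
          · exact Or.inr ⟨h1, hv, h2⟩
      · rintro ((rfl | rfl | rfl | rfl) | h)
        exacts [hw.1, haW, hbW, hcW, h.2.1]
    · simp [hw, hab.ne, hbc.ne, hac.ne]
    · simp
  · push Not at ht
    have ht' : ∀ a ∈ W, ∀ b ∈ W, ∀ c ∈ W, H.Adj a b → H.Adj b c → H.Adj a c → False :=
      fun a ha b hb c hc h1 h2 h3 => ht a ha b hb c hc h1 h2 h3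
    refine false_of_pm hc ha hr ht' ?_
    obtain ⟨x, hx, y, hy, hxy⟩ := ha.exists_adj hr.pred (Finset.card_pos.1 (by omega))
    have h16 : (W \ {x, y}).card = 2 * 7 + 2 := by
      rw [Finset.card_sdiff_of_subset (by
        intro v hv
        simp only [Finset.mem_insert, Finset.mem_singleton] at hv
        rcases hv with rfl | rfl <;> assumption), Finset.card_pair hxy.ne]
      omega
    rcases pm_or_split (ha.mono Finset.sdiff_subset le_rfl) (hr.sdiff (clique_pair hxy)) h16 with
      h | ⟨V, V', a, a', hd, hU, hno, haa, hVc, hVc', hVa, hVa', hVr, hVr'⟩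
    · have := (pm_pair hxy).union h Finset.disjoint_sdiff
      rwa [Finset.union_sdiff_of_subset (by
        intro v hv
        simp only [Finset.mem_insert, Finset.mem_singleton] at hv
        rcases hv with rfl | rfl <;> assumption)] at this
    have hmem : ∀ u, u ∈ W ↔ u = x ∨ u = y ∨ u ∈ V ∨ u ∈ V' := by
      intro u
      have h1 : u ∈ V ∪ V' ↔ u ∈ W \ {x, y} := by rw [hU]
      simp only [Finset.mem_union, Finset.mem_sdiff, Finset.mem_insert, Finset.mem_singleton,
        not_or] at h1
      by_cases hux : u = x
      · simp [hux, hx]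
      · by_cases huy : u = y
        · simp [huy, hy]
        · simp only [hux, huy, false_or, h1, not_false_eq_true, and_true]
    have hxyV : ∀ u, u ∈ V ∨ u ∈ V' → u ≠ x ∧ u ≠ y := by
      intro u hu
      have h1 : u ∈ V ∪ V' ↔ u ∈ W \ {x, y} := by rw [hU]
      simp only [Finset.mem_union, Finset.mem_sdiff, Finset.mem_insert, Finset.mem_singleton,
        not_or] at h1
      exact (h1.1 hu).2
    have hdeg : ∀ u ∈ W, 3 ≤ (nb H W {u}).card := fun u hu => two_le_card_nb ha hr hu le_rfl
    have hout : ∀ (X X' : Finset ℕ) (b : ℕ), (∀ u, u ∈ W ↔ u = x ∨ u = y ∨ u ∈ X ∨ u ∈ X') →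
        (∀ u ∈ X, ∀ v ∈ X', ¬ H.Adj u v) → X.card = 2 * b + 1 → Robust H X 1 b →
        (∃ v ∈ X, H.Adj x v) ∨ ∃ v ∈ X, H.Adj y v := by
      intro X X' b hm hn hX hXr
      by_contra hcon
      push Not at hcon
      obtain ⟨B, hBX, hne, hBi, hBc⟩ : ∃ B ⊆ X, B.Nonempty ∧ H.IsIndepSet (B : Set ℕ) ∧
          X.card ≤ 2 * B.card + 1 := by
        rcases Nat.eq_zero_or_pos b with rfl | hb
        · obtain ⟨v, hv⟩ := Finset.card_pos.1 (show 0 < X.card by omega)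
          exact ⟨{v}, by simpa using hv, by simp, by simp, by simp [hX]⟩
        · obtain ⟨B, h1, h2, h3, -⟩ := hXr.one clique_empty
          exact ⟨B, h1, Finset.card_pos.1 (by omega), h2, by omega⟩
      have hBW : B ⊆ W := fun u hu => (hm u).2 (by simp [hBX hu])
      have h1 := ha.expand_two hr hBW hne hBi
      have h2 : B ∪ nb H W B ⊆ X := by
        refine Finset.union_subset hBX fun u hu => ?_
        obtain ⟨huW, c, hcB, hcu⟩ := mem_nb.1 hu
        rcases (hm u).1 huW with rfl | rfl | h | h
        · exact absurd hcu.symm (hcon.1 c (hBX hcB))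
        · exact absurd hcu.symm (hcon.2 c (hBX hcB))
        · exact h
        · exact absurd hcu (hn c (hBX hcB) u h)
      have h3 := Finset.card_le_card h2
      rw [Finset.card_union_of_disjoint (disjoint_nb hBi)] at h3
      omega
    have hself : ∀ z z', (∀ u, u ∈ W ↔ u = z ∨ u = z' ∨ u ∈ V ∨ u ∈ V') → z ∈ W →
        (∃ v ∈ V, H.Adj z v) ∨ ∃ v ∈ V', H.Adj z v := by
      intro z z' hm hz
      by_contra hcon
      push Not at hcon
      have h1 : nb H W {z} ⊆ {z'} := by
        intro u hu
        obtain ⟨huW, c, hcz, hcu⟩ := mem_nb.1 hu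
        rw [Finset.mem_singleton] at hcz ⊢
        subst hcz
        rcases (hm u).1 huW with rfl | rfl | h | h
        · exact absurd hcu (H.loopless.irrefl _)
        · rfl
        · exact absurd hcu (hcon.1 u h)
        · exact absurd hcu (hcon.2 u h)
      have := Finset.card_le_card h1
      have := hdeg z hz
      rw [Finset.card_singleton] at *
      omega
    have hpm : ∀ z z' v v', z ≠ z' → (∀ u, u ∈ W ↔ u = z ∨ u = z' ∨ u ∈ V ∨ u ∈ V') →
        (∀ u, u ∈ V ∨ u ∈ V' → u ≠ z ∧ u ≠ z') → v ∈ V → v' ∈ V' → H.Adj z v → H.Adj z' v' →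
        PM H W := by
      intro z z' v v' hzz hm hz hv hv' hzv hzv'
      have hvv : ∀ u, u ∈ V → u ∉ V' := fun u hu => Finset.disjoint_left.1 hd hu
      have h1 := ((pm_pair hzv).union (pm_pair hzv') (by
          have h1 := hz v (Or.inl hv)
          have h2 := hz v' (Or.inr hv')
          have h3 : v ≠ v' := fun h => hvv v hv (h ▸ hv')
          simp [hzz.symm, h1.2.symm, h2.1, h3.symm])).union
        ((pm_erase hVa hVr hVc hv).union (pm_erase hVa' hVr' hVc' hv') (by
          exact Finset.disjoint_of_subset_left (Finset.erase_subset _ _)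
            (Finset.disjoint_of_subset_right (Finset.erase_subset _ _) hd))) (by
          rw [Finset.disjoint_left]
          intro u hu hu'
          simp only [Finset.mem_union, Finset.mem_insert, Finset.mem_singleton,
            Finset.mem_erase] at hu hu'
          have hu2 : u ∈ V ∨ u ∈ V' := hu'.imp And.right And.right
          have h4 := hz u hu2
          rcases hu with (rfl | rfl) | (rfl | rfl)
          · exact h4.1 rfl
          · exact hvv u hv (hu'.resolve_left fun h => h.1 rfl).2
          · exact h4.2 rfl
          · exact hvv u (hu'.resolve_right fun h => h.1 rfl).2 hv')
      convert h1 using 1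
      ext u
      rw [hm]
      simp only [Finset.mem_union, Finset.mem_insert, Finset.mem_singleton, Finset.mem_erase]
      constructor
      · rintro (h | h | h | h)
        · simp [h]
        · simp [h]
        · by_cases h' : u = v <;> simp [h, h']
        · by_cases h' : u = v' <;> simp [h, h']
      · rintro (((h | h) | (h | h)) | (h | h))
        · simp [h]
        · simp [h, hv]
        · simp [h]
        · simp [h, hv']
        · simp [h.2]
        · simp [h.2]
    have hmem' : ∀ u, u ∈ W ↔ u = y ∨ u = x ∨ u ∈ V ∨ u ∈ V' := fun u => by
      rw [hmem, or_left_comm]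
    have h1 := hout V V' a hmem hno hVc hVr
    have h2 := hout V' V a' (fun u => by rw [hmem, or_comm (a := u ∈ V)])
      (fun u hu v hv h => hno v hv u hu h.symm) hVc' hVr'
    have h3 := hself x y hmem hx
    have h4 := hself y x hmem' hy
    have h5 : ((∃ v ∈ V, H.Adj x v) ∧ ∃ v ∈ V', H.Adj y v) ∨
        ((∃ v ∈ V, H.Adj y v) ∧ ∃ v ∈ V', H.Adj x v) := by
      rcases h3 with h3 | h3
      · rcases h4 with h4 | h4
        · exact h2.elim (fun h => Or.inr ⟨h4, h⟩) fun h => Or.inl ⟨h3, h⟩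
        · exact Or.inl ⟨h3, h4⟩
      · rcases h4 with h4 | h4
        · exact Or.inr ⟨h4, h3⟩
        · exact h1.elim (fun h => Or.inl ⟨h, h4⟩) fun h => Or.inr ⟨h, h3⟩
    rcases h5 with ⟨⟨v, hv, h⟩, v', hv', h'⟩ | ⟨⟨v, hv, h⟩, v', hv', h'⟩
    · exact hpm x y v v' hxy.ne hmem hxyV hv hv' h h'
    · exact hpm y x v v' hxy.ne' hmem' (fun u hu => (hxyV u hu).symm) hv hv' h h'

theorem AlphaLe.sdiff_mono {W X X' : Finset ℕ} {k : ℕ} (h : AlphaLe H (W \ X) k) (hX : X ⊆ X') :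
    AlphaLe H (W \ X') k := h.mono (Finset.sdiff_subset_sdiff subset_rfl hX) le_rfl

theorem exists_indep_of_not_alphaLe {W : Finset ℕ} {k : ℕ} (h : ¬ AlphaLe H W k) :
    ∃ S ⊆ W, H.IsIndepSet (S : Set ℕ) ∧ k < S.card := by
  unfold AlphaLe at h
  push Not at h
  exact h

theorem robust_one_of_forall {W : Finset ℕ} {k : ℕ} (ha : AlphaLe H W (k + 1))
    (h : ∀ C : Finset ℕ, H.IsClique (C : Set ℕ) → ¬ AlphaLe H (W \ C) k) :
    Robust H W 1 (k + 1) := by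
  intro L hL hcl
  obtain ⟨C, rfl⟩ := List.length_eq_one_iff.1 hL
  obtain ⟨S, hS, hi, hc⟩ := exists_indep_of_not_alphaLe (h C (hcl C (by simp)))
  rw [Finset.subset_sdiff] at hS
  have := ha S hS.1 hi
  exact ⟨S, hS.1, hi, by omega, by simpa using hS.2⟩

theorem robust_two_of_forall {W : Finset ℕ} {k : ℕ} (ha : AlphaLe H W (k + 1))
    (h : ∀ C C' : Finset ℕ, H.IsClique (C : Set ℕ) → H.IsClique (C' : Set ℕ) →
      ¬ AlphaLe H (W \ (C ∪ C')) k) : Robust H W 2 (k + 1) := by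
  intro L hL hcl
  obtain ⟨C, C', rfl⟩ := List.length_eq_two.1 hL
  obtain ⟨S, hS, hi, hc⟩ := exists_indep_of_not_alphaLe (h C C' (hcl C (by simp))
    (hcl C' (by simp)))
  rw [Finset.subset_sdiff, Finset.disjoint_union_right] at hS
  have := ha S hS.1 hi
  exact ⟨S, hS.1, hi, by omega, by simpa using hS.2⟩

theorem Robust.sdiff_union {W : Finset ℕ} {r k : ℕ} (h : Robust H W (r + 2) k) {C C' : Finset ℕ}
    (hC : H.IsClique (C : Set ℕ)) (hC' : H.IsClique (C' : Set ℕ)) :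
    Robust H (W \ (C ∪ C')) r k := by
  have := (h.sdiff hC).sdiff hC'
  rwa [sdiff_sdiff] at this

/-- The assumptions on a counterexample with nineteen vertices. -/
structure Nineteen (H : SimpleGraph ℕ) (W : Finset ℕ) : Prop where
  card : W.card = 19
  alpha : AlphaLe H W 8
  one : Robust H W 1 8
  three : Robust H W 3 7

theorem not_good_two_two {W : Finset ℕ} (hW : Nineteen H W) {a b c d : ℕ}
    (haW : a ∈ W) (hbW : b ∈ W) (hcW : c ∈ W) (hdW : d ∈ W)
    (had : H.Adj a d) (hbc : H.Adj b c) (hab : a ≠ b) (hac : a ≠ c) (hdb : d ≠ b) (hdc : d ≠ c)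
    (hg : AlphaLe H (W \ ({a, d} ∪ {b, c})) 7) : False := by
  have hR := hW.three.sdiff_union (clique_pair had) (clique_pair hbc)
  have h4 : (({a, d} ∪ {b, c} : Finset ℕ)).card = 4 := by
    rw [Finset.card_union_of_disjoint (by
      simp [hab.symm, hac.symm, hdb.symm, hdc.symm]), Finset.card_pair had.ne,
      Finset.card_pair hbc.ne]
  have h15 : (W \ ({a, d} ∪ {b, c})).card = 2 * 7 + 1 := by
    rw [Finset.card_sdiff_of_subset (by
      intro v hv
      simp only [Finset.mem_union, Finset.mem_insert, Finset.mem_singleton] at hv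
      rcases hv with (rfl | rfl) | (rfl | rfl) <;> assumption)]
    have := hW.card
    omega
  obtain ⟨w, hw⟩ := Finset.card_pos.1 (show 0 < (W \ ({a, d} ∪ {b, c})).card by omega)
  have hpm := pm_erase hg hR h15 hw
  have hins := Finset.insert_erase hw
  simp only [Finset.mem_sdiff, Finset.mem_union, Finset.mem_insert, Finset.mem_singleton,
    not_or] at hw
  refine false_of_two_edges (w := w) (a := a) (b := b) (c := c) (d := d) hW.card hW.alpha hW.three ?_ ?_ ?_ ?_
    hbc had hpm (by rwa [hins])
  · intro v hv
    have := hW.alpha.expand hW.one (A := {v}) (by simpa using hv) (by simp) (by simp)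
    simpa using this
  · ext v
    simp only [List.toFinset_cons, List.toFinset_nil, Finset.mem_union, Finset.mem_insert,
      Finset.mem_erase, Finset.mem_sdiff, Finset.mem_singleton, Finset.notMem_empty, or_false]
    constructor
    · intro hv
      by_cases h1 : v = w
      · exact Or.inl (Or.inl h1)
      · by_cases h2 : (v = a ∨ v = d) ∨ (v = b ∨ v = c)
        · left; right; tauto
        · exact Or.inr ⟨h1, hv, h2⟩
    · rintro ((rfl | rfl | rfl | rfl | rfl) | h)
      exacts [hw.1, haW, hbW, hcW, hdW, h.2.1]
  · simp [hw, hab, hac, had.ne, hbc.ne, hdb.symm, hdc.symm]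
  · simp

theorem exists_adj_ne {W : Finset ℕ} (hW : Nineteen H W) {v u : ℕ}
    (hv : v ∈ W) : ∃ e ∈ W, H.Adj v e ∧ e ≠ u := by
  have := hW.alpha.expand hW.one (A := {v}) (by simpa using hv) (by simp) (by simp)
  rw [Finset.card_singleton] at this
  obtain ⟨e, he, hne⟩ := Finset.exists_mem_ne (show 1 < (nb H W {v}).card by omega) u
  obtain ⟨h1, c, h2, h3⟩ := mem_nb.1 he
  rw [Finset.mem_singleton] at h2
  exact ⟨e, h1, h2 ▸ h3, hne⟩

theorem not_good_clique {W : Finset ℕ} (hW : Nineteen H W) {X : Finset ℕ}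
    (hX : H.IsClique (X : Set ℕ)) : ¬ AlphaLe H (W \ X) 7 := by
  intro h
  obtain ⟨S, hS, hi, hSc, hd⟩ := hW.one.one hX
  have := h S (Finset.subset_sdiff.2 ⟨hS, hd⟩) hi
  omega

theorem not_good_two_one {W : Finset ℕ} (hW : Nineteen H W) {a b d : ℕ}
    (haW : a ∈ W) (hbW : b ∈ W) (hdW : d ∈ W)
    (hab : H.Adj a b) (hda : d ≠ a) (hdb : d ≠ b)
    (hg : AlphaLe H (W \ ({a, b} ∪ {d})) 7) : False := by
  by_cases hout : ∃ e ∈ W, H.Adj d e ∧ e ≠ a ∧ e ≠ b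
  · obtain ⟨e, heW, hde, hea, heb⟩ := hout
    exact not_good_two_two hW haW hdW heW hbW hab hde hda.symm hea.symm hdb.symm
      heb.symm (hg.sdiff_mono (Finset.union_subset_union subset_rfl (by simp)))
  · push Not at hout
    have h1 : H.Adj d a := by
      obtain ⟨e, heW, hde, hne⟩ := exists_adj_ne hW (u := b) hdW
      by_contra h
      exact hne (hout e heW hde (fun h' => h (h' ▸ hde)))
    have h2 : H.Adj d b := by
      obtain ⟨e, heW, hde, hne⟩ := exists_adj_ne hW (u := a) hdW
      exact hout e heW hde hne ▸ hde
    refine not_good_clique hW ?_ hg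
    simp [SimpleGraph.isClique_insert, hab, h1.symm, h2.symm]

theorem not_good_one_one {W : Finset ℕ} (hW : Nineteen H W) {a b : ℕ}
    (haW : a ∈ W) (hbW : b ∈ W) (hab : a ≠ b)
    (hg : AlphaLe H (W \ ({a} ∪ {b})) 7) : False := by
  obtain ⟨e, heW, hae, hne⟩ := exists_adj_ne hW (u := b) haW
  exact not_good_two_one hW haW heW hbW hae hab.symm hne.symm
    (hg.sdiff_mono (Finset.union_subset_union (by simp) subset_rfl))

theorem card_le_four {W : Finset ℕ} (hW : Nineteen H W) {C C' : Finset ℕ}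
    (hC : H.IsClique (C : Set ℕ))
    (hC' : H.IsClique (C' : Set ℕ)) (hCW : C ∪ C' ⊆ W) (hg : AlphaLe H (W \ (C ∪ C')) 7) :
    (C ∪ C').card ≤ 4 := by
  have := hg.two_mul_lt (hW.three.sdiff_union hC hC') (by omega)
  rw [Finset.card_sdiff_of_subset hCW, hW.card] at this
  omega

theorem not_good_three_one {W : Finset ℕ} (hW : Nineteen H W) {a b c d : ℕ}
    (haW : a ∈ W) (hbW : b ∈ W) (hcW : c ∈ W) (hdW : d ∈ W)
    (hab : H.Adj a b) (hbc : H.Adj b c) (hac : H.Adj a c) (hda : d ≠ a) (hdb : d ≠ b)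
    (hdc : d ≠ c) (hg : AlphaLe H (W \ ({a, b, c} ∪ {d})) 7) : False := by
  obtain ⟨e, heW, hde, -⟩ := exists_adj_ne hW (u := d) hdW
  by_cases hin : e = a ∨ e = b ∨ e = c
  · rcases hin with rfl | rfl | rfl
    · refine not_good_two_two hW hdW hbW hcW haW hde hbc hdb hdc hab.ne hac.ne
        (hg.sdiff_mono ?_)
      intro v; simp only [Finset.mem_union, Finset.mem_insert, Finset.mem_singleton]; tauto
    · refine not_good_two_two hW hdW haW hcW hbW hde hac hda hdc hab.ne' hbc.ne
        (hg.sdiff_mono ?_)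
      intro v; simp only [Finset.mem_union, Finset.mem_insert, Finset.mem_singleton]; tauto
    · refine not_good_two_two hW hdW haW hbW hcW hde hab hda hdb hac.ne' hbc.ne'
        (hg.sdiff_mono ?_)
      intro v; simp only [Finset.mem_union, Finset.mem_insert, Finset.mem_singleton]; tauto
  · push Not at hin
    have h3 : ({a, b, c} : Finset ℕ).card = 3 :=
      Finset.card_eq_three.2 ⟨a, b, c, hab.ne, hac.ne, hbc.ne, rfl⟩
    have := card_le_four hW (C := {a, b, c}) (C' := {d, e})
      (by simp [SimpleGraph.isClique_insert, hab, hbc, hac]) (clique_pair hde) (by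
        intro v hv
        simp only [Finset.mem_union, Finset.mem_insert, Finset.mem_singleton] at hv
        rcases hv with (rfl | rfl | rfl) | (rfl | rfl) <;> assumption)
      (hg.sdiff_mono (Finset.union_subset_union subset_rfl (by simp)))
    rw [Finset.card_union_of_disjoint (by
      simp [hda, hdb, hdc, hin.1, hin.2.1, hin.2.2]), h3,
      Finset.card_pair hde.ne] at this
    omega

theorem not_good_disjoint {W : Finset ℕ} (hW : Nineteen H W) {C C' : Finset ℕ}
    (hC : H.IsClique (C : Set ℕ))
    (hC' : H.IsClique (C' : Set ℕ)) (hCW : C ⊆ W) (hCW' : C' ⊆ W) (hd : Disjoint C C')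
    (hle : C'.card ≤ C.card) (hg : AlphaLe H (W \ (C ∪ C')) 7) : False := by
  have h4 := card_le_four hW hC hC' (Finset.union_subset hCW hCW') hg
  rw [Finset.card_union_of_disjoint hd] at h4
  have hpos : 0 < C'.card := by
    by_contra h0
    have h0 : C' = ∅ := Finset.card_eq_zero.1 (by omega)
    subst h0
    rw [Finset.union_empty] at hg
    exact not_good_clique hW hC hg
  obtain h | h | h | h : (C.card = 1 ∧ C'.card = 1) ∨ (C.card = 2 ∧ C'.card = 1) ∨
      (C.card = 2 ∧ C'.card = 2) ∨ (C.card = 3 ∧ C'.card = 1) := by omega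
  · obtain ⟨a, rfl⟩ := Finset.card_eq_one.1 h.1
    obtain ⟨b, rfl⟩ := Finset.card_eq_one.1 h.2
    exact not_good_one_one hW (hCW (by simp)) (hCW' (by simp)) (by simpa using hd) hg
  · obtain ⟨a, b, hab, rfl⟩ := Finset.card_eq_two.1 h.1
    obtain ⟨d, rfl⟩ := Finset.card_eq_one.1 h.2
    simp only [Finset.disjoint_singleton_right, Finset.mem_insert, Finset.mem_singleton,
      not_or] at hd
    exact not_good_two_one hW (hCW (by simp)) (hCW (by simp)) (hCW' (by simp))
      (hC (by simp) (by simp) hab) hd.1 hd.2 hg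
  · obtain ⟨a, d, had, rfl⟩ := Finset.card_eq_two.1 h.1
    obtain ⟨b, c, hbc, rfl⟩ := Finset.card_eq_two.1 h.2
    simp only [Finset.disjoint_left, Finset.mem_insert, Finset.mem_singleton, not_or,
      forall_eq_or_imp, forall_eq] at hd
    exact not_good_two_two hW (hCW (by simp)) (hCW' (by simp)) (hCW' (by simp))
      (hCW (by simp)) (hC (by simp) (by simp) had) (hC' (by simp) (by simp) hbc)
      hd.1.1 hd.1.2 hd.2.1 hd.2.2 hg
  · obtain ⟨a, b, c, hab, hac, hbc, rfl⟩ := Finset.card_eq_three.1 h.1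
    obtain ⟨d, rfl⟩ := Finset.card_eq_one.1 h.2
    simp only [Finset.disjoint_singleton_right, Finset.mem_insert, Finset.mem_singleton,
      not_or] at hd
    exact not_good_three_one hW (hCW (by simp)) (hCW (by simp)) (hCW (by simp))
      (hCW' (by simp)) (hC (by simp) (by simp) hab) (hC (by simp) (by simp) hbc)
      (hC (by simp) (by simp) hac) hd.1 hd.2.1 hd.2.2 hg

theorem not_robust_three {W : Finset ℕ} (hW : Nineteen H W) : False := by
  by_cases hg : ∃ C C' : Finset ℕ, H.IsClique (C : Set ℕ) ∧ H.IsClique (C' : Set ℕ) ∧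
      AlphaLe H (W \ (C ∪ C')) 7
  · obtain ⟨C, C', hC, hC', hg⟩ := hg
    have hsub : ∀ {X Y : Finset ℕ}, Y ⊆ X → H.IsClique (X : Set ℕ) → H.IsClique (Y : Set ℕ) :=
      fun h h' => Set.Pairwise.mono (by exact_mod_cast h) h'
    have hg' : AlphaLe H (W \ (W ∩ C ∪ (W ∩ C') \ C)) 7 := by
      refine hg.mono ?_ le_rfl
      intro v
      simp only [Finset.mem_sdiff, Finset.mem_union, Finset.mem_inter]
      tauto
    have h1 := hsub (Y := W ∩ C) Finset.inter_subset_right hC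
    have h2 := hsub (Y := (W ∩ C') \ C) (Finset.sdiff_subset.trans Finset.inter_subset_right) hC'
    have h3 : W ∩ C ⊆ W := Finset.inter_subset_left
    have h4 : (W ∩ C') \ C ⊆ W := Finset.sdiff_subset.trans Finset.inter_subset_left
    have hd : Disjoint (W ∩ C) ((W ∩ C') \ C) :=
      Finset.disjoint_of_subset_left Finset.inter_subset_right Finset.disjoint_sdiff
    rcases le_total ((W ∩ C') \ C).card (W ∩ C).card with hle | hle
    · exact not_good_disjoint hW h1 h2 h3 h4 hd hle hg'
    · rw [Finset.union_comm] at hg'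
      exact not_good_disjoint hW h2 h1 h4 h3 hd.symm hle hg'
  · push Not at hg
    have hR := robust_two_of_forall hW.alpha hg
    obtain ⟨a, haW, d, hdW, had⟩ := hW.alpha.exists_adj hW.one 
      (Finset.card_pos.1 (by have := hW.card; omega))
    have h17 : (W \ {a, d}).card = 2 * 8 + 1 := by
      rw [Finset.card_sdiff_of_subset (by
        intro v hv
        simp only [Finset.mem_insert, Finset.mem_singleton] at hv
        rcases hv with rfl | rfl <;> assumption), Finset.card_pair had.ne, hW.card]
    obtain ⟨w, hw⟩ := Finset.card_pos.1 (show 0 < (W \ {a, d}).card by omega)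
    have hpm := pm_erase (hW.alpha.mono Finset.sdiff_subset le_rfl) (hR.sdiff (clique_pair had)) h17 hw
    simp only [Finset.mem_sdiff, Finset.mem_insert, Finset.mem_singleton, not_or] at hw
    refine false_of_edge (w := w) (a := a) (d := d) hW.card hW.alpha hR ?_ ?_ ?_ had hpm
    · ext v
      simp only [List.toFinset_cons, List.toFinset_nil, Finset.mem_union, Finset.mem_insert,
        Finset.mem_erase, Finset.mem_sdiff, Finset.mem_singleton, Finset.notMem_empty, or_false]
      constructor
      · intro hv
        by_cases h1 : v = w
        · exact Or.inl (Or.inl h1)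
        · by_cases h2 : v = a ∨ v = d
          · exact Or.inl (Or.inr h2)
          · exact Or.inr ⟨h1, hv, h2⟩
      · rintro ((rfl | rfl | rfl) | h)
        exacts [hw.1, haW, hdW, h.2.1]
    · simp [hw, had.ne]
    · simp

/-- Deleting four edges on the larger side of a split. -/
theorem not_robust_split {W V V' : Finset ℕ} {a a' : ℕ} (hU : W ⊆ V ∪ V') (haa : a + a' = 9)
    (h5 : 5 ≤ a) (hVc : V.card = 2 * a + 1) (hVa : AlphaLe H V a) (hVa' : AlphaLe H V' a')
    (hVr : Robust H V 1 a) (hr : Robust H W 4 7) : False := by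
  obtain ⟨v, hv⟩ := Finset.card_pos.1 (show 0 < V.card by omega)
  have hcard := Finset.card_erase_of_mem hv
  obtain ⟨L, hl, hL, hS⟩ := (pm_erase hVa hVr hVc hv).remove 4 (by omega)
  obtain ⟨S, hSW, hSi, hSc, hSd⟩ := hr L hl hL
  have h1 := hS S hSi hSd
  have h2 := hVa' (S ∩ V') Finset.inter_subset_right (indep_mono hSi Finset.inter_subset_left)
  have h3 : S ⊆ insert v (S ∩ V.erase v ∪ S ∩ V') := by
    intro u hu
    have := Finset.mem_union.1 (hU (hSW hu))
    simp only [Finset.mem_insert, Finset.mem_union, Finset.mem_inter, Finset.mem_erase, hu,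
      true_and]
    tauto
  have h4 := (Finset.card_le_card h3).trans (Finset.card_insert_le _ _)
  have h6 := Finset.card_union_le (S ∩ V.erase v) (S ∩ V')
  omega

theorem not_robust_four {W : Finset ℕ} (hc : W.card = 20) (ha : AlphaLe H W 9)
    (hr : Robust H W 1 9) (hr4 : Robust H W 4 7) : False := by
  rcases pm_or_split ha hr (by omega) with
    h | ⟨V, V', a, a', hd, hU, hno, haa, hVc, hVc', hVa, hVa', hVr, hVr'⟩
  · obtain ⟨L, hl, hL, hS⟩ := h.remove 4 (by omega)
    obtain ⟨S, hSW, hSi, hSc, hSd⟩ := hr4 L hl hL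
    have := hS S hSi hSd
    rw [Finset.inter_eq_left.2 hSW] at this
    omega
  · rcases le_or_gt 5 a with h5 | h5
    · exact not_robust_split hU.superset haa h5 hVc hVa hVa' hVr hr4
    · exact not_robust_split (Finset.union_comm V V' ▸ hU.superset) (Nat.add_comm a' a ▸ haa)
        (by omega) hVc' hVa' hVa hVr' hr4

theorem not_robust_five {W : Finset ℕ} (hc : W.card = 21) (ha : AlphaLe H W 10)
    (hr : Robust H W 1 10) (hr5 : Robust H W 5 7) : False := by
  obtain ⟨v, hv⟩ := Finset.card_pos.1 (show 0 < W.card by omega)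
  have hcard := Finset.card_erase_of_mem hv
  obtain ⟨L, hl, hL, hS⟩ := (pm_erase ha hr (by omega) hv).remove 5 (by omega)
  obtain ⟨S, hSW, hSi, hSc, hSd⟩ := hr5 L hl hL
  have h1 := hS S hSi hSd
  have h3 : S ⊆ insert v (S ∩ W.erase v) := by
    intro u hu
    have := hSW hu
    simp only [Finset.mem_insert, Finset.mem_inter, Finset.mem_erase, hu, this]
    tauto
  have h4 := (Finset.card_le_card h3).trans (Finset.card_insert_le _ _)
  omega

/-- Enlarging the vertex set by vertices adjacent to all other vertices. -/
theorem exists_pad (H : SimpleGraph ℕ) {W : Finset ℕ} {n : ℕ} (hn : W.card ≤ n) :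
    ∃ (H' : SimpleGraph ℕ) (W' : Finset ℕ), W'.card = n ∧
      (∀ k, 0 < k → AlphaLe H W k → AlphaLe H' W' k) ∧
      ∀ r k, Robust H W r k → Robust H' W' r k := by
  obtain ⟨W', hWW', hc⟩ := Infinite.exists_superset_card_eq W n hn
  refine ⟨⟨fun u v => u ≠ v ∧ (u ∉ W ∨ v ∉ W ∨ H.Adj u v), ⟨fun u v h => ⟨h.1.symm, ?_⟩⟩,
    ⟨fun u h => h.1 rfl⟩⟩, W', hc, ?_, ?_⟩
  · rcases h.2 with h | h | h
    exacts [Or.inr (Or.inl h), Or.inl h, Or.inr (Or.inr h.symm)]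
  · intro k hk ha S hS hi
    by_cases hSW : S ⊆ W
    · exact ha S hSW fun u hu v hv huv h => hi hu hv huv ⟨huv, Or.inr (Or.inr h)⟩
    · obtain ⟨u, hu, huW⟩ := Finset.not_subset.1 hSW
      have : S ⊆ {u} := by
        intro v hv
        rw [Finset.mem_singleton]
        by_contra hvu
        exact hi hu hv (Ne.symm hvu) ⟨Ne.symm hvu, Or.inl huW⟩
      have := Finset.card_le_card this
      rw [Finset.card_singleton] at this
      omega
  · intro r k hr L hL hcl
    obtain ⟨S, hS, hi, hSc, hd⟩ := hr (L.map fun C => C ∩ W) (by simpa using hL) (by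
      intro C hC
      obtain ⟨D, hD, rfl⟩ := List.mem_map.1 hC
      intro u hu v hv huv
      rw [Finset.mem_coe, Finset.mem_inter] at hu hv
      rcases (hcl D hD hu.1 hv.1 huv).2 with h | h | h
      exacts [absurd hu.2 h, absurd hv.2 h, h])
    refine ⟨S, hS.trans hWW', ?_, hSc, fun C hC => ?_⟩
    · intro u hu v hv huv h
      rcases h.2 with h | h | h
      exacts [h (hS hu), h (hS hv), hi hu hv huv h]
    · rw [Finset.disjoint_left]
      intro v hv hvC
      exact Finset.disjoint_left.1 (hd _ (List.mem_map_of_mem hC)) hv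
        (Finset.mem_inter.2 ⟨hvC, hS hv⟩)

theorem not_robust (r : ℕ) (hr2 : 2 ≤ r) : ∀ (H : SimpleGraph ℕ) (W : Finset ℕ),
    W.card ≤ r + 16 → AlphaLe H W (r + 5) → ¬ Robust H W r 7 := by
  induction r, hr2 using Nat.le_induction with
  | base =>
    intro H W hc ha hr
    obtain ⟨H', W', hc', ha', hr'⟩ := exists_pad H hc
    exact not_robust_two hc' (ha' _ (by omega) ha) (hr' _ _ hr)
  | succ r hr2 ih =>
    intro H W hc ha hr
    obtain ⟨H', W', hc', ha', hr'⟩ := exists_pad H hc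
    have ha := ha' _ (by omega) ha
    have hr := hr' _ _ hr
    clear ha' hr'
    by_cases hg : ∃ C : Finset ℕ, H'.IsClique (C : Set ℕ) ∧ AlphaLe H' (W' \ C) (r + 5)
    · obtain ⟨C, hC, hCa⟩ := hg
      obtain ⟨D, hD, hDa, hDW⟩ : ∃ D : Finset ℕ, H'.IsClique (D : Set ℕ) ∧
          AlphaLe H' (W' \ D) (r + 5) ∧ (D ∩ W').Nonempty := by
        by_cases hne : (C ∩ W').Nonempty
        · exact ⟨C, hC, hCa, hne⟩
        · obtain ⟨v, hv⟩ := Finset.card_pos.1 (show 0 < W'.card by omega)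
          rw [Finset.not_nonempty_iff_eq_empty, ← Finset.disjoint_iff_inter_eq_empty] at hne
          rw [Finset.sdiff_eq_self_of_disjoint hne.symm] at hCa
          exact ⟨{v}, clique_singleton v, hCa.mono Finset.sdiff_subset le_rfl, v, by simp [hv]⟩
      refine ih H' (W' \ D) ?_ hDa (hr.sdiff hD)
      have h1 := Finset.card_pos.2 hDW
      have h2 := Finset.card_sdiff_add_card_inter W' D
      rw [Finset.inter_comm] at h2
      omega
    · push Not at hg
      have hR : Robust H' W' 1 (r + 1 + 5) :=
        robust_one_of_forall (k := r + 5) (by simpa [Nat.add_right_comm] using ha) hg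
      have hlt := ha.two_mul_lt hR (by omega)
      obtain rfl | rfl | rfl : r = 2 ∨ r = 3 ∨ r = 4 := by omega
      · exact not_robust_three ⟨hc', ha, hR, hr⟩
      · exact not_robust_four hc' ha hR hr
      · exact not_robust_five hc' ha hR hr

end

end Folkman

namespace Folkman

open Finset

/-! ### The lower bound -/

/-- The complement of a graph on `Fin n`, as a graph on `ℕ`. -/
def complNat {n : ℕ} (G : SimpleGraph (Fin n)) : SimpleGraph ℕ := Gᶜ.map Fin.valEmbedding

theorem complNat_adj {n : ℕ} {G : SimpleGraph (Fin n)} {u v : Fin n} :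
    (complNat G).Adj u v ↔ u ≠ v ∧ ¬ G.Adj u v := by
  rw [← SimpleGraph.compl_adj]
  exact SimpleGraph.map_adj_apply (f := Fin.valEmbedding)

theorem complNat_isIndepSet_map {n : ℕ} {G : SimpleGraph (Fin n)} {T : Finset (Fin n)}
    (hT : G.IsClique (T : Set (Fin n))) :
    (complNat G).IsIndepSet (T.map Fin.valEmbedding : Set ℕ) := by
  rw [Finset.coe_map]
  rintro _ ⟨u, hu, rfl⟩ _ ⟨v, hv, rfl⟩ huv h
  have h' := complNat_adj.1 h
  exact h'.2 (hT hu hv h'.1)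

theorem alphaLe_complNat {n k : ℕ} {G : SimpleGraph (Fin n)} (hG : G.CliqueFree (k + 1)) :
    AlphaLe (complNat G) (range n) k := by
  intro S hS hi
  obtain ⟨T, rfl⟩ : ∃ T : Finset (Fin n), T.map Fin.valEmbedding = S := by
    refine ⟨univ.filter fun i => i.val ∈ S, ?_⟩
    ext i
    simp only [mem_map, mem_filter, mem_univ, true_and, Fin.valEmbedding_apply]
    exact ⟨fun ⟨j, hj, h⟩ => h ▸ hj, fun h => ⟨⟨i, mem_range.1 (hS h)⟩, h, rfl⟩⟩
  rw [card_map]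
  by_contra hlt
  have hT : G.IsClique (T : Set (Fin n)) := by
    intro u hu v hv huv
    by_contra h
    exact hi (mem_coe.2 (mem_map_of_mem _ hu)) (mem_coe.2 (mem_map_of_mem _ hv))
      (fun h' => huv (Fin.ext h')) (complNat_adj.2 ⟨huv, h⟩)
  obtain ⟨T', hT', hc⟩ := exists_subset_card_eq (show k + 1 ≤ T.card by omega)
  exact hG T' ⟨hT.subset (coe_subset.2 hT'), hc⟩

theorem exists_coloring {ι : Type*} [Fintype ι] [DecidableEq ι] (w : ι → ℕ) (i₀ : ι) {r : ℕ}
    (hr : ∑ i ∈ univ.erase i₀, w i = r) :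
    ∃ φ : Fin r → ι, (∀ j, φ j ≠ i₀) ∧ ∀ i, (univ.filter fun j => φ j = i).card ≤ w i := by
  have hc : Fintype.card (Σ i : (univ.erase i₀ : Finset ι), Fin (w i)) = r := by
    rw [Fintype.card_sigma, ← hr]
    simp only [Fintype.card_fin]
    exact Finset.sum_coe_sort (univ.erase i₀) w
  let e := (Fintype.equivFinOfCardEq hc).symm
  refine ⟨fun j => (e j).1, fun j => (mem_erase.1 (e j).1.2).1, fun i => ?_⟩
  rw [← Finset.card_range (w i)]
  refine card_le_card_of_injOn (fun j => (e j).2.val) ?_ ?_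
  · intro j hj
    have hj' : ((e j).1 : ι) = i := by simpa using hj
    have := (e j).2.isLt
    simpa [hj'] using this
  · intro j hj k hk h
    have hj' : ((e j).1 : ι) = i := by simpa using hj
    have hk' : ((e k).1 : ι) = i := by simpa using hk
    apply e.injective
    have h1 : (e j).1 = (e k).1 := Subtype.ext (hj'.trans hk'.symm)
    exact Sigma.ext h1 ((Fin.heq_ext_iff (by rw [h1])).2 h)

theorem robust_complNat {n : ℕ} {G : SimpleGraph (Fin n)} {a : List ℕ} (hA : VArrow G a)
    (hpos : ∀ x ∈ a, 0 < x) (i₀ : Fin a.length) {r : ℕ}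
    (hr : ∑ i ∈ univ.erase i₀, (a.get i - 1) = r) :
    Robust (complNat G) (range n) r (a.get i₀) := by
  classical
  obtain ⟨φ, hφ, hφc⟩ := exists_coloring (fun i => a.get i - 1) i₀ hr
  intro L hL hcl
  subst hL
  have hch : ∀ v : Fin n, ∃ c : Fin a.length,
      (c = i₀ ∧ ∀ j, v.val ∉ L.get j) ∨ ∃ j, φ j = c ∧ v.val ∈ L.get j := by
    intro v
    by_cases h : ∃ j, v.val ∈ L.get j
    · obtain ⟨j, hj⟩ := h
      exact ⟨φ j, Or.inr ⟨j, rfl, hj⟩⟩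
    · push Not at h
      exact ⟨i₀, Or.inl ⟨rfl, h⟩⟩
  choose c hc using hch
  obtain ⟨i, s, hs, hsc⟩ := hA c
  by_cases hi : i = i₀
  · subst hi
    refine ⟨s.map Fin.valEmbedding, ?_, complNat_isIndepSet_map hs.1, by rw [card_map, hs.2], ?_⟩
    · intro x hx
      obtain ⟨v, -, rfl⟩ := mem_map.1 hx
      exact mem_range.2 v.isLt
    · intro C hC
      obtain ⟨j, rfl⟩ := List.mem_iff_get.1 hC
      rw [disjoint_left]
      intro x hx
      obtain ⟨v, hv, rfl⟩ := mem_map.1 hx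
      rcases hc v with h | ⟨k, h, -⟩
      · exact h.2 j
      · exact absurd (h.trans (hsc v hv)) (hφ k)
  · exfalso
    have hex : ∀ v : s, ∃ j, φ j = i ∧ v.1.val ∈ L.get j := by
      rintro ⟨v, hv⟩
      rcases hc v with h | ⟨k, h, h'⟩
      · exact absurd ((hsc v hv).symm.trans h.1) hi
      · exact ⟨k, h.trans (hsc v hv), h'⟩
    choose f hf hf' using hex
    have hinj : Function.Injective f := by
      intro u v huv
      by_contra hne
      have hne' : u.1 ≠ v.1 := fun h => hne (Subtype.ext h)
      have h1 := hf' u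
      rw [huv] at h1
      have := hcl _ (L.get_mem (f v)) (mem_coe.2 h1) (mem_coe.2 (hf' v))
        (fun h => hne' (Fin.ext h))
      exact (complNat_adj.1 this).2 (hs.1 u.2 v.2 hne')
    have h1 : s.card ≤ (univ.filter fun j => φ j = i).card := by
      rw [← Fintype.card_coe s, ← Finset.card_univ]
      exact card_le_card_of_injOn f (fun v _ => by simp [hf v]) hinj.injOn
    have h2 := hφc i
    have h3 := hpos _ (a.get_mem i)
    rw [hs.2] at h1
    have : a.get i ≤ a.get i - 1 := h1.trans h2
    omega

theorem sum_get_sub_one (a : List ℕ) :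
    ∑ i : Fin a.length, (a.get i - 1) = (a.map (· - 1)).sum := by
  rw [← Fin.sum_univ_getElem]
  exact Fintype.sum_equiv (finCongr (by simp)) _ _ fun i => by simp

theorem add_ten_le_of_vArrow {n m : ℕ} {G : SimpleGraph (Fin n)} {a : List ℕ}
    (hpos : ∀ x ∈ a, 0 < x) (h7 : 7 ∈ a) (hm : m = (a.map (· - 1)).sum + 1) (hm9 : 9 ≤ m)
    (hG : G.CliqueFree (m - 1)) (hA : VArrow G a) : m + 10 ≤ n := by
  obtain ⟨i₀, h⟩ := List.mem_iff_get.1 h7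
  have hsum : ∑ i : Fin a.length, (a.get i - 1) = m - 1 := by
    rw [hm, Nat.add_sub_cancel, sum_get_sub_one]
  rw [← Finset.add_sum_erase _ _ (mem_univ i₀), h] at hsum
  have hR := robust_complNat hA hpos i₀ rfl
  rw [h, show ∑ i ∈ univ.erase i₀, (a.get i - 1) = m - 7 by omega] at hR
  by_contra hlt
  refine not_robust (m - 7) (by omega) _ _ ?_ (alphaLe_complNat ?_) hR
  · rw [card_range]; omega
  · rwa [show m - 7 + 5 + 1 = m - 1 by omega]

end Folkman

namespace Folkman

/-! ### Certificates for the upper bound -/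

/-- Whether the set `c` contains `k` pairwise non-adjacent vertices. -/
noncomputable def ind (E fuel : ℕ) : ℕ → ℕ → Bool :=
  Nat.rec (fun _ k => Nat.beq k 0) (fun _ ih c k => Nat.rec true (fun k' _ =>
    bif Nat.beq c 0 then false else
      frc (Nat.log2 c) fun u => frc (Nat.xor c (Nat.shiftLeft 1 u)) fun c' =>
      frc (Nat.xor c' (Nat.land c' (row E u))) fun c'' =>
        bif ih c'' k' then true else ih c' (Nat.succ k')) k) fuel

noncomputable def symE (n E : ℕ) : Bool :=
  allN (fun a => allN (fun b => bif hasE E a b then hasE E b a else true) n) n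

/-- No vertex of the set `m` has a neighbor in `m`. -/
noncomputable def indSet (n E m : ℕ) : Bool :=
  allN (fun i => bif tb m i then Nat.beq (Nat.land (row E i) m) 0 else true) n

/-- Record that `v` has to avoid the first color class, as otherwise that class would contain `s`
independent vertices. -/
noncomputable def hAvoid (E n s : ℕ) (ih : ℕ → ℕ → ℕ → List ℕ → Res)
    (A B c : ℕ) (rest : List ℕ) : Res :=
  frc (fld c 1) fun v => frc (Nat.xor A (Nat.land A (row E v))) fun A' =>
    bif ind E n A' (Nat.pred s) then
    bif tb A v then none else bif Nat.blt v n then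
      frc (Nat.lor B (Nat.shiftLeft 1 v)) fun B' => frc (Nat.shiftRight c 6) fun c' =>
        ih A B' c' rest
    else none else none

/-- Branch on the largest vertex of the first color in a set of `t` independent vertices. -/
noncomputable def hBranch (E n t : ℕ) (ih : ℕ → ℕ → ℕ → List ℕ → Res)
    (A B c : ℕ) (rest : List ℕ) : Res :=
  frc (Nat.land (Nat.shiftRight c 1) (ones n)) fun I =>
    bif indSet n E I then bif Nat.ble t (cnt I n) then
      frc (Nat.shiftRight c 23) fun c' =>
        forN n (fun v c rest => bif tb I v then bif tb B v then some (c, rest) else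
          frc (Nat.lor A (Nat.shiftLeft 1 v)) fun A' =>
          frc (Nat.lor B (Nat.shiftLeft (Nat.shiftRight I (Nat.succ v)) (Nat.succ v))) fun B' =>
            ih A' B' c rest
          else some (c, rest)) c' rest
    else none else none

noncomputable def split (E n s t fuel : ℕ) : ℕ → ℕ → ℕ → List ℕ → Res :=
  Nat.rec (fun _ _ _ _ => none) (fun _ ih A B c rest =>
    nxt (fun c rest => bif tb c 0 then hBranch E n t ih A B c rest
      else hAvoid E n s ih A B c rest) c rest) fuel

noncomputable def splitOk (E n s t : ℕ) (code : List ℕ) : Bool :=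
  Option.rec false (fun _ => true) (split E n s t 200 0 0 1 code)

end Folkman

namespace Folkman

/-! ### The two graphs -/

/-- A graph with 21 vertices. -/
noncomputable def edges21 : ℕ :=
  1346996718341117484295580094873265326582468979758484625982763206503405783019213674100299628030070045321164591685905390741936613944643192089385517508368662574852601340387062757291568840967075672637506

/-- A graph with 22 vertices. -/
noncomputable def edges22 : ℕ :=
  293932999802862938656223908294040714022901271852213476892763683496607539927900206662683533067354891024929393281398992490364741820440921931575836938480746566970188711625338473390732404747566545000749090816

noncomputable def split21 : List ℕ :=
  [77015520132220063029309709127501524999386760252157051198559303959787673337253479209640295811468233856674339318021205463529578043289998396790864875235204471294726846586417247342758282837936216939582961536392184803823715736318667471619293479168122445066709579231245239967592092052350247183108553626029680094529176243273851931684703967403534209077781588965953047269597653046586373233070967530283401052577143952214431340172587,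
   7714918697938248641963206593049251439433886123786056320325198130183705725677507849719993120184586062240527775827056294130423618256849087266227054180734619485240988188608664255944839265423582045570442717036057711881384540064737830821084298441601962281226555283297547871835505974131276077505622391167574288193257625489005557599453227499882795730382354861778790255140490381700990967783015914984632137800291423586810081618869652182,
   470814769820582525197736239016216312957905789768529215731371749384106782493184536988688819410373278273475646787318289679680171662622533401852486280905105711174389757754591947566710669388704850060766298456802104364274242267970263264343622724665135618822445651844250743553204373966046161832051751839440819191087488896983093045601576141490724450213627634264858338867366557888979826699812519288085470000232359298186850755723904,
   60877421633214890728757006845738185124309413372805747541234287742703261185320329191660474649617271241069134158410345360438693053765316592275394668887350898313118055883959672018734985382848096904186390769780344739681569334959862016488873558042425519669705339454681254884953461051841285159464005227750876710932052423265626028364186061655097431050559518686260817477547296093726336375113719038805552588190713360774502586776059013004,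
   21436054295858621304482558126562490595954363043796667423037047990482477880371621920898750748500418421845469227771083441162]

noncomputable def split22a : List ℕ :=
  [2669388422562058520905217281002983646076300369328578641908185239864164678390628326429787288752067677881049581361514540422305304860987306122345582141653278491155750722392525089770003103087478344287896529568320943301556658721334286517484777763550248907035575070753267724395457078079854487215029337353879837634639292302474760046875215733804875309851377878495097927658642343216876997526585331352542081770633917235271640582979839,
   3626707112519373305776708598197951620954805191001650525556869181939983565425113952051476747849925940572208000083152632855272078028925481941682979294778106338497634516218070142266100301406202665702656428429420134345143957373237236689928307974232436457759971888537155606161173326722438939186673614365317571531080350405625572643264430906867366129853966357973324316669504248393926537467536981718290647347882955403514581462682602,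
   486107433764228009826114623666423047410586701284384375981805433452340043054741052520212264092975374792987980128023421564436311475500267407177885355820908885896781561342856123076750616520023067183187882465091265400303788161283269552747361463230078209036546165586624370096130162688078276198271895124449793161724569305502524020016760297004175558429270682898618838007615078664831109457849358993180103378113512875296176481461354624,
   58885231089999534754340257340579079824300173141330178618803912339887711875151105315100604044324066727242202028243267880232652687497631539479479293028675034623904838342706010887603622497410115380505201673924099245098240848144337155467259618048986229638487127628177074128111465220856363017649785510799034168610912797483817602889300199905542074434877437861039374192521254326376967895849324147037677903256478809577384629452292427,
   443686450107475424427082620662840923462460715884368818766092281475620094076881454944344212695629972607614845097222312719451791509530488031429794563921877094944952877656444077798883374087445963090754607395582825237761883541590322177653930753781991490986514137722684371653943268591720080024467689516270686075868245796960560637036679251144600640867726282206338294129462001839311528629237249865761184835260312341311124595298410,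
   1466817667632252177508450381097248209580466479809435620699538066784205084155943198144843628847768272339399254694696738567502961112291581140145056168966399622457453922961056663039575028270729471167501762910801426925628700039843582159597585907222761859195409738484663817578273382327828984218802481193682764107969157238306715882877991882576371777052737325539734707269165125204063018443097854265993447581345594166099778813837440,
   14685995254818360405990196107921636064492131874179668590501430481233119793013425963859603908257414080733962803644343431987585919459195765420964843999647625345686786016827323478567973230158146190620183090045887921875481433596540327320965896716362207948442655038392821555862975364045207933098210840276009342391728260009997723199399209850791597471541357940115227711677411587624613786813362748254624466827705010573718588368700961,
   2324201921406489736288213303405740497066544424558644686723660558972435889193327956504221373344948205456574986630457820009070692689925388646235772932336479219493179666378676665540967446445877797733744617766376919939820828965807429261239401543598147877767098267832165683570179202966686460488754785963165743655476643451238557407741986405615258549359368931054322943631320645214135546599594725888155012384692521698715161091195360,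
   58024721550449847592952781101737030138830253021769003144933911864164977701612794118921327932351641016145866632462316450395712475723469273057429924824119326188575018524167568033091403558826218323252387272343840699036104278908973458690298621392416800934721723975872328245354118423180952760703746987728780629935475594604636042574453806150830398299651516247625764523009583782383298190482264525615121320019565165271518628942055062,
   72692442609626066887808372474177342921856969914091274750815047863613596325384747635616603177531651379832153854197368724094355655010308735390332031536201881499461254253028455888802985321326976989056013927319720509745844260484940266364525427087213470520612966399952542521239584164536930175525462432898712289283396988745018496769201176495642728929690793690147684179491806967222286819790417326297377314290255372787462478382354,
   3559126956030724975589497392698796982491341295879944659249754927644151711050717530525559077752945406602089874053919700149379985316594170119101177357727354883411543958870000205003936428955051500306548839611151622520046301198585385542107618517100106944056233199012068721561388660716685344211175696998185947047532932895738060500826221664908028366492474212501937147720061731742130220797198422729316106072647114775146474133838502,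
   262257400661866495931927723006322168315527835993339593898252779389461790868288642330295263255020754352639243721820460571335295174553283286099688371938833875523914823627948361058664423541249610542252714852587259550957722563785289920872062631885305220302814534392595494917377407608717642717672953388169755240416394095259871038089975180691995284285991838990229145665759342028122847143630905056979846810556906384811122808242387048864,
   2069686953027056950658058433540959855523072530598110248886833399230149357771843567921885935106141315051148549903164399819917185982360351360392056258258872795636915161361253383617969312337756724154927872114787115239703186790247743420048103309069709476690666416931428565423656740648657520182921463249203715250772679835723874525263445652376181021507563450771690240597926919935607915756755781387104616012989813016262741109798895720,
   1189782245228537309556719311127181383613302124527753120040137390935353215846133118558549150255302761710033036489770395634383724697383891205261151990401931426776137768299113865431877396431096224382799672242397306901156613331625657539766363743491920357392342377709043684946261756399166723484006209483536484006684957569938968188381361936404011618911587244518252611538530298714104552538718496576934292031775482666484734677629184,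
   110922432180298997144201136119561958052197400582478042280745644474835952076581697786074581934323762421153431494231476979389258676380952180971401524024633292674097088627061531042828740202324548232576948866941156421369637786301516074614568942864450609025147626762288748017605866718735702010260026313150922217423253503657840293012963732161208410434036185234653671944471541220539959284682315014799172799233060755447949382010906,
   152762380401049046245022462006979361270847610459129746]

noncomputable def split22b : List ℕ :=
  [326629341840392177588192913230282135157823107432697040988789746087081254383301335396900636366147471510160260701051392984966782424303488675073872786914973320393422767617697872728719043113373070978044572311350638037474480003115859151569584371783011495913326533859256266878031673918112526058368539887657391584233588208170014559942354982820645392546936203891177154331227520888655208134307840815374345190991602677256343143841919,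
   116636988965405615101621905188146162164062621828365981021862718469534389249767324912019241892293235708237480024225846203182062726540118501431652382792846709179075401725712990387336028006450951085345547076289940983724784700306751755371825325318535829666278600131177254690824663882239556908197118130830761568234001292374687770011613785168406541628129544278752883411170731664714589855002634811080460649363728942899254776443385743846,
   7311790648166789599449741286112083385589540843840555674954530697455696290162737244769079366138229079670257452097503248128854254888666087731319329302746932382601750018163394900230806552296300523001203995994575506815446711097321789360547840739533387319399710367171005551907889221984113294992828877501130247850363857337815831866426478031254423635218425310519169622405263203130024529623508391381496659412974792618790853865457002,
   7398720591699905955106602790055464832768531936386397311726434384633068818413451431256510103026563030072945646487927104519125291927749207270126320866644290729492404183819298700147583759157197681480413050076495671309266706921432251568675648749777786696112250637367413482638947698828520101259262844041616823220829773638861824821995872045283070550919446202163111038231226928425229108782159547370131661085573418199684970278817465728,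
   7342781520908995894927437744604224885295847195430129500792387582241854561446114474583138111580017850741487624794724000612913428174278153400727942103199576592333503500374539966129038672264713144743791060850661466912161129627874272425370187450783767675704351729378511631620488874823615009143547641482174961852660318022739931593324176029621409468117609061005767502885583956415789638352945940483317171463796113868108267760334976,
   240388685022244385876858682766717717545387616430722880403251858565776323251286978825327932705629770704737702171709197217742223988006577078686296763098093800118947260440234319385580511561021234782793495166738537087754754248249727750205750038253749931036372141294500823321269783541613756890822447963082422534941274438288135676243322005607042654954455828137016574901625492932982514862762908424402561761815293571529110733645891092868,
   7424058291612896569347551971821929499909620896335512872714918621664646027087380230094591709360032313101379180003928392523425108163163801496775589844640527239438339469168029773436604461699833208612439919417904867466505201093466863790320224951008365986996901444530102450585405752056186978577408015984697320861640385804689230835143286274138308213386626918769546714776180619611349011713065145890689795112008908361772003770174801159,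
   159259263266056292716241113415379325996249964878106930613715451724383840928291038281244670497063384790661188813315301835433991114423367158560007346245496725851186496444422020787215461139151175672999942270750229137061537331488399503044365266608409148387842641111813425394952872261005869056221158435832104011301771756771616933358845492094186520148712858020756528215614552271444848408331462734834721229012546602094510536131483,
   907644863642212932855565355280744131808752314236338057802984079379556438116191897934721850960990875493242183727780609037259191266789725958418991968730309637792654043686118833330584707659110531742305346513393918879254358852180476592962584910850190195979173958086563101391191781670992730543920514072053838074604357642160930863373372560660302318714173163891509933760070009231091779504797320472340244227112281421080734361998338150,
   3889173977078560604225743851819519419144754187344172910188789951726511115854165123977278980649753356176332440179489361013715060106940267455776716493097017821799318982183811591348414431329780907781019925622826308857125756517243780036801977285301981758693811159545254473331307390353401690694390158435676225348880593704346388450986226317889990313301055456605844114616103960926428830156090458714355423984720878900002362955651096995,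
   115603280875415198248604368504170979913289025076965105145927859604501940918566137846118560702227969966767587135194868094105195360949353267544544264435159531826249810462706686113827096787889359727705368984783428738614454861969710646369504869994300193704110524446934237417068830023367387082375024509301494589437744077197904346704524519904492865612189875331260394680328465949822197684287360962519033557473373967794749522485926274,
   414598099620501883689548415843044172403485734603165901935761689759066827871808401768710868493303559583570673680333060950908140022434210001350051986705427276559368355876207482325920946489214491665959024957659872749739909914530142897613337038041403952326039118831203113311119008158538967272921595841918269805173507825591195488601569270636245934631084788035658447755741228914838849740447752839708750783119244934812073284299127458008,
   233275301597373921577772168739243767437489853545485443186737387030109717052636429548839570966832198628526596646001839062005743239153529415123998241754823933755587875621723552501226627688966187552029581362262683248509922800810195622112872118474491242904204716947806686426365749186318977539507875599904383186671030291746377334619811321788995893154387099398679844483903003801948310788397003515602278027709704878180883030652357846800,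
   16840180744817078203831383452840572507881896367960409086280084477499987484376195039882497778363019000115944609938275935650616910873430693019889631306437998304627770542874400343940556774909054047916967623798121250840335175987135246614262379147390278454495796768227804971477227812650784802017329123241626280429932152153322163068816812325575774702022499156266557304230880816501975861401978263330976099298230114078520206963708262,
   86928919491189901589028410374289587885739011777418918430829168853810038995036950278197328543916819683471694892830140420901666383077082017883196939389512125268031170256452708872549954019925765128786242059816047885112921550807168867569096490268340780937938548345074602585523394288828882093947096409941576969856867506165695398586862396311047947441708058468061735939755050711814154167999608639501422888489796719942016614581346,
   43662839109531126447635242463872334761168908831978254443113908462146412396548523311443932519579816025570021122504698186351031286368938473468812574523641053734795676852935724074807648082887699800322055637499651422088600149498319547955409307276845794145785011257886638616990936071850774240912268567441636431577022326740778618950102956833995312686476554960183294158438692749629057103934427915566718122229292907859708679421709649411,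
   942807675670641032110721931072911511102107803678573899758458672344696344014759228142675803416511281964310907319474064704871419451609216040637333835152427538181859134695408763639501411019874492077804458808192051997756545278471530645557197162224663818365390122314881895506966692050187574775532777298450209391218829687515805798852621635204533475313373657224706985725219747476652055280370414338130766281468703828406181129398465,
   2049376258343958883418766374529829353616728859300240053253320245526464459772808133012612379061190740333850035573721191375070291321916280400595032970672550182349012758154614132256269896590612990084749233122037974151622229052365824913350820575313271644724753159702938927211665084933578996323158317412904478720060013429942049740048980939864310355099050118190000972211384478235003959987780193521936369581367068425418242222302208,
   975391088487477498698552390462813294573348036462514588321178657436118403742293334097469694441674480452892213494910511092339861732705053149347971825395710825546920096188625666614514974713309271336855908349038793372471656363391666134309671924522180247677751139537589632571827712094482586415665940105230627884880332247210114099872605067962576760957848676542831361514965577983579698182957748560549679034579167513620309803935376,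
   232721168172704005338342191465263140969740529373043798422172867849908656936473559832445687477556560677018791338967577218777208720059273555759023936628039578114477653176419502824438733176722294476153679385653940317261942150871235084602023759150406867264838794272282020234881483348859820461346304702201886574110970809311436994727615329725709689580161293420298993501943084107255445554880581544779435834576180950077654967395840,
   86134997684925343537921413061489220807047359949712926700820950729425680894082823329193740134287536095601289219735221383051365696412469997362150104744162105129950252165466803301716014967918768731554824378012993762620924597291773170909524049652728663254137204122383227981729604736917003909562243498462564453847365819508613621596649756190957185344529148148736702551640352908387739510431664509411136304486443903813117623602796894,
   114445610804909725393515524356846096132990258855145264539921707565836663729124510357272474506223763856196832640530704080006719298781943557122870840747766051014360036986351009560412021876490482047186321210393774026390740554104221517810206002977095938564753007203490354826404301228591006638126030860645913808513068716899091271522833944936786980121266458558319662391708597959331874094197997821595628751653080905505413336737916816,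
   28336946974973332930849027439876121091658509397136679342390504173792336623546503148983055497624292455192796839375736406400055572434501891426584611041629681436943531222556604339380805696674511158374603828178340305793415721950526225129734109156468974095369247373852415410534908969002581662206258258836897695596925041386062433408040427530127966584201885616961375521590654020568095769766836155297270999490687189252186996013822048,
   3555627796301640902074233502012646309749682438891902519235409050578385023215209026737244514250724698852752804271948933982461062341805385309932319714458448262980666349668409959799097927944346194948568273308689407289625018299905470893627421998071309371028733407513915870619917266384095534888898304995269179859767177451228872205894528255675295975232063232530698387511176465528828978042538446243261018868740430962419390203568247,
   1361917278390480602991364359245133180907473767015867771373667798891916425541834088867911192712234487576176509002269555132421603533721321739851707535230213109806796967275629882876891755327166539749451360639941828526475919774491503115494430360216183330987143500653877487199633318489008214251109394465546469515690016250936147204332970837414211055690658224294924813838699158078507728819637945095988735614220817586164538385383781,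
   55632454778868543009977634307428564198598786699626845298623079072171469064599605680860170931967243613274532377482042101024915865383246876656460470499835801782118941226177043892197801029646108243749169457901922604510131141968509064417459273112171226759740654002756708778651300985526981214963737633438895790268427249516919602540613721]

theorem sym21_ok : (symE 21 edges21) = true := by
  decide +kernel

theorem sym22_ok : (symE 22 edges22) = true := by
  decide +kernel

theorem ind21_ok : (Bool.not (ind edges21 21 (ones 21) 8)) = true := by
  decide +kernel

theorem ind22_ok : (Bool.not (ind edges22 22 (ones 22) 9)) = true := by
  decide +kernel

theorem split21_ok : (splitOk edges21 21 3 7 split21) = true := by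
  decide +kernel

theorem split22a_ok : (splitOk edges22 22 4 7 split22a) = true := by
  decide +kernel

theorem split22b_ok : (splitOk edges22 22 5 6 split22b) = true := by
  decide +kernel

end Folkman

namespace Folkman

open Finset

/-- `S` is independent in the graph with adjacency matrix `E`. -/
def IndE (E : ℕ) (S : Finset ℕ) : Prop := ∀ u ∈ S, ∀ v ∈ S, u ≠ v → hasE E u v = false

theorem IndE.mono {E : ℕ} {S T : Finset ℕ} (h : IndE E T) (hST : S ⊆ T) : IndE E S :=
  fun u hu v hv => h u (hST hu) v (hST hv)

def SymE (n E : ℕ) : Prop := ∀ a < n, ∀ b < n, hasE E a b = hasE E b a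

theorem symE_eq_true {n E : ℕ} (h : symE n E = true) : SymE n E := by
  have key : ∀ a < n, ∀ b < n, hasE E a b = true → hasE E b a = true := by
    intro a ha b hb hab
    have := allN_eq_true (allN_eq_true h a ha) b hb
    rwa [hab] at this
  intro a ha b hb
  exact Bool.eq_iff_iff.2 ⟨key a ha b hb, key b hb a ha⟩

theorem testBit_row {E a j : ℕ} (hj : j < 32) : (row E a).testBit j = hasE E a j := by
  rw [hasE_eq, Bool.eq_iff_iff, row_bit]
  exact and_iff_right hj

theorem testBit_xor_and (a b i : ℕ) :
    (Nat.xor a (Nat.land a b)).testBit i = (a.testBit i && !b.testBit i) := by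
  show (a ^^^ (a &&& b)).testBit i = _
  rw [Nat.testBit_xor, Nat.testBit_and]
  cases a.testBit i <;> cases b.testBit i <;> rfl

theorem testBit_lor_shiftLeft_one (a v i : ℕ) :
    (Nat.lor a (Nat.shiftLeft 1 v)).testBit i = true ↔ a.testBit i = true ∨ i = v := by
  show (a ||| 1 <<< v).testBit i = true ↔ _
  rw [Nat.testBit_or, Nat.one_shiftLeft, Nat.testBit_two_pow, Bool.or_eq_true, decide_eq_true_iff,
    @eq_comm ℕ v]

theorem ind_iff {n E : ℕ} (hE : SymE n E) (hn : n ≤ 32) : ∀ fuel ≤ n, ∀ c < 2 ^ fuel, ∀ k,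
    ind E fuel c k = true ↔ ∃ S : Finset ℕ, (∀ i ∈ S, c.testBit i = true) ∧ IndE E S ∧ S.card = k
    := by
  intro fuel
  induction fuel with
  | zero =>
    intro _ c hc k
    have hk : ind E 0 c k = true ↔ k = 0 := Nat.beq_eq ▸ Iff.rfl
    rw [hk]
    constructor
    · rintro rfl
      exact ⟨∅, by simp, fun u hu => by simp at hu, rfl⟩
    · rintro ⟨S, hS, -, rfl⟩
      rw [card_eq_zero, eq_empty_iff_forall_notMem]
      intro i hi
      exact absurd (testBit_lt hc (hS i hi)) (Nat.not_lt_zero i)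
  | succ fuel ih =>
    intro hf c hc k
    cases k with
    | zero => exact ⟨fun _ => ⟨∅, by simp, fun u hu => by simp at hu, rfl⟩, fun _ => rfl⟩
    | succ k =>
      rcases eq_or_ne c 0 with rfl | hc0
      · refine ⟨fun h => absurd h Bool.false_ne_true, ?_⟩
        rintro ⟨S, hS, -, h⟩
        obtain ⟨i, hi⟩ := card_pos.1 (show 0 < S.card by omega)
        simpa using hS i hi
      have hu : c.testBit c.log2 = true := Nat.testBit_log2 hc0
      have hlt : c.log2 < fuel + 1 := (Nat.log2_lt hc0).2 hc
      set u := c.log2 with hu_def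
      have hmax : ∀ i, c.testBit i = true → i ≤ u := fun i hi =>
        Nat.lt_succ_iff.1 (testBit_lt Nat.lt_log2_self hi)
      let c' := Nat.xor c (Nat.shiftLeft 1 u)
      let c'' := Nat.xor c' (Nat.land c' (row E u))
      have hc' : ∀ i, c'.testBit i = true ↔ c.testBit i = true ∧ i ≠ u := by
        intro i
        show (c ^^^ 1 <<< u).testBit i = true ↔ _
        rw [Nat.testBit_xor, Nat.one_shiftLeft, Nat.testBit_two_pow]
        rcases eq_or_ne u i with h | h
        · subst h; simp [hu]
        · simp [h, h.symm]
      have hc'' : ∀ i, c''.testBit i = true ↔ c'.testBit i = true ∧ hasE E u i = false := by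
        intro i
        rw [testBit_xor_and]
        have : c'.testBit i = true → i < 32 := fun h => by
          have := hmax i ((hc' i).1 h).1
          omega
        by_cases h : c'.testBit i = true
        · rw [h, testBit_row (this h)]; simp
        · simp [h]
      have b' : c' < 2 ^ fuel := by
        refine Nat.lt_pow_two_of_testBit _ fun i hi => ?_
        rw [← Bool.not_eq_true, hc']
        rintro ⟨h1, h2⟩
        have := hmax i h1
        omega
      have b'' : c'' < 2 ^ fuel := by
        refine Nat.lt_pow_two_of_testBit _ fun i hi => ?_
        rw [← Bool.not_eq_true, hc'']
        rintro ⟨h1, -⟩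
        have := testBit_lt b' h1
        omega
      have hrun : ind E (fuel + 1) c (k + 1) = true ↔
          ind E fuel c'' k = true ∨ ind E fuel c' (k + 1) = true := by
        have : ind E (fuel + 1) c (k + 1) = bif Nat.beq c 0 then false else
          bif ind E fuel c'' k then true else ind E fuel c' (k + 1) := rfl
        rw [this, show Nat.beq c 0 = false from
            Bool.eq_false_iff.2 fun h => hc0 (Nat.eq_of_beq_eq_true h)]
        cases ind E fuel c'' k <;> simp
      rw [hrun, ih (by omega) _ b'', ih (by omega) _ b']
      constructor
      · rintro (⟨S, h1, h2, h3⟩ | ⟨S, h1, h2, h3⟩)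
        · have huS : u ∉ S := fun h => ((hc' u).1 ((hc'' u).1 (h1 u h)).1).2 rfl
          refine ⟨insert u S, ?_, ?_, by rw [card_insert_of_notMem huS, h3]⟩
          · intro i hi
            rcases mem_insert.1 hi with rfl | hi
            exacts [hu, ((hc' i).1 ((hc'' i).1 (h1 i hi)).1).1]
          · have hS : ∀ i ∈ S, hasE E u i = false ∧ hasE E i u = false := by
              intro i hi
              have h4 := (hc'' i).1 (h1 i hi)
              have h5 := hmax i ((hc' i).1 h4.1).1
              exact ⟨h4.2, by rw [hE i (by omega) u (by omega)]; exact h4.2⟩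
            intro x hx y hy hxy
            rcases mem_insert.1 hx with rfl | hx <;> rcases mem_insert.1 hy with rfl | hy
            exacts [absurd rfl hxy, (hS y hy).1, (hS x hx).2, h2 x hx y hy hxy]
        · exact ⟨S, fun i hi => ((hc' i).1 (h1 i hi)).1, h2, h3⟩
      · rintro ⟨S, h1, h2, h3⟩
        by_cases huS : u ∈ S
        · refine Or.inl ⟨S.erase u, fun i hi => ?_, h2.mono (erase_subset _ _), ?_⟩
          · obtain ⟨h4, h5⟩ := mem_erase.1 hi
            exact (hc'' i).2 ⟨(hc' i).2 ⟨h1 i h5, h4⟩, h2 u huS i h5 (Ne.symm h4)⟩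
          · rw [card_erase_of_mem huS, h3, Nat.add_sub_cancel]
        · exact Or.inr ⟨S, fun i hi => (hc' i).2 ⟨h1 i hi, fun h => huS (h ▸ hi)⟩, h2, h3⟩

theorem card_lt_of_ind {n E k : ℕ} (hE : SymE n E) (hn : n ≤ 32)
    (h : Bool.not (ind E n (ones n) k) = true) {S : Finset ℕ} (hS : S ⊆ range n)
    (hi : IndE E S) : S.card < k := by
  by_contra hlt
  obtain ⟨T, hT, hc⟩ := exists_subset_card_eq (not_lt.1 hlt)
  have : ind E n (ones n) k = true := by
    refine (ind_iff hE hn n le_rfl _ ?_ k).2 ⟨T, fun i hi => ?_, hi.mono hT, hc⟩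
    · rw [ones_eq]; exact Nat.sub_lt (Nat.two_pow_pos n) one_pos
    · rw [ones_eq, Nat.testBit_two_pow_sub_one]
      simpa using hS (hT hi)
  rw [this] at h
  exact absurd h (by simp)

/-- In every coloring of `range n` with two colors there are `s` independent vertices of the first
color or `t` independent vertices of the second color. -/
def IndArrow (E n s t : ℕ) : Prop := ∀ X : ℕ → Prop,
  (∃ S ⊆ range n, (∀ i ∈ S, X i) ∧ IndE E S ∧ s ≤ S.card) ∨
  (∃ S ⊆ range n, (∀ i ∈ S, ¬ X i) ∧ IndE E S ∧ t ≤ S.card)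

theorem split_sound {E n s t : ℕ} (hE : SymE n E) (hn : n ≤ 32) (hs : 1 ≤ s) (X : ℕ → Prop) :
    ∀ (fuel A B c : ℕ) (rest : List ℕ) (r : ℕ × List ℕ), split E n s t fuel A B c rest = some r →
    (∀ i, A.testBit i = true → X i ∧ i < n) → (∀ i, B.testBit i = true → ¬ X i) →
    (∃ S ⊆ range n, (∀ i ∈ S, X i) ∧ IndE E S ∧ s ≤ S.card) ∨
    (∃ S ⊆ range n, (∀ i ∈ S, ¬ X i) ∧ IndE E S ∧ t ≤ S.card) := by
  intro fuel
  induction fuel with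
  | zero => intro A B c rest r h; cases h
  | succ fuel ih =>
    intro A B c rest r h hA hB
    obtain ⟨c, rest, h⟩ := nxt_some (show nxt (fun c rest => bif tb c 0 then
      hBranch E n t (split E n s t fuel) A B c rest else
      hAvoid E n s (split E n s t fuel) A B c rest) c rest = some r from h)
    cases htag : tb c 0 <;> simp only [htag, cond_true, cond_false] at h
    · unfold hAvoid at h
      simp only [frc_eq] at h
      obtain ⟨h1, h⟩ := bif_none.1 h
      generalize fld c 1 = v at h h1
      cases hv : tb A v <;> rw [hv] at h
      swap
      · cases h
      simp only [cond_false] at h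
      obtain ⟨h2, h⟩ := bif_none.1 h
      have hvn := lt_of_blt h2
      have hbits : ∀ i, (Nat.xor A (Nat.land A (row E v))).testBit i = true →
          A.testBit i = true ∧ hasE E v i = false := by
        intro i hi
        rw [testBit_xor_and, Bool.and_eq_true, Bool.not_eq_true'] at hi
        rw [testBit_row ((hA i hi.1).2.trans_le hn)] at hi
        exact hi
      have hb : Nat.xor A (Nat.land A (row E v)) < 2 ^ n := by
        refine Nat.lt_pow_two_of_testBit _ fun i hi => ?_
        rw [← Bool.not_eq_true]
        intro h'
        exact absurd (hA i (hbits i h').1).2 (not_lt.2 hi)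
      obtain ⟨S, hS1, hS2, hS3⟩ := (ind_iff hE hn n le_rfl _ hb _).1 h1
      by_cases hX : X v
      · have hvS : v ∉ S := fun h' => by
          have := (hbits v (hS1 v h')).1
          rw [← tb_eq, hv] at this
          cases this
        refine Or.inl ⟨insert v S, ?_, ?_, ?_, ?_⟩
        · intro i hi
          rcases mem_insert.1 hi with rfl | hi
          exacts [mem_range.2 hvn, mem_range.2 (hA i (hbits i (hS1 i hi)).1).2]
        · intro i hi
          rcases mem_insert.1 hi with rfl | hi
          exacts [hX, (hA i (hbits i (hS1 i hi)).1).1]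
        · have hS : ∀ i ∈ S, hasE E v i = false ∧ hasE E i v = false := by
            intro i hi
            have h4 := hbits i (hS1 i hi)
            exact ⟨h4.2, by rw [hE i (hA i h4.1).2 v hvn]; exact h4.2⟩
          intro x hx y hy hxy
          rw [mem_insert] at hx hy
          rcases hx with rfl | hx <;> rcases hy with rfl | hy
          exacts [absurd rfl hxy, (hS y hy).1, (hS x hx).2, hS2 x hx y hy hxy]
        · rw [card_insert_of_notMem hvS, hS3, Nat.pred_eq_sub_one]; omega
      · refine ih _ _ _ _ _ h hA fun i hi => ?_
        rcases (testBit_lor_shiftLeft_one _ _ _).1 hi with hi | rfl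
        exacts [hB i hi, hX]
    · unfold hBranch at h
      simp only [frc_eq] at h
      obtain ⟨h1, h⟩ := bif_none.1 h
      obtain ⟨h2, h⟩ := bif_none.1 h
      have hIn : ∀ i, (Nat.land (Nat.shiftRight c 1) (ones n)).testBit i = true → i < n := by
        intro i hi
        rw [ones_eq] at hi
        have hi' : (c >>> 1 &&& 2 ^ n - 1).testBit i = true := hi
        rw [Nat.testBit_and, Nat.testBit_two_pow_sub_one, Bool.and_eq_true,
          decide_eq_true_iff] at hi'
        exact hi'.2
      generalize Nat.land (Nat.shiftRight c 1) (ones n) = I at h h1 h2 hIn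
      rw [cnt_eq] at h2
      have h2 := Nat.le_of_ble_eq_true h2
      have hI : IndE E ((range n).filter fun i => I.testBit i = true) := by
        intro u hu v hv _
        obtain ⟨hu1, hu2⟩ := mem_filter.1 hu
        obtain ⟨hv1, hv2⟩ := mem_filter.1 hv
        have h3 := allN_eq_true h1 u (mem_range.1 hu1)
        rw [tb_eq, hu2, cond_true] at h3
        have h4 : row E u &&& I = 0 := Nat.eq_of_beq_eq_true h3
        have h5 := congrArg (fun x => x.testBit v) h4
        simp only [Nat.testBit_and, hv2, Bool.and_true, Nat.zero_testBit] at h5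
        rwa [testBit_row ((mem_range.1 hv1).trans_le hn)] at h5
      by_cases hX : ∃ v, v < n ∧ I.testBit v = true ∧ X v
      · classical
        obtain ⟨v, hv, hmax⟩ := ((range n).filter fun v => I.testBit v = true ∧ X v).exists_max_image
          id (by
            obtain ⟨v, h3, h4⟩ := hX
            exact ⟨v, mem_filter.2 ⟨mem_range.2 h3, h4⟩⟩)
        obtain ⟨hvn, hvI, hvX⟩ := mem_filter.1 hv
        obtain ⟨c', rest', r', h3⟩ := forN_some n h v (mem_range.1 hvn)
        rw [tb_eq, tb_eq, hvI, cond_true] at h3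
        cases hvB : B.testBit v
        swap
        · exact absurd hvX (hB v hvB)
        rw [hvB, cond_false] at h3
        refine ih _ _ _ _ _ h3 ?_ ?_
        · intro i hi
          rcases (testBit_lor_shiftLeft_one _ _ _).1 hi with hi | rfl
          exacts [hA i hi, ⟨hvX, mem_range.1 hvn⟩]
        · intro i hi hiX
          have hi' : (B ||| (I >>> (v + 1)) <<< (v + 1)).testBit i = true := hi
          rw [Nat.testBit_or, Bool.or_eq_true, Nat.testBit_shiftLeft, Nat.testBit_shiftRight,
            Bool.and_eq_true, decide_eq_true_iff] at hi'
          rcases hi' with hi' | ⟨hi1, hi2⟩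
          · exact hB i hi' hiX
          · rw [show v + 1 + (i - (v + 1)) = i by omega] at hi2
            have := hmax i (mem_filter.2 ⟨mem_range.2 (hIn i hi2), hi2, hiX⟩)
            simp only [id] at this
            omega
      · refine Or.inr ⟨_, filter_subset _ _, fun i hi hiX => hX ?_, hI, h2⟩
        obtain ⟨h3, h4⟩ := mem_filter.1 hi
        exact ⟨i, mem_range.1 h3, h4, hiX⟩

theorem indArrow_of_splitOk {E n s t : ℕ} {code : List ℕ} (hE : SymE n E) (hn : n ≤ 32)
    (hs : 1 ≤ s) (h : splitOk E n s t code = true) : IndArrow E n s t := by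
  intro X
  unfold splitOk at h
  match hr : split E n s t 200 0 0 1 code with
  | none => rw [hr] at h; cases h
  | some r => exact split_sound hE hn hs X _ _ _ _ _ _ hr (by simp) (by simp)

end Folkman

namespace Folkman

open Finset

/-! ### The upper bound -/

/-- The join of a complete graph on `k` vertices and the complement of the graph with adjacency
matrix `E`. -/
def joinCompl (k n E : ℕ) : SimpleGraph (Fin (k + n)) where
  Adj x y := x ≠ y ∧ (x.val < k ∨ y.val < k ∨
    hasE E (x.val - k) (y.val - k) = false ∧ hasE E (y.val - k) (x.val - k) = false)
  symm := ⟨fun x y h => ⟨h.1.symm, by have := h.2; tauto⟩⟩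
  loopless := ⟨fun x h => h.1 rfl⟩

theorem joinCompl_cliqueFree {k n E p : ℕ}
    (hp : ∀ S ⊆ range n, IndE E S → S.card ≤ p) : (joinCompl k n E).CliqueFree (k + p + 1) := by
  intro T hT
  have h1 : (T.filter fun x => x.val < k).card ≤ k := by
    rw [← card_map Fin.valEmbedding]
    refine (card_le_card ?_).trans (card_range k).le
    intro i hi
    obtain ⟨x, hx, rfl⟩ := mem_map.1 hi
    exact mem_range.2 (mem_filter.1 hx).2
  have hinj : Set.InjOn (fun x : Fin (k + n) => x.val - k) (T.filter fun x => ¬ x.val < k) := by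
    intro x hx y hy hxy
    have hx' := (mem_filter.1 (mem_coe.1 hx)).2
    have hy' := (mem_filter.1 (mem_coe.1 hy)).2
    have hxy' : x.val - k = y.val - k := hxy
    exact Fin.ext (by omega)
  have h2 := hp ((T.filter fun x => ¬ x.val < k).image fun x => x.val - k) ?_ ?_
  · rw [card_image_of_injOn hinj] at h2
    have := card_filter_add_card_filter_not (s := T) (fun x => x.val < k)
    have := hT.2
    omega
  · intro i hi
    obtain ⟨x, hx, rfl⟩ := mem_image.1 hi
    have := (mem_filter.1 hx).2
    exact mem_range.2 (by omega)
  · intro u hu v hv huv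
    obtain ⟨x, hx, rfl⟩ := mem_image.1 hu
    obtain ⟨y, hy, rfl⟩ := mem_image.1 hv
    obtain ⟨hx1, hx2⟩ := mem_filter.1 hx
    obtain ⟨hy1, hy2⟩ := mem_filter.1 hy
    have := (hT.1 (mem_coe.2 hx1) (mem_coe.2 hy1) (fun h => huv (by rw [h]))).2
    tauto

/-- The number of vertices of the complete part of color `i`. -/
def headCount {k n l : ℕ} (c : Fin (k + n) → Fin l) (i : Fin l) : ℕ :=
  (univ.filter fun j : Fin k => c (Fin.castAdd n j) = i).card

theorem sum_headCount {k n l : ℕ} (c : Fin (k + n) → Fin l) : ∑ i, headCount c i = k := by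
  have := card_eq_sum_card_fiberwise (s := (univ : Finset (Fin k))) (t := univ)
    (f := fun j => c (Fin.castAdd n j)) (fun _ _ => mem_univ _)
  rw [card_fin] at this
  exact this.symm

theorem exists_clique_of_ind {k n l E q : ℕ} (c : Fin (k + n) → Fin l) (i : Fin l)
    {S : Finset ℕ} (hS : S ⊆ range n) (hE : IndE E S)
    (hc : ∀ j : Fin n, j.val ∈ S → c (Fin.natAdd k j) = i) (hq : q ≤ headCount c i + S.card) :
    ∃ T : Finset (Fin (k + n)), (joinCompl k n E).IsNClique q T ∧ ∀ v ∈ T, c v = i := by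
  let T₁ : Finset (Fin (k + n)) :=
    (univ.filter fun j : Fin k => c (Fin.castAdd n j) = i).map (Fin.castAddEmb n)
  let T₂ : Finset (Fin (k + n)) := (univ.filter fun j : Fin n => j.val ∈ S).map (Fin.natAddEmb k)
  have h1 : ∀ x ∈ T₁, x.val < k ∧ c x = i := by
    intro x hx
    obtain ⟨j, hj, rfl⟩ := mem_map.1 hx
    exact ⟨j.isLt, (mem_filter.1 hj).2⟩
  have h2 : ∀ x ∈ T₂, k ≤ x.val ∧ x.val - k ∈ S ∧ c x = i := by
    intro x hx
    obtain ⟨j, hj, rfl⟩ := mem_map.1 hx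
    have hj' := (mem_filter.1 hj).2
    refine ⟨Nat.le_add_right _ _, ?_, hc j hj'⟩
    show k + j.val - k ∈ S
    rwa [Nat.add_sub_cancel_left]
  have hdis : Disjoint T₁ T₂ := by
    rw [disjoint_left]
    intro x hx hx'
    have := (h1 x hx).1
    have := (h2 x hx').1
    omega
  have hcl : (joinCompl k n E).IsClique ((T₁ ∪ T₂ : Finset _) : Set (Fin (k + n))) := by
    intro x hx y hy hxy
    refine ⟨hxy, ?_⟩
    rcases mem_union.1 (mem_coe.1 hx) with hx | hx
    · exact Or.inl (h1 x hx).1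
    rcases mem_union.1 (mem_coe.1 hy) with hy | hy
    · exact Or.inr (Or.inl (h1 y hy).1)
    have hx' := h2 x hx
    have hy' := h2 y hy
    have hne : x.val - k ≠ y.val - k := fun h => hxy (Fin.ext (by omega))
    exact Or.inr (Or.inr ⟨hE _ hx'.2.1 _ hy'.2.1 hne, hE _ hy'.2.1 _ hx'.2.1 hne.symm⟩)
  have hcard : (T₁ ∪ T₂).card = headCount c i + S.card := by
    rw [card_union_of_disjoint hdis, card_map, card_map]
    congr 1
    rw [← card_map Fin.valEmbedding]
    congr 1
    ext v
    simp only [mem_map, mem_filter, mem_univ, true_and, Fin.valEmbedding_apply]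
    exact ⟨fun ⟨j, hj, h⟩ => h ▸ hj, fun h => ⟨⟨v, mem_range.1 (hS h)⟩, h, rfl⟩⟩
  obtain ⟨T, hT, hTc⟩ := exists_subset_card_eq (hq.trans hcard.ge)
  refine ⟨T, ⟨hcl.subset (coe_subset.2 hT), hTc⟩, fun v hv => ?_⟩
  rcases mem_union.1 (hT hv) with h | h
  exacts [(h1 v h).2, (h2 v h).2.2]

theorem exists_clique_of_colors {k n l E : ℕ} (c : Fin (k + n) → Fin l) (q : Fin l → ℕ)
    (P : Finset (Fin l)) {S : Finset ℕ} (hS : S ⊆ range n) (hE : IndE E S)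
    (hc : ∀ j : Fin n, j.val ∈ S → c (Fin.natAdd k j) ∈ P)
    (hcard : ∑ i ∈ P, (q i - 1 - headCount c i) < S.card) :
    ∃ i, ∃ T : Finset (Fin (k + n)), (joinCompl k n E).IsNClique (q i) T ∧ ∀ v ∈ T, c v = i := by
  let S' : Finset (Fin n) := univ.filter fun j => j.val ∈ S
  have hS' : S'.map Fin.valEmbedding = S := by
    ext v
    simp only [S', mem_map, mem_filter, mem_univ, true_and, Fin.valEmbedding_apply]
    exact ⟨fun ⟨j, hj, h⟩ => h ▸ hj, fun h => ⟨⟨v, mem_range.1 (hS h)⟩, h, rfl⟩⟩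
  have hmem : ∀ j ∈ S', c (Fin.natAdd k j) ∈ P := fun j hj => hc j (mem_filter.1 hj).2
  rw [← hS', card_map, card_eq_sum_card_fiberwise hmem] at hcard
  obtain ⟨i, -, hi⟩ := exists_lt_of_sum_lt hcard
  refine ⟨i, exists_clique_of_ind c i
    (S := (S'.filter fun j => c (Fin.natAdd k j) = i).map Fin.valEmbedding) ?_ ?_ ?_ ?_⟩
  · exact (map_subset_map.2 (filter_subset _ _)).trans (hS'.trans_subset hS)
  · exact hE.mono ((map_subset_map.2 (filter_subset _ _)).trans hS'.subset)
  · intro j hj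
    obtain ⟨j', hj', h⟩ := mem_map.1 hj
    have : j' = j := Fin.ext h
    exact this ▸ (mem_filter.1 hj').2
  · rw [card_map]
    omega

theorem exists_clique_of_indArrow {k n l E s t : ℕ} (hE : IndArrow E n s t)
    (c : Fin (k + n) → Fin l) (q : Fin l → ℕ) (P : Finset (Fin l))
    (hs : ∑ i ∈ P, (q i - 1 - headCount c i) < s)
    (ht : ∑ i ∈ Pᶜ, (q i - 1 - headCount c i) < t) :
    ∃ i, ∃ T : Finset (Fin (k + n)), (joinCompl k n E).IsNClique (q i) T ∧ ∀ v ∈ T, c v = i := by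
  rcases hE (fun v => ∃ h : v < n, c (Fin.natAdd k ⟨v, h⟩) ∈ P) with
    ⟨S, h1, h2, h3, h4⟩ | ⟨S, h1, h2, h3, h4⟩
  · exact exists_clique_of_colors c q P h1 h3 (fun j hj => (h2 _ hj).2) (hs.trans_le h4)
  · exact exists_clique_of_colors c q Pᶜ h1 h3
      (fun j hj => mem_compl.2 fun h => h2 _ hj ⟨j.isLt, h⟩) (ht.trans_le h4)

theorem exists_subset_sum_mem_Icc {ι : Type*} [DecidableEq ι] (b : ι → ℕ) (hb : ∀ i, b i ≤ 6)
    (U : Finset ι) : ∑ i ∈ U, b i < 3 ∨ ∃ P ⊆ U, 3 ≤ ∑ i ∈ P, b i ∧ ∑ i ∈ P, b i ≤ 6 := by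
  induction U using Finset.induction_on with
  | empty => exact Or.inl (by simp)
  | insert i U hi ih =>
    rcases ih with h | ⟨P, hP, h⟩
    · by_cases h3 : 3 ≤ b i
      · exact Or.inr ⟨{i}, by simp, by simpa using ⟨h3, hb i⟩⟩
      · have := sum_insert (f := b) hi
        by_cases h4 : ∑ i ∈ insert i U, b i < 3
        · exact Or.inl h4
        · exact Or.inr ⟨_, Subset.rfl, by omega, by omega⟩
    · exact Or.inr ⟨P, hP.trans (subset_insert _ _), h⟩

theorem exists_sum_eq_three_or_four {ι : Type*} [Fintype ι] [DecidableEq ι] (b : ι → ℕ)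
    (hb : ∀ i, b i ≤ 6) (h9 : ∑ i, b i = 9) :
    ∃ P : Finset ι, (∑ i ∈ P, b i = 3 ∧ ∑ i ∈ Pᶜ, b i = 6) ∨
      (∑ i ∈ P, b i = 4 ∧ ∑ i ∈ Pᶜ, b i = 5) := by
  obtain h | ⟨P, -, h⟩ := exists_subset_sum_mem_Icc b hb univ
  · omega
  have := sum_add_sum_compl P b
  by_cases h4 : ∑ i ∈ P, b i ≤ 4
  · exact ⟨P, by omega⟩
  · exact ⟨Pᶜ, by rw [compl_compl]; omega⟩

theorem vArrow_joinCompl_of_sum_eq {a : List ℕ} (hmax : ∀ x ∈ a, x ≤ 7)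
    {k n E : ℕ} (h₁ : IndArrow E n 4 7) (h₂ : IndArrow E n 5 6)
    (hk : (a.map (· - 1)).sum = k + 9) : VArrow (joinCompl k n E) a := by
  intro c
  by_cases hbig : ∃ i, a.get i ≤ headCount c i
  · obtain ⟨i, hi⟩ := hbig
    exact ⟨i, exists_clique_of_ind c i (S := ∅) (by simp) (fun u hu => by simp at hu)
      (fun j hj => by simp at hj) (by simpa using hi)⟩
  push Not at hbig
  have hsum : ∑ i, (a.get i - 1 - headCount c i) = 9 := by
    have h1 : ∑ i, (a.get i - 1 - headCount c i) + ∑ i, headCount c i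
        = ∑ i, (a.get i - 1) := by
      rw [← sum_add_distrib]
      refine sum_congr rfl fun i _ => ?_
      have := hbig i
      omega
    rw [sum_headCount, sum_get_sub_one, hk] at h1
    omega
  obtain ⟨P, h | h⟩ := exists_sum_eq_three_or_four (fun i => a.get i - 1 - headCount c i)
    (fun i => by have := hmax _ (a.get_mem i); omega) hsum
  · exact exists_clique_of_indArrow h₁ c a.get P (by omega) (by omega)
  · exact exists_clique_of_indArrow h₂ c a.get P (by omega) (by omega)

theorem vArrow_joinCompl_zero {a : List ℕ} (h7 : 7 ∈ a) {n E : ℕ} (h : IndArrow E n 3 7)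
    (hk : (a.map (· - 1)).sum = 8) : VArrow (joinCompl 0 n E) a := by
  intro c
  obtain ⟨i₀, hi₀⟩ := List.mem_iff_get.1 h7
  have h0 : ∀ i, headCount c i = 0 := fun i => by simp [headCount]
  have hsum := sum_add_sum_compl {i₀} fun i => a.get i - 1
  rw [sum_get_sub_one, hk, sum_singleton, hi₀] at hsum
  refine exists_clique_of_indArrow h c a.get {i₀}ᶜ ?_ ?_
  · simp only [h0, Nat.sub_zero]; omega
  · rw [compl_compl, sum_singleton, hi₀, h0]; norm_num

theorem exists_vArrow (a : List ℕ) (hmax : ∀ x ∈ a, x ≤ 7) (h7 : 7 ∈ a)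
    {m : ℕ} (hm : m = (a.map (· - 1)).sum + 1) (hm9 : 9 ≤ m) :
    ∃ G : SimpleGraph (Fin (m + 12)), G.CliqueFree (m - 1) ∧ VArrow G a := by
  have s21 := symE_eq_true sym21_ok
  have s22 := symE_eq_true sym22_ok
  rcases hm9.eq_or_lt with rfl | hm10
  · rw [show 9 + 12 = 0 + 21 from rfl]
    refine ⟨joinCompl 0 21 edges21, ?_, vArrow_joinCompl_zero h7
      (indArrow_of_splitOk s21 (by norm_num) (by norm_num) split21_ok) (by omega)⟩
    exact joinCompl_cliqueFree (p := 7) fun S hS hi =>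
      Nat.lt_succ_iff.1 (card_lt_of_ind s21 (by norm_num) ind21_ok hS hi)
  · obtain ⟨k, rfl⟩ := Nat.exists_eq_add_of_le' hm10
    rw [show k + (9 + 1) + 12 = k + 22 by omega, show k + (9 + 1) - 1 = k + 8 + 1 by omega]
    refine ⟨joinCompl k 22 edges22, ?_, vArrow_joinCompl_of_sum_eq hmax
      (indArrow_of_splitOk s22 (by norm_num) (by norm_num) split22a_ok)
      (indArrow_of_splitOk s22 (by norm_num) (by norm_num) split22b_ok) (by omega)⟩
    exact joinCompl_cliqueFree (p := 8) fun S hS hi =>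
      Nat.lt_succ_iff.1 (card_lt_of_ind s22 (by norm_num) ind22_ok hS hi)

end Folkman

/-- If `max{a₁, …, aₛ} = 7` and `m = Σ (aᵢ − 1) + 1 ≥ 9`, then
`m + 10 ≤ F_v(a₁, …, aₛ; m − 1) ≤ m + 12`. -/
theorem folkman_max_seven_bounds (a : List ℕ) (hpos : ∀ x ∈ a, 0 < x)
    (hmax : ∀ x ∈ a, x ≤ 7) (h7 : 7 ∈ a)
    (m : ℕ) (hm : m = (a.map (· - 1)).sum + 1) (hm9 : 9 ≤ m) :
    m + 10 ≤ folkman a (m - 1) ∧ folkman a (m - 1) ≤ m + 12 := by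
  have hex := Folkman.exists_vArrow a hmax h7 hm hm9
  constructor
  · obtain ⟨G, hG, hA⟩ := Nat.sInf_mem (s := {n : ℕ | ∃ G : SimpleGraph (Fin n),
      G.CliqueFree (m - 1) ∧ VArrow G a}) ⟨_, hex⟩
    exact Folkman.add_ten_le_of_vArrow hpos h7 hm hm9 hG hA
  · exact Nat.sInf_le hex
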